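/- Let p be a prime with p ≠ 3, and for m ∈ ℕ let SL₃^m(ℤ_p) denote the m-th principal congruence subgroup of SL₃(ℤ_p), i.e. the kernel of the reduction map SL₃(ℤ_p) → SL₃(ℤ/p^mℤ). Set u(X) = X³ + X² − X − 1 − X^{−1}. Then there exists M ∈ ℕ such that for all m ≥ M and all real s > 2/3, the following convergent series identity holds: ∑_{n≥1} rₙ(SL₃^m(ℤ_p))·n^{−s} = p^{8m}·(1 + u(p)·p^{−3−2s} + u(p^{−1})·p^{−2−3s} + p^{−5−5s}) / ((1 − p^{1−2s})(1 − p^{2−3s})). -/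

import Mathlib

open scoped MatrixGroups

/-- A submodule `W` of `ℂ^n` is invariant under a matrix representation `ρ` if it is stable
under the action of every `ρ g`. -/
def RepInvariant {G : Type*} [Group G] {n : ℕ} (ρ : G →* GL (Fin n) ℂ)
    (W : Submodule ℂ (Fin n → ℂ)) : Prop :=
  ∀ g : G, ∀ v ∈ W, Matrix.mulVec (ρ g : Matrix (Fin n) (Fin n) ℂ) v ∈ W

/-- A matrix representation `ρ : G →* GLₙ(ℂ)` is irreducible if the associated `ℂG`-module
`ℂ^n` is simple, i.e. nonzero and without proper nonzero invariant submodules. -/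
def RepIsIrreducible {G : Type*} [Group G] {n : ℕ} (ρ : G →* GL (Fin n) ℂ) : Prop :=
  (⊥ : Submodule ℂ (Fin n → ℂ)) ≠ ⊤ ∧
    ∀ W : Submodule ℂ (Fin n → ℂ), RepInvariant ρ W → W = ⊥ ∨ W = ⊤

/-- Two matrix representations are isomorphic if they are conjugate by an element of
`GLₙ(ℂ)`. -/
def RepIso {G : Type*} [Group G] {n : ℕ} (ρ₁ ρ₂ : G →* GL (Fin n) ℂ) : Prop :=
  ∃ T : GL (Fin n) ℂ, ∀ g : G, T * ρ₁ g * T⁻¹ = ρ₂ g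

/-- A matrix representation of a topological group is continuous if it is continuous into
`GLₙ(ℂ)` with its standard topology, i.e. the map on matrix entries is continuous. -/
def RepContinuous {G : Type*} [Group G] [TopologicalSpace G] {n : ℕ}
    (ρ : G →* GL (Fin n) ℂ) : Prop :=
  Continuous fun g : G => (ρ g : Matrix (Fin n) (Fin n) ℂ)

/-- `rₙ(G)` for a topological group `G`: the number of isomorphism classes of continuous
`n`-dimensional irreducible complex representations of `G`. -/
noncomputable def contIrrRepCount (G : Type*) [Group G] [TopologicalSpace G] (n : ℕ) : ℕ :=
  Nat.card (Quot fun ρ₁ ρ₂ : {ρ : G →* GL (Fin n) ℂ // RepContinuous ρ ∧ RepIsIrreducible ρ} =>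
    RepIso ρ₁.1 ρ₂.1)

/-- The special linear group over a topological ring carries the topology induced from the
space of matrices. -/
noncomputable instance (n : Type*) [DecidableEq n] [Fintype n]
    (R : Type*) [CommRing R] [TopologicalSpace R] :
    TopologicalSpace (Matrix.SpecialLinearGroup n R) :=
  inferInstanceAs (TopologicalSpace {A : Matrix n n R // A.det = 1})

set_option linter.all false

section PartA

theorem trace_eq_sum_basis' {ι V : Type*} [Fintype ι] [DecidableEq ι] [AddCommGroup V] [Module ℂ V]
    (b : Module.Basis ι ℂ V) (T : V →ₗ[ℂ] V) :
    LinearMap.trace ℂ V T = ∑ i, b.repr (T (b i)) i := by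
  rw [LinearMap.trace_eq_matrix_trace ℂ b, Matrix.trace]
  simp [LinearMap.toMatrix_apply]

theorem trace_pi_matrix {κ : Type} [Fintype κ] [DecidableEq κ] {d : κ → ℕ}
    (T : (Π i, Matrix (Fin (d i)) (Fin (d i)) ℂ) →ₗ[ℂ] (Π i, Matrix (Fin (d i)) (Fin (d i)) ℂ)) :
    LinearMap.trace ℂ _ T = ∑ i, ∑ j, ∑ k, T (Pi.single i (Matrix.single j k 1)) i j k := by
  classical
  rw [trace_eq_sum_basis' (Pi.basis (fun i => Matrix.stdBasis ℂ (Fin (d i)) (Fin (d i)))),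
    Fintype.sum_sigma]
  refine Finset.sum_congr rfl fun i _ => ?_
  rw [Fintype.sum_prod_type]
  refine Finset.sum_congr rfl fun j _ => Finset.sum_congr rfl fun k _ => ?_
  rw [Pi.basis_repr, Pi.basis_apply, Matrix.stdBasis_eq_single]
  rfl

variable {Γ : Type*} [Group Γ] [Fintype Γ]

theorem trace_monoidAlgebra (T : MonoidAlgebra ℂ Γ →ₗ[ℂ] MonoidAlgebra ℂ Γ) :
    LinearMap.trace ℂ _ T = ∑ g, (T (MonoidAlgebra.single g 1)).coeff g := by
  classical
  rw [trace_eq_sum_basis' (Module.Basis.ofRepr (MonoidAlgebra.coeffLinearEquiv ℂ))]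
  refine Finset.sum_congr rfl fun i _ => ?_
  simp

theorem trace_fun {W : Type*} [Fintype W] [DecidableEq W] (T : (W → ℂ) →ₗ[ℂ] (W → ℂ)) :
    LinearMap.trace ℂ _ T = ∑ w, T (Pi.single w 1) w := by
  rw [trace_eq_sum_basis' (Pi.basisFun ℂ W)]
  simp

variable {κ : Type} [Fintype κ] [DecidableEq κ] {d : κ → ℕ} [∀ i, NeZero (d i)]
  (Φ : MonoidAlgebra ℂ Γ ≃ₐ[ℂ] Π i, Matrix (Fin (d i)) (Fin (d i)) ℂ)

include Φ in
theorem wed_trace (x : MonoidAlgebra ℂ Γ) :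
    ∑ i, (d i : ℂ) * (Φ x i).trace = (Fintype.card Γ : ℂ) * x.coeff 1 := by
  classical
  have h1 := trace_monoidAlgebra (LinearMap.mulLeft ℂ x)
  have h2 := trace_pi_matrix (d := d) (LinearMap.mulLeft ℂ (Φ x))
  have h3 : LinearMap.mulLeft ℂ (Φ x) = Φ.toLinearEquiv.conj (LinearMap.mulLeft ℂ x) := by
    refine LinearMap.ext fun y => ?_
    simp [LinearEquiv.conj_apply]
  rw [h3, LinearMap.trace_conj', h1] at h2
  have h4 : ∑ g : Γ, ((LinearMap.mulLeft ℂ x) (MonoidAlgebra.single g 1)).coeff g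
      = (Fintype.card Γ : ℂ) * x.coeff 1 := by
    simp [MonoidAlgebra.coeff_mul_single_apply]
  rw [← h4, h2, ← h3]
  refine Finset.sum_congr rfl fun i _ => ?_
  have : ∀ j k, (LinearMap.mulLeft ℂ (Φ x)) (Pi.single i (Matrix.single j k 1)) i j k = Φ x i j j := by
    intro j k
    simp
  simp_rw [this]
  simp [Matrix.trace, Finset.mul_sum]

/-- the representation of a block -/
noncomputable def blk (i : κ) (g : Γ) : Matrix (Fin (d i)) (Fin (d i)) ℂ := Φ (MonoidAlgebra.single g 1) i

theorem blk_mul (i : κ) (g h : Γ) : blk Φ i (g * h) = blk Φ i g * blk Φ i h := by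
  unfold blk
  rw [← Pi.mul_apply, ← map_mul, MonoidAlgebra.single_mul_single, one_mul]

theorem blk_one (i : κ) : blk Φ i 1 = 1 := by
  unfold blk
  rw [← MonoidAlgebra.one_def, map_one]; rfl

theorem blk_mul_inv (i : κ) (g : Γ) : blk Φ i g * blk Φ i g⁻¹ = 1 := by
  rw [← blk_mul, mul_inv_cancel, blk_one]
theorem blk_inv_mul (i : κ) (g : Γ) : blk Φ i g⁻¹ * blk Φ i g = 1 := by
  rw [← blk_mul, inv_mul_cancel, blk_one]

theorem eq_sum_single (x : MonoidAlgebra ℂ Γ) : x = ∑ g, x.coeff g • MonoidAlgebra.single g 1 := by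
  ext g
  classical
  simp [Finsupp.single_apply]

theorem apply_eq_sum_blk (x : MonoidAlgebra ℂ Γ) (i : κ) :
    Φ x i = ∑ g, x.coeff g • blk Φ i g := by
  conv_lhs => rw [eq_sum_single x]
  simp only [map_sum, map_smul, Finset.sum_apply, Pi.smul_apply, blk]

theorem wed_surj (i : κ) (M : Matrix (Fin (d i)) (Fin (d i)) ℂ) : ∃ x, Φ x i = M := by
  classical
  exact ⟨Φ.symm (Pi.single i M), by simp⟩

/-- commuting with all of the block implies scalar -/
theorem scalar_of_commute {k : ℕ} [NeZero k] (M : Matrix (Fin k) (Fin k) ℂ)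
    (h : ∀ N, M * N = N * M) : M = (M.trace / k) • 1 := by
  have := Matrix.mem_range_scalar_of_commute_single (M := M) (fun i j _ => (h _).symm)
  obtain ⟨c, rfl⟩ := this
  have hk : (k : ℂ) ≠ 0 := by exact_mod_cast NeZero.ne k
  simp only [Matrix.scalar_apply, Matrix.trace_diagonal, Finset.sum_const, Finset.card_univ,
    Fintype.card_fin, nsmul_eq_mul]
  rw [mul_div_cancel_left₀ _ hk]
  exact (Matrix.smul_one_eq_diagonal c).symm

theorem scalar_of_commute_blk (i : κ) (M : Matrix (Fin (d i)) (Fin (d i)) ℂ)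
    (h : ∀ g, M * blk Φ i g = blk Φ i g * M) : M = (M.trace / d i) • 1 := by
  apply scalar_of_commute
  intro N
  obtain ⟨x, rfl⟩ := wed_surj Φ i N
  rw [apply_eq_sum_blk]
  simp only [Finset.mul_sum, Finset.sum_mul, Matrix.mul_smul, Matrix.smul_mul, h]

theorem schur_avg (i : κ) (M : Matrix (Fin (d i)) (Fin (d i)) ℂ) :
    ∑ g, blk Φ i g * M * blk Φ i g⁻¹ = ((Fintype.card Γ : ℂ) * M.trace / d i) • 1 := by
  have := scalar_of_commute_blk Φ i (∑ g, blk Φ i g * M * blk Φ i g⁻¹) (by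
    intro h
    rw [Finset.mul_sum, Finset.sum_mul]
    refine Fintype.sum_equiv (Equiv.mulLeft h⁻¹) _ _ fun g => ?_
    simp only [Equiv.coe_mulLeft, mul_inv_rev, inv_inv, blk_mul]
    rw [show blk Φ i h * (blk Φ i h⁻¹ * blk Φ i g * M * (blk Φ i g⁻¹ * blk Φ i h))
      = (blk Φ i h * blk Φ i h⁻¹) * blk Φ i g * M * (blk Φ i g⁻¹ * blk Φ i h) by
        simp only [mul_assoc], blk_mul_inv]
    simp only [mul_assoc, one_mul])
  rw [this]
  congr 2
  rw [Matrix.trace_sum]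
  simp [Matrix.trace_mul_cycle, blk_inv_mul]

/-- sum of all commutators -/
noncomputable def commSum (Γ : Type*) [Group Γ] [Fintype Γ] : MonoidAlgebra ℂ Γ :=
  ∑ g : Γ, ∑ h : Γ, MonoidAlgebra.single (g * (h * g⁻¹ * h⁻¹)) 1

theorem commSum_block (i : κ) :
    Φ (commSum Γ) i = (((Fintype.card Γ : ℂ) / d i) ^ 2) • 1 := by
  have h1 : Φ (commSum Γ) i = ∑ g : Γ, blk Φ i g * (∑ h : Γ, blk Φ i h * blk Φ i g⁻¹ * blk Φ i h⁻¹) := by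
    unfold commSum
    simp only [map_sum, Finset.sum_apply, Finset.mul_sum, ← blk_mul]
    rfl
  rw [h1]
  simp only [schur_avg]
  ext a b
  have h2 := fun k => congrFun (congrFun (schur_avg Φ i (Matrix.single b k 1)) a) k
  have h3 : ∀ k, ∑ g, blk Φ i g a b * blk Φ i g⁻¹ k k =
    ((Fintype.card Γ : ℂ) * (Matrix.single b k (1:ℂ)).trace / d i) * (1 : Matrix _ _ ℂ) a k := by
    intro k
    rw [← smul_eq_mul, ← Matrix.smul_apply, ← h2 k, Matrix.sum_apply]
    refine Finset.sum_congr rfl fun g _ => ?_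
    simp [Matrix.mul_apply, Matrix.single_apply, ite_and]
  rw [Matrix.sum_apply]
  simp only [Matrix.mul_smul, Matrix.mul_one, Matrix.smul_apply, smul_eq_mul]
  have h4 : ∑ g, (Fintype.card Γ : ℂ) * (blk Φ i g⁻¹).trace / d i * blk Φ i g a b
     = (Fintype.card Γ : ℂ) / d i * ∑ k, ∑ g, blk Φ i g a b * blk Φ i g⁻¹ k k := by
    rw [Finset.sum_comm, Finset.mul_sum]
    refine Finset.sum_congr rfl fun g _ => ?_
    rw [← Finset.mul_sum, Matrix.trace]
    simp only [Matrix.diag]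
    ring
  rw [h4]
  simp only [h3]
  rw [Finset.sum_eq_single b]
  · simp; ring
  · intro k _ hk
    rw [Matrix.trace_single_eq_of_ne _ _ _ hk.symm]; simp
  · simp

end PartA

section PartB

/-- Data for the orbit method. -/
structure OrbData (Γ 𝔤 H : Type) [Group Γ] [Fintype Γ] [AddCommGroup 𝔤] [Fintype 𝔤] [Group H] where
  ℓ : Γ ≃ 𝔤
  l_one : ℓ 1 = 0
  aΓ : H →* MulAut Γ
  ag : H →* AddMonoid.End 𝔤
  l_act : ∀ h γ, ℓ (aΓ h γ) = ag h (ℓ γ)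
  ι : Γ →* H
  i_conj : ∀ g x, aΓ (ι g) x = g * x * g⁻¹
  i_act : ∀ h g, ι (aΓ h g) = h * ι g * h⁻¹
  N : AddSubgroup 𝔤
  N_act : ∀ h, ∀ v ∈ N, ag h v ∈ N
  N_comm : ∀ g h : Γ, ℓ (g * (h * g⁻¹ * h⁻¹)) ∈ N
  N_sub : ∀ γ v, ag (ι γ) v - v ∈ N
  mul : ∀ f1 f2 : MonoidAlgebra ℂ Γ, (∀ g x, f1.coeff (g * x * g⁻¹) = f1.coeff x) →
    (∀ h x, f2.coeff (aΓ h x) = f2.coeff x) → (∀ x, ℓ x ∉ N → f2.coeff x = 0) →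
    ∀ ω : AddChar 𝔤 ℂ, ∑ g, (f1 * f2).coeff g * ω (ℓ g) =
      (∑ g, f1.coeff g * ω (ℓ g)) * ∑ g, f2.coeff g * ω (ℓ g)

variable {Γ 𝔤 H : Type} [Group Γ] [Fintype Γ] [AddCommGroup 𝔤] [Fintype 𝔤] [Group H]
  (D : OrbData Γ 𝔤 H)

namespace OrbData

/-- Fourier transform -/
noncomputable def F (x : MonoidAlgebra ℂ Γ) (ω : AddChar 𝔤 ℂ) : ℂ := ∑ g, x.coeff g * ω (D.ℓ g)

/-- inverse Fourier transform -/
noncomputable def Fi (φ : AddChar 𝔤 ℂ → ℂ) : MonoidAlgebra ℂ Γ :=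
  MonoidAlgebra.ofCoeff (Finsupp.equivFunOnFinite.symm fun g =>
    (Fintype.card Γ : ℂ)⁻¹ * ∑ ω : AddChar 𝔤 ℂ, φ ω * ω (-D.ℓ g))

theorem Fi_coeff (φ : AddChar 𝔤 ℂ → ℂ) (g : Γ) : (D.Fi φ).coeff g =
    (Fintype.card Γ : ℂ)⁻¹ * ∑ ω : AddChar 𝔤 ℂ, φ ω * ω (-D.ℓ g) := by
  simp [Fi]

theorem card_ne : (Fintype.card Γ : ℂ) ≠ 0 := by
  exact_mod_cast Fintype.card_ne_zero

include D in
theorem card_eq : Fintype.card Γ = Fintype.card 𝔤 := Fintype.card_congr D.ℓ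

theorem Fi_F (x : MonoidAlgebra ℂ Γ) : D.Fi (D.F x) = x := by
  classical
  ext g
  rw [Fi_coeff]
  unfold F
  simp only [Finset.sum_mul]
  rw [Finset.sum_comm]
  simp only [mul_assoc, ← AddChar.map_add_eq_mul, ← Finset.mul_sum, AddChar.sum_apply_eq_ite]
  rw [Finset.sum_eq_single g]
  · rw [if_pos (by simp), ← D.card_eq]
    field_simp [card_ne (Γ := Γ)]
  · intro b _ hb
    rw [if_neg, mul_zero]
    intro h
    apply hb
    apply D.ℓ.injective
    exact add_neg_eq_zero.mp h
  · simp

theorem F_Fi (φ : AddChar 𝔤 ℂ → ℂ) : D.F (D.Fi φ) = φ := by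
  classical
  ext ω
  unfold F
  simp only [Fi_coeff, mul_assoc, ← Finset.mul_sum]
  simp only [Finset.sum_mul]
  rw [Finset.sum_comm]
  have : ∀ χ : AddChar 𝔤 ℂ, ∑ g : Γ, φ χ * χ (-D.ℓ g) * ω (D.ℓ g) =
     if ω = χ then (Fintype.card Γ : ℂ) * φ χ else 0 := by
    intro χ
    rw [← Equiv.sum_comp D.ℓ.symm]
    simp only [Equiv.apply_symm_apply, mul_assoc, ← Finset.mul_sum]
    have h2 : ∀ x, χ (-x) * ω x = (ω * χ⁻¹) x := by
      intro x; rw [AddChar.mul_apply, AddChar.inv_apply, mul_comm]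
    simp only [h2]
    rw [AddChar.sum_eq_ite, D.card_eq]
    by_cases h : ω = χ
    · rw [if_pos h, if_pos]
      · ring
      · rw [h]; exact mul_inv_cancel χ
    · rw [if_neg h, if_neg, mul_zero]
      intro h'; exact h (mul_inv_eq_one.mp h')
  simp only [this]
  simp [card_ne]

/-- Fourier transform as linear equivalence -/
noncomputable def FE : MonoidAlgebra ℂ Γ ≃ₗ[ℂ] (AddChar 𝔤 ℂ → ℂ) where
  toFun := D.F
  invFun := D.Fi
  left_inv := D.Fi_F
  right_inv := D.F_Fi
  map_add' x y := by
    ext ω; simp [F, add_mul, Finset.sum_add_distrib]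
  map_smul' c x := by
    ext ω; simp [F, mul_assoc, Finset.mul_sum]

/-- pull back of a character -/
noncomputable def pull (h : H) (ω : AddChar 𝔤 ℂ) : AddChar 𝔤 ℂ :=
  ω.compAddMonoidHom (D.ag h)

@[simp] theorem pull_apply (h : H) (ω : AddChar 𝔤 ℂ) (v : 𝔤) : D.pull h ω v = ω (D.ag h v) := rfl

theorem ag_inv (h : H) (v : 𝔤) : D.ag h⁻¹ (D.ag h v) = v := by
  have : D.ag h⁻¹ (D.ag h v) = D.ag (h⁻¹ * h) v := by rw [map_mul]; rfl
  rw [this]; simp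
theorem ag_inv' (h : H) (v : 𝔤) : D.ag h (D.ag h⁻¹ v) = v := by
  have : D.ag h (D.ag h⁻¹ v) = D.ag (h * h⁻¹) v := by rw [map_mul]; rfl
  rw [this]; simp
theorem ag_mul (h k : H) (v : 𝔤) : D.ag (h * k) v = D.ag h (D.ag k v) := by
  rw [map_mul]; rfl

/-- pull as equivalence -/
noncomputable def pullE (h : H) : AddChar 𝔤 ℂ ≃ AddChar 𝔤 ℂ where
  toFun := D.pull h
  invFun := D.pull h⁻¹
  left_inv ω := by ext v; simp [ag_inv']
  right_inv ω := by ext v; simp [ag_inv]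

/-- H-invariance, support -/
def Good (x : MonoidAlgebra ℂ Γ) : Prop :=
  (∀ h g, x.coeff (D.aΓ h g) = x.coeff g) ∧ (∀ g, D.ℓ g ∉ D.N → x.coeff g = 0)

/-- relation -/
noncomputable def st' : Setoid (AddChar 𝔤 ℂ) where
  r ω ω' := ∃ h, ∀ v ∈ D.N, ω' v = ω (D.ag h v)
  iseqv := {
    refl := fun ω => ⟨1, fun v _ => by simp⟩
    symm := by
      rintro ω ω' ⟨h, hh⟩
      refine ⟨h⁻¹, fun v hv => ?_⟩
      rw [hh _ (D.N_act _ _ hv), ag_inv']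
    trans := by
      rintro a b c ⟨h, hh⟩ ⟨k, hk⟩
      refine ⟨h * k, fun v hv => ?_⟩
      rw [hk _ hv, hh _ (D.N_act _ _ hv), ag_mul] }

theorem F_good {x : MonoidAlgebra ℂ Γ} (hx : D.Good x) {ω ω' : AddChar 𝔤 ℂ} (h : D.st'.r ω ω') :
    D.F x ω' = D.F x ω := by
  obtain ⟨h, hh⟩ := h
  unfold F
  refine Fintype.sum_equiv (D.aΓ h).toEquiv _ _ fun g => ?_
  simp only [MulEquiv.toEquiv_eq_coe, EquivLike.coe_coe, hx.1, D.l_act]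
  by_cases hg : D.ℓ g ∈ D.N
  · rw [hh _ hg]
  · rw [hx.2 _ hg]; simp

theorem Fi_good (φ : AddChar 𝔤 ℂ → ℂ) (hφ : ∀ ω ω', D.st'.r ω ω' → φ ω = φ ω') : D.Good (D.Fi φ) := by
  constructor
  · intro h g
    rw [Fi_coeff, Fi_coeff]
    congr 1
    refine Fintype.sum_equiv (D.pullE h) _ _ fun ω => ?_
    simp only [pullE, Equiv.coe_fn_mk, pull_apply, D.l_act, map_neg]
    congr 1
    exact hφ _ _ ⟨h, fun v _ => rfl⟩
  · intro g hg
    have : ∃ χ : AddChar 𝔤 ℂ, (∀ v ∈ D.N, χ v = 1) ∧ χ (-D.ℓ g) ≠ 1 := by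
      have h0 : (QuotientAddGroup.mk (-D.ℓ g) : 𝔤 ⧸ D.N) ≠ 0 := by
        intro h
        rw [QuotientAddGroup.eq_zero_iff] at h
        exact hg (by simpa using h)
      obtain ⟨ψ, hψ⟩ := AddChar.exists_apply_ne_zero.mpr h0
      refine ⟨ψ.compAddMonoidHom (QuotientAddGroup.mk' D.N), fun v hv => ?_, hψ⟩
      rw [AddChar.compAddMonoidHom_apply]
      rw [show (QuotientAddGroup.mk' D.N) v = 0 from (QuotientAddGroup.eq_zero_iff v).mpr hv]
      simp
    obtain ⟨χ, h1, h2⟩ := this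
    rw [Fi_coeff]
    have h3 : ∑ ω : AddChar 𝔤 ℂ, φ ω * ω (-D.ℓ g) = χ (-D.ℓ g) * ∑ ω : AddChar 𝔤 ℂ, φ ω * ω (-D.ℓ g) := by
      rw [Finset.mul_sum]
      refine (Fintype.sum_equiv (Equiv.mulLeft χ) _ _ fun ω => ?_).symm
      simp only [Equiv.coe_mulLeft, AddChar.mul_apply]
      rw [hφ ω (χ * ω) ⟨1, fun v hv => by simp [AddChar.mul_apply, h1 v hv]⟩]
      ring
    have h4 : (χ (-D.ℓ g) - 1) * ∑ ω : AddChar 𝔤 ℂ, φ ω * ω (-D.ℓ g) = 0 := by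
      rw [sub_mul, ← h3]; ring
    rcases mul_eq_zero.mp h4 with h | h
    · exact absurd (sub_eq_zero.mp h) h2
    · rw [h, mul_zero]

theorem Good.cls {x : MonoidAlgebra ℂ Γ} (hx : D.Good x) (g y : Γ) : x.coeff (g * y * g⁻¹) = x.coeff y := by
  rw [← D.i_conj, hx.1]

theorem F_mul {x y : MonoidAlgebra ℂ Γ} (hx : ∀ g z, x.coeff (g * z * g⁻¹) = x.coeff z)
    (hy : D.Good y) (ω) : D.F (x * y) ω = D.F x ω * D.F y ω := D.mul x y hx hy.1 hy.2 ω

theorem commSum_good : D.Good (commSum Γ) := by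
  classical
  constructor
  · intro h g
    unfold commSum
    simp only [MonoidAlgebra.coeff_sum, MonoidAlgebra.coeff_single, Finsupp.finsetSum_apply,
      Finsupp.single_apply]
    symm
    refine Fintype.sum_equiv (D.aΓ h).toEquiv _ _ fun a => ?_
    refine Fintype.sum_equiv (D.aΓ h).toEquiv _ _ fun b => ?_
    simp only [MulEquiv.toEquiv_eq_coe, EquivLike.coe_coe, ← map_inv, ← map_mul,
      EmbeddingLike.apply_eq_iff_eq]
  · intro g hg
    unfold commSum
    simp only [MonoidAlgebra.coeff_sum, MonoidAlgebra.coeff_single, Finsupp.finsetSum_apply,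
      Finsupp.single_apply]
    refine Finset.sum_eq_zero fun a _ => Finset.sum_eq_zero fun b _ => ?_
    rw [if_neg]
    rintro rfl
    exact hg (D.N_comm a b)

/-- stabilizer size -/
noncomputable def stab (ω : AddChar 𝔤 ℂ) : ℕ := Nat.card {γ : Γ // ∀ v, ω (D.ag (D.ι γ) v) = ω v}

theorem stab_eq {ω ω' : AddChar 𝔤 ℂ} (h : D.st'.r ω ω') : D.stab ω' = D.stab ω := by
  obtain ⟨h, hh⟩ := h
  have key : ∀ (χ : AddChar 𝔤 ℂ) a b, χ a = χ b ↔ χ (a - b) = 1 := by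
    intro χ a b
    rw [AddChar.map_sub_eq_div, div_eq_one_iff_eq]
    exact (AddChar.val_isUnit χ b).ne_zero
  refine Nat.card_congr ((D.aΓ h).toEquiv.subtypeEquiv fun γ => ?_)
  simp only [MulEquiv.toEquiv_eq_coe, EquivLike.coe_coe, D.i_act]
  have h1 : ∀ v, ω' (D.ag (D.ι γ) v) = ω' v ↔
      ω (D.ag (h * D.ι γ * h⁻¹) (D.ag h v)) = ω (D.ag h v) := by
    intro v
    rw [key, key, hh _ (D.N_sub _ _), map_sub, ag_mul, ag_mul, ag_inv]
  simp only [h1]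
  exact ⟨fun H v => by simpa [ag_inv'] using H (D.ag h⁻¹ v), fun H v => H _⟩

theorem F_one : D.F 1 = fun _ => 1 := by
  classical
  ext ω
  unfold F
  rw [Finset.sum_eq_single 1]
  · simp [MonoidAlgebra.one_def, D.l_one]
  · intro b _ hb
    simp [MonoidAlgebra.one_def, Finsupp.single_apply, hb.symm]
  · simp


theorem cls_comm {x : MonoidAlgebra ℂ Γ} (hx : ∀ g z, x.coeff (g * z * g⁻¹) = x.coeff z)
    (y : MonoidAlgebra ℂ Γ) : x * y = y * x := by
  rw [eq_sum_single y, Finset.mul_sum, Finset.sum_mul]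
  refine Finset.sum_congr rfl fun g _ => ?_
  rw [mul_smul_comm, smul_mul_assoc]
  congr 1
  ext z
  rw [MonoidAlgebra.coeff_mul_single_apply, MonoidAlgebra.coeff_single_mul_apply, mul_one, one_mul,
    ← hx g⁻¹]
  congr 1
  group

/-- orbit idempotent -/
noncomputable def e (O : Quotient D.st') : MonoidAlgebra ℂ Γ :=
  open Classical in D.Fi fun ω => if Quotient.mk D.st' ω = O then 1 else 0

open Classical in
theorem F_e (O : Quotient D.st') (ω) : D.F (D.e O) ω = if Quotient.mk D.st' ω = O then 1 else 0 := by
  unfold e; rw [F_Fi]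

theorem e_good (O : Quotient D.st') : D.Good (D.e O) := by
  classical
  apply Fi_good
  intro ω ω' h
  rw [show Quotient.mk D.st' ω = Quotient.mk D.st' ω' from Quotient.sound h]

theorem F_inj {x y : MonoidAlgebra ℂ Γ} (h : ∀ ω, D.F x ω = D.F y ω) : x = y := by
  rw [← D.Fi_F x, ← D.Fi_F y, funext h]

open Classical in
theorem e_mul (O O' : Quotient D.st') : D.e O * D.e O' = if O = O' then D.e O else 0 := by
  apply D.F_inj
  intro ω
  rw [D.F_mul (D.e_good O).cls (D.e_good O'), F_e, F_e]
  split_ifs with h1 h2 h3 h4 h5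
  · rw [F_e, if_pos h1]; simp
  · exact absurd (h1.symm.trans h2) h3
  · exact absurd (h1.trans h4) h2
  · simp [F]
  · exact absurd (h5.trans (Eq.symm ‹O = O'›)) h1
  · simp [F]
  · rw [F_e, if_neg h1]; simp
  · simp [F]

theorem e_sum : ∑ᶠ O, D.e O = 1 := by
  classical
  haveI : Fintype (Quotient D.st') := Fintype.ofFinite _
  rw [finsum_eq_sum_of_fintype]
  apply D.F_inj
  intro ω
  rw [F_one]
  have : D.F (∑ O, D.e O) = ∑ O, D.F (D.e O) := map_sum D.FE _ _
  rw [this, Finset.sum_apply]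
  simp [F_e]

variable {κ : Type} [Fintype κ] [DecidableEq κ] {d : κ → ℕ} [∀ i, NeZero (d i)]
  (Φ : MonoidAlgebra ℂ Γ ≃ₐ[ℂ] Π i, Matrix (Fin (d i)) (Fin (d i)) ℂ)

theorem cls_scalar {x : MonoidAlgebra ℂ Γ} (hx : ∀ g z, x.coeff (g * z * g⁻¹) = x.coeff z) (i : κ) :
    ∃ c : ℂ, Φ x i = c • 1 := by
  refine ⟨_, scalar_of_commute_blk Φ i _ fun g => ?_⟩
  unfold blk
  rw [← Pi.mul_apply, ← Pi.mul_apply, ← map_mul, ← map_mul, cls_comm hx]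

theorem smul_one_inj {k : ℕ} [NeZero k] {a b : ℂ}
    (h : a • (1 : Matrix (Fin k) (Fin k) ℂ) = b • 1) : a = b := by
  have := congrFun (congrFun h 0) 0
  simpa using this

open Classical in
theorem exists_tau : ∃ τ : κ → Quotient D.st', ∀ i O, Φ (D.e O) i = if τ i = O then 1 else 0 := by
  haveI : Fintype (Quotient D.st') := Fintype.ofFinite _
  suffices h : ∀ i, ∃ O', ∀ O, Φ (D.e O) i = if O' = O then 1 else 0 by
    choose τ hτ using h; exact ⟨τ, hτ⟩
  intro i
  choose s hs using fun O => cls_scalar Φ (D.e_good O).cls i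
  have h1 : ∀ O O', s O * s O' = if O = O' then s O else 0 := by
    intro O O'
    apply smul_one_inj (k := d i)
    have := congrFun (congrArg Φ (D.e_mul O O')) i
    rw [map_mul, Pi.mul_apply, hs, hs] at this
    rw [smul_mul_smul_comm, mul_one] at this
    rw [this]
    split_ifs
    · exact hs O
    · simp
  have h2 : ∑ O, s O = 1 := by
    apply smul_one_inj (k := d i)
    have := D.e_sum
    rw [finsum_eq_sum_of_fintype] at this
    have := congrFun (congrArg Φ this) i
    rw [map_sum, Finset.sum_apply, map_one] at this
    simp only [hs] at this
    rw [Finset.sum_smul, this, one_smul]; rfl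
  obtain ⟨O', hO'⟩ : ∃ O', s O' ≠ 0 := by
    by_contra! h
    simp [h] at h2
  refine ⟨O', fun O => ?_⟩
  rw [hs]
  by_cases h : O' = O
  · subst h
    have := h1 O' O'
    rw [if_pos rfl] at this
    rw [if_pos rfl, mul_left_cancel₀ hO' (this.trans (mul_one _).symm), one_smul]
  · have := h1 O' O
    rw [if_neg h] at this
    rw [if_neg h, (mul_eq_zero.mp this).resolve_left hO', zero_smul]

variable {τ : κ → Quotient D.st'}
open Classical in
theorem d_const (hτ : ∀ i O, Φ (D.e O) i = if τ i = O then 1 else 0) (i j : κ) (h : τ i = τ j) :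
    d i = d j := by
  obtain ⟨ω, hω⟩ := Quotient.exists_rep (τ i)
  have h1 : D.e (τ i) * commSum Γ = D.F (commSum Γ) ω • D.e (τ i) := by
    apply D.F_inj
    intro ω'
    rw [D.F_mul (D.e_good _).cls D.commSum_good]
    have : D.F (D.F (commSum Γ) ω • D.e (τ i)) = D.F (commSum Γ) ω • D.F (D.e (τ i)) := map_smul D.FE _ _
    rw [this, Pi.smul_apply, F_e, ← hω]
    split_ifs with h
    · rw [D.F_good D.commSum_good (Quotient.exact h)]; simp
    · simp
  have key : ∀ k, τ k = τ i → ((Fintype.card Γ : ℂ) / d k) ^ 2 = D.F (commSum Γ) ω := by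
    intro k hk
    have h2 := congrFun (congrArg Φ h1) k
    rw [map_mul, map_smul, Pi.mul_apply, Pi.smul_apply, hτ, if_pos hk, commSum_block, one_mul] at h2
    exact smul_one_inj h2
  have h3 := (key i rfl).trans (key j h.symm).symm
  have hi : (d i : ℂ) ≠ 0 := by exact_mod_cast NeZero.ne (d i)
  have hj : (d j : ℂ) ≠ 0 := by exact_mod_cast NeZero.ne (d j)
  have hc := card_ne (Γ := Γ)
  field_simp at h3
  have h4 : (d j) ^ 2 = (d i) ^ 2 := by exact_mod_cast h3
  exact (Nat.pow_left_injective (n := 2) (by norm_num) h4).symm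

open Classical in
theorem sum_d (hτ : ∀ i O, Φ (D.e O) i = if τ i = O then 1 else 0) (O : Quotient D.st') :
    ∑ i with τ i = O, (d i) ^ 2 = Finset.card {ω : AddChar 𝔤 ℂ | Quotient.mk D.st' ω = O} := by
  have h := wed_trace Φ (D.e O)
  simp only [hτ] at h
  rw [e, Fi_coeff, D.l_one] at h
  have hc := card_ne (Γ := Γ)
  rw [mul_inv_cancel_left₀ hc] at h
  simp only [neg_zero, AddChar.map_zero_eq_one, mul_one, Finset.sum_boole] at h
  have h5 : ∑ i with τ i = O, (d i : ℂ) ^ 2 = ∑ i, (d i : ℂ) * (if τ i = O then (1 : Matrix (Fin (d i)) (Fin (d i)) ℂ) else 0).trace := by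
    rw [Finset.sum_filter]
    refine Finset.sum_congr rfl fun i _ => ?_
    split_ifs
    · simp [pow_two]
    · simp
  rw [← h5] at h
  exact_mod_cast h

/-- the averaging operator -/
noncomputable def avgOp (O : Quotient D.st') : MonoidAlgebra ℂ Γ →ₗ[ℂ] MonoidAlgebra ℂ Γ :=
  LinearMap.mulLeft ℂ (D.e O) ∘ₗ ∑ γ : Γ, LinearMap.mulLeft ℂ (MonoidAlgebra.single γ 1) ∘ₗ
    LinearMap.mulRight ℂ (MonoidAlgebra.single γ⁻¹ 1)

theorem avgOp_apply (O : Quotient D.st') (x) : D.avgOp O x = D.e O * ∑ γ : Γ,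
    MonoidAlgebra.single γ 1 * (x * MonoidAlgebra.single γ⁻¹ 1) := by
  simp [avgOp, Finset.mul_sum]

open Classical in
theorem trace_block (hτ : ∀ i O, Φ (D.e O) i = if τ i = O then 1 else 0) (O : Quotient D.st') :
    LinearMap.trace ℂ _ (D.avgOp O) = (Fintype.card Γ : ℂ) * Finset.card {i | τ i = O} := by
  rw [← LinearMap.trace_conj' (D.avgOp O) Φ.toLinearEquiv, trace_pi_matrix]
  have h1 : ∀ M i, Φ.toLinearEquiv.conj (D.avgOp O) M i =
      (if τ i = O then ((Fintype.card Γ : ℂ) * (M i).trace / d i) else 0) • 1 := by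
    intro M i
    rw [LinearEquiv.conj_apply]
    have : Φ (D.avgOp O (Φ.symm M)) i =
      (if τ i = O then ((Fintype.card Γ : ℂ) * (M i).trace / d i) else 0) • 1 := by
      rw [avgOp_apply, map_mul, Pi.mul_apply, hτ, map_sum, Finset.sum_apply]
      simp only [map_mul, Pi.mul_apply, AlgEquiv.apply_symm_apply, ← mul_assoc]
      have := schur_avg Φ i (M i)
      unfold blk at this
      rw [this]
      split_ifs <;> simp
    exact this
  simp only [h1]
  have h2 : ∀ i, ∑ j : Fin (d i), ∑ k : Fin (d i), ((if τ i = O then ((Fintype.card Γ : ℂ) *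
     ((Pi.single i (Matrix.single j k 1) : Π i, Matrix (Fin (d i)) (Fin (d i)) ℂ) i).trace / d i) else 0) • (1 : Matrix (Fin (d i)) (Fin (d i)) ℂ)) j k
     = if τ i = O then (Fintype.card Γ : ℂ) else 0 := by
    intro i
    have hi : (d i : ℂ) ≠ 0 := by exact_mod_cast NeZero.ne (d i)
    split_ifs
    · have h3 : ∀ j : Fin (d i), ∑ k : Fin (d i), (((Fintype.card Γ : ℂ) *
        ((Pi.single i (Matrix.single j k 1) : Π i, Matrix (Fin (d i)) (Fin (d i)) ℂ) i).trace / d i) • (1 : Matrix (Fin (d i)) (Fin (d i)) ℂ)) j k = Fintype.card Γ / d i := by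
        intro j
        rw [Finset.sum_eq_single j]
        · simp
        · intro k _ hk
          simp [Matrix.one_apply_ne hk.symm]
        · simp
      simp only [h3]
      simp
      field_simp
    · simp
  simp only [h2]
  rw [Finset.sum_ite]
  simp [mul_comm]

theorem F_conj (γ : Γ) (x : MonoidAlgebra ℂ Γ) (ω) :
    D.F (MonoidAlgebra.single γ 1 * (x * MonoidAlgebra.single γ⁻¹ 1)) ω = D.F x (D.pull (D.ι γ) ω) := by
  unfold F
  symm
  refine Fintype.sum_equiv (D.aΓ (D.ι γ)).toEquiv _ _ fun g => ?_
  simp only [MulEquiv.toEquiv_eq_coe, EquivLike.coe_coe, D.l_act, pull_apply]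
  rw [MonoidAlgebra.coeff_single_mul_apply, MonoidAlgebra.coeff_mul_single_apply, D.i_conj]
  simp [mul_assoc]

open Classical in
theorem trace_four (O : Quotient D.st') :
    LinearMap.trace ℂ _ (D.avgOp O) = ∑ ω : AddChar 𝔤 ℂ with Quotient.mk D.st' ω = O, (D.stab ω : ℂ) := by
  rw [← LinearMap.trace_conj' (D.avgOp O) D.FE, trace_fun, Finset.sum_filter]
  refine Finset.sum_congr rfl fun ω _ => ?_
  rw [LinearEquiv.conj_apply]
  have h1 : ∀ x, D.F (D.avgOp O x) ω = (if Quotient.mk D.st' ω = O then 1 else 0) *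
      ∑ γ, D.F x (D.pull (D.ι γ) ω) := by
    intro x
    have hc : D.e O * ∑ γ : Γ, MonoidAlgebra.single γ 1 * (x * MonoidAlgebra.single γ⁻¹ 1) =
       (∑ γ : Γ, MonoidAlgebra.single γ 1 * (x * MonoidAlgebra.single γ⁻¹ 1)) * D.e O := by
      apply cls_comm
      exact (D.e_good O).cls
    rw [avgOp_apply, hc, D.F_mul _ (D.e_good O), F_e, mul_comm]
    · congr 1
      have : D.F (∑ γ : Γ, MonoidAlgebra.single γ 1 * (x * MonoidAlgebra.single γ⁻¹ 1)) =
        ∑ γ : Γ, D.F (MonoidAlgebra.single γ 1 * (x * MonoidAlgebra.single γ⁻¹ 1)) := map_sum D.FE _ _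
      rw [this, Finset.sum_apply]
      simp only [F_conj]
    · intro g z
      simp only [MonoidAlgebra.coeff_sum, Finsupp.finsetSum_apply,
        MonoidAlgebra.coeff_single_mul_apply, MonoidAlgebra.coeff_mul_single_apply, one_mul, mul_one]
      refine Fintype.sum_equiv (Equiv.mulLeft g⁻¹) _ _ fun γ => ?_
      simp [mul_assoc]
  have h2 : (D.FE ((D.avgOp O) (D.FE.symm (Pi.single ω 1)))) ω = if Quotient.mk D.st' ω = O then (D.stab ω : ℂ) else 0 := by
    change D.F (D.avgOp O (D.Fi (Pi.single ω 1))) ω = _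
    rw [h1, F_Fi]
    split_ifs
    · simp only [Pi.single_apply, Finset.sum_boole, one_mul]
      unfold stab
      rw [Nat.card_eq_fintype_card, Fintype.card_subtype]
      congr 2
      ext γ
      simp only [Finset.mem_filter, Finset.mem_univ, true_and]
      exact DFunLike.ext_iff
    · simp
  exact h2

theorem stab_pos (ω) : 0 < D.stab ω := by
  unfold stab
  haveI : Nonempty {γ : Γ // ∀ v, ω (D.ag (D.ι γ) v) = ω v} := ⟨⟨1, fun v => by simp⟩⟩
  exact Nat.card_pos

include Φ in
theorem main (f : ℝ → ℝ) : ∑ i, f (d i ^ 2) =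
    ∑ ω, f ((Fintype.card Γ : ℝ) / D.stab ω) * (D.stab ω / Fintype.card Γ) := by
  classical
  obtain ⟨τ, hτ⟩ := D.exists_tau Φ
  haveI : Fintype (Quotient D.st') := Fintype.ofFinite _
  rw [← Finset.sum_fiberwise Finset.univ τ, ← Finset.sum_fiberwise Finset.univ (Quotient.mk D.st')]
  refine Finset.sum_congr rfl fun O _ => ?_
  obtain ⟨ω, rfl⟩ := Quotient.exists_rep O
  set O := Quotient.mk D.st' ω with hO
  have h1 : ∀ ω' ∈ ({ω' | Quotient.mk D.st' ω' = O} : Finset _), D.stab ω' = D.stab ω := by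
    intro ω' h
    simp only [Finset.mem_filter, Finset.mem_univ, true_and] at h
    exact (D.stab_eq (Quotient.exact h)).symm
  have h2 := D.sum_d Φ hτ O
  have h3 := (D.trace_block Φ hτ O).symm.trans (D.trace_four O)
  rw [Finset.sum_congr rfl (fun ω' h => by rw [h1 ω' h] : ∀ ω' ∈ ({ω' | Quotient.mk D.st' ω' = O} : Finset _), (D.stab ω' : ℂ) = D.stab ω), Finset.sum_const, nsmul_eq_mul] at h3
  rw [Finset.sum_congr rfl (fun ω' h => by rw [h1 ω' h] : ∀ ω' ∈ ({ω' | Quotient.mk D.st' ω' = O} : Finset _), f ((Fintype.card Γ : ℝ) / D.stab ω') * (D.stab ω' / Fintype.card Γ) = f ((Fintype.card Γ : ℝ) / D.stab ω) * (D.stab ω / Fintype.card Γ)), Finset.sum_const, nsmul_eq_mul]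
  have h3' : Fintype.card Γ * Finset.card {i | τ i = O} = Finset.card {ω' | Quotient.mk D.st' ω' = O} * D.stab ω := by
    exact_mod_cast h3
  have hpos : 0 < Finset.card {ω' | Quotient.mk D.st' ω' = O} :=
    Finset.card_pos.mpr ⟨ω, by simp [hO]⟩
  have hst := D.stab_pos ω
  have hΓ : 0 < Fintype.card Γ := Fintype.card_pos
  have hS : 0 < Finset.card {i | τ i = O} := by
    apply Nat.pos_of_ne_zero
    intro h
    rw [h, mul_zero] at h3'
    have := Nat.mul_pos hpos hst
    omega
  obtain ⟨i, hi⟩ := Finset.card_pos.mp hS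
  have h4 : ∀ j ∈ ({i | τ i = O} : Finset κ), d j = d i := by
    intro j hj
    simp only [Finset.mem_filter, Finset.mem_univ, true_and] at hi hj
    exact D.d_const Φ hτ j i (hj.trans hi.symm)
  rw [Finset.sum_congr rfl (fun j h => by rw [h4 j h] : ∀ j ∈ ({i | τ i = O} : Finset κ), d j ^ 2 = d i ^ 2), Finset.sum_const, smul_eq_mul] at h2
  rw [Finset.sum_congr rfl (fun j h => by rw [h4 j h] : ∀ j ∈ ({i | τ i = O} : Finset κ), f (d j ^ 2) = f (d i ^ 2)), Finset.sum_const, nsmul_eq_mul]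
  have hΓ' : (Fintype.card Γ : ℝ) ≠ 0 := by positivity
  have hst' : (D.stab ω : ℝ) ≠ 0 := by positivity
  have hS' : (Finset.card {i | τ i = O} : ℝ) ≠ 0 := by positivity
  have h5 : (d i : ℝ) ^ 2 = Fintype.card Γ / D.stab ω := by
    rw [eq_div_iff hst']
    have h2' : (Finset.card {i | τ i = O} : ℝ) * (d i : ℝ) ^ 2 = Finset.card {ω' | Quotient.mk D.st' ω' = O} := by exact_mod_cast h2
    have h3'' : (Fintype.card Γ : ℝ) * Finset.card {i | τ i = O} = Finset.card {ω' | Quotient.mk D.st' ω' = O} * D.stab ω := by exact_mod_cast h3'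
    rw [← h2'] at h3''
    apply mul_left_cancel₀ hS'
    linarith
  have h6 : (Finset.card {i | τ i = O} : ℝ) = Finset.card {ω' | Quotient.mk D.st' ω' = O} * (D.stab ω / Fintype.card Γ) := by
    field_simp
    have h3'' : (Fintype.card Γ : ℝ) * Finset.card {i | τ i = O} = Finset.card {ω' | Quotient.mk D.st' ω' = O} * D.stab ω := by exact_mod_cast h3'
    linarith
  rw [h5, h6]
  ring

end OrbData
end PartB

section PartC

/-- all classes of continuous irreducible representations -/
def IrrAll (K : Type) [Group K] [TopologicalSpace K] : Type :=
  Σ n : ℕ, Quot fun ρ₁ ρ₂ : {ρ : K →* GL (Fin n) ℂ // RepContinuous ρ ∧ RepIsIrreducible ρ} =>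
    RepIso ρ₁.1 ρ₂.1

/-- character -/
noncomputable def irrTrace {K : Type} [Group K] [TopologicalSpace K] (x : IrrAll K) (k : K) : ℂ :=
  Quot.lift (fun ρ : {ρ : K →* GL (Fin x.1) ℂ // RepContinuous ρ ∧ RepIsIrreducible ρ} =>
    ((ρ.1 k : GL (Fin x.1) ℂ) : Matrix (Fin x.1) (Fin x.1) ℂ).trace) (by
    rintro ρ₁ ρ₂ ⟨T, hT⟩
    rw [← hT k]
    simp only [Units.val_mul]
    rw [Matrix.trace_mul_cycle, ← Units.val_mul]
    simp) x.2

variable {G : Type} [Group G] [Fintype G] {κ : Type} [Fintype κ] [DecidableEq κ] {d : κ → ℕ}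
  [∀ i, NeZero (d i)] (Φ : MonoidAlgebra ℂ G ≃ₐ[ℂ] Π i, Matrix (Fin (d i)) (Fin (d i)) ℂ)

/-- block representation into GL -/
noncomputable def blkGL (i : κ) : G →* GL (Fin (d i)) ℂ where
  toFun g := ⟨blk Φ i g, blk Φ i g⁻¹, blk_mul_inv Φ i g, blk_inv_mul Φ i g⟩
  map_one' := Units.ext (blk_one Φ i)
  map_mul' g h := Units.ext (blk_mul Φ i g h)

theorem blkGL_irr {K : Type} [Group K] (π : K →* G) (hπ : Function.Surjective π) (i : κ) :
    RepIsIrreducible ((blkGL Φ i).comp π) := by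
  have hne : ∃ v : Fin (d i) → ℂ, v ≠ 0 := ⟨fun _ => 1, fun h => by simpa using congrFun h 0⟩
  constructor
  · obtain ⟨v, hv⟩ := hne
    intro h
    exact hv ((Submodule.mem_bot ℂ).mp (h ▸ Submodule.mem_top))
  · intro W hW
    by_cases h0 : W = ⊥
    · exact Or.inl h0
    right
    obtain ⟨v, hvW, hv⟩ := W.exists_mem_ne_zero_of_ne_bot h0
    have hall : ∀ M : Matrix (Fin (d i)) (Fin (d i)) ℂ, M.mulVec v ∈ W := by
      intro M
      obtain ⟨x, rfl⟩ := wed_surj Φ i M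
      rw [apply_eq_sum_blk, Matrix.sum_mulVec]
      refine Submodule.sum_mem _ fun g _ => ?_
      rw [Matrix.smul_mulVec]
      apply Submodule.smul_mem
      obtain ⟨k, rfl⟩ := hπ g
      exact hW k v hvW
    rw [eq_top_iff]
    intro u _
    obtain ⟨j, hj⟩ := Function.ne_iff.mp hv
    have hj' : v j ≠ 0 := hj
    have : u = (Matrix.of fun a b => if b = j then u a / v j else 0).mulVec v := by
      ext a
      simp [Matrix.mulVec, dotProduct, hj']
    rw [this]
    exact hall _

theorem blk_trace_inj (i j : κ) (h : ∀ g, (blk Φ i g).trace = (blk Φ j g).trace) : i = j := by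
  by_contra hij
  have h1 : ∀ x, (Φ x i).trace = (Φ x j).trace := by
    intro x
    rw [apply_eq_sum_blk, apply_eq_sum_blk, Matrix.trace_sum, Matrix.trace_sum]
    simp [h]
  have := h1 (Φ.symm (Pi.single i 1))
  simp [Pi.single_eq_of_ne (Ne.symm hij)] at this
  exact NeZero.ne (d i) this

theorem irr_eq_block {n : ℕ} (ρ : G →* GL (Fin n) ℂ) (hρ : RepIsIrreducible ρ) :
    ∃ i : κ, ∃ h : d i = n, RepIso (h ▸ blkGL Φ i : G →* GL (Fin n) ℂ) ρ := by
  classical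
  let P : MonoidAlgebra ℂ G →ₐ[ℂ] Matrix (Fin n) (Fin n) ℂ :=
    MonoidAlgebra.lift ℂ (Matrix (Fin n) (Fin n) ℂ) G ((Units.coeHom _).comp ρ)
  have hP : ∀ g, P (MonoidAlgebra.single g 1) = (ρ g : Matrix (Fin n) (Fin n) ℂ) := by
    intro g; simp [P]
  let E : ∀ i : κ, Matrix (Fin (d i)) (Fin (d i)) ℂ → Matrix (Fin n) (Fin n) ℂ := fun i M =>
    P (Φ.symm (Pi.single i M))
  have E_add : ∀ i M N, E i (M + N) = E i M + E i N := by
    intro i M N; simp only [E]; rw [Pi.single_add, map_add, map_add]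
  have E_mul : ∀ i M N, E i (M * N) = E i M * E i N := by
    intro i M N; simp only [E]; rw [Pi.single_mul, map_mul, map_mul]
  have PE : ∀ i x N, P x * E i N = E i (Φ x i * N) := by
    intro i x N; simp only [E]; rw [← map_mul]; congr 1
    apply Φ.injective
    rw [map_mul, AlgEquiv.apply_symm_apply, AlgEquiv.apply_symm_apply]
    ext1 j
    by_cases h : j = i
    · subst h; simp
    · simp [Pi.single_eq_of_ne h]
  have hsum : ∑ i, E i 1 = 1 := by
    simp only [E]
    rw [← map_sum, ← map_sum]
    have : ∑ i, (Pi.single i 1 : Π i, Matrix (Fin (d i)) (Fin (d i)) ℂ) = 1 := Finset.univ_sum_single 1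
    rw [this, map_one, map_one]
  have hn : (1 : Matrix (Fin n) (Fin n) ℂ) ≠ 0 := by
    intro h
    apply hρ.1
    rw [eq_comm, eq_bot_iff]
    intro v _
    rw [Submodule.mem_bot, ← Matrix.one_mulVec v, h, Matrix.zero_mulVec]
  obtain ⟨i, hi⟩ : ∃ i, E i 1 ≠ 0 := by
    by_contra! h
    simp [h] at hsum
    exact hn hsum.symm
  refine ⟨i, ?_⟩
  have E_sum : ∀ (s : Finset (Fin (d i))) (f : Fin (d i) → Matrix (Fin (d i)) (Fin (d i)) ℂ), E i (∑ k ∈ s, f k) = ∑ k ∈ s, E i (f k) := by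
    intro s f
    exact map_sum (AddMonoidHom.mk' (E i) (E_add i)) f s
  have E_smul : ∀ (c : ℂ) M, E i (c • M) = c • E i M := by
    intro c M; simp only [E]; rw [Pi.single_smul, map_smul, map_smul]
  have h00 : E i (Matrix.single 0 0 1) ≠ 0 := by
    intro h
    apply hi
    have : (1 : Matrix (Fin (d i)) (Fin (d i)) ℂ) = ∑ k, Matrix.single k 0 1 * Matrix.single 0 0 1 * Matrix.single 0 k 1 := by
      simp [Matrix.sum_single_one]
    rw [this, E_sum]
    refine Finset.sum_eq_zero fun k _ => ?_
    rw [E_mul, E_mul, h]; simp only [mul_zero, zero_mul]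
  obtain ⟨w, hw⟩ : ∃ w, (E i (Matrix.single 0 0 1)).mulVec w ≠ 0 := by
    by_contra! h
    apply h00
    exact Matrix.ext_of_mulVec_single fun k => by rw [h, Matrix.zero_mulVec]
  set w0 := (E i (Matrix.single 0 0 1)).mulVec w with hw0
  let col : (Fin (d i) → ℂ) → Matrix (Fin (d i)) (Fin (d i)) ℂ := fun u => ∑ k, u k • Matrix.single k 0 1
  have col_mul : ∀ M u, M * col u = col (M.mulVec u) := by
    intro M u
    have hc : ∀ u a b, col u a b = if b = 0 then u a else 0 := by
      intro u a b
      simp only [col, Matrix.sum_apply, Matrix.smul_apply, Matrix.single_apply, smul_eq_mul]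
      by_cases h : b = 0
      · subst h; simp
      · simp [h, Ne.symm h]
    ext a b
    rw [Matrix.mul_apply]
    simp only [hc]
    by_cases h : b = 0
    · simp [h, Matrix.mulVec, dotProduct]
    · simp [h]
  let L : (Fin (d i) → ℂ) →ₗ[ℂ] (Fin n → ℂ) :=
    { toFun := fun u => (E i (col u)).mulVec w0
      map_add' := by
        intro u v
        rw [← Matrix.add_mulVec, ← E_add]
        congr 2
        simp only [col, Pi.add_apply, add_smul, Finset.sum_add_distrib]
      map_smul' := by
        intro c u
        simp only [RingHom.id_apply]
        rw [← Matrix.smul_mulVec, ← E_smul]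
        congr 2
        simp [col, Finset.smul_sum, mul_smul] }
  have L_app : ∀ u, L u = (E i (col u)).mulVec w0 := fun u => rfl
  have L_comm : ∀ g u, (ρ g : Matrix _ _ ℂ).mulVec (L u) = L ((blk Φ i g).mulVec u) := by
    intro g u
    rw [L_app, L_app, Matrix.mulVec_mulVec, ← hP, PE, col_mul]; rfl
  have L_inj : Function.Injective L := by
    rw [← LinearMap.ker_eq_bot, LinearMap.ker_eq_bot']
    intro u hu
    ext l
    have h1 : (E i (Matrix.single 0 l 1)).mulVec (L u) = u l • w0 := by
      rw [L_app, Matrix.mulVec_mulVec, ← E_mul]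
      have : Matrix.single 0 l 1 * col u = u l • Matrix.single 0 0 1 := by
        simp only [col, Finset.mul_sum]
        rw [Finset.sum_eq_single l]
        · simp
        · intro b _ hb
          simp [Matrix.single_mul_single_of_ne, Ne.symm hb]
        · simp
      rw [this, E_smul, Matrix.smul_mulVec, hw0, Matrix.mulVec_mulVec, ← E_mul]
      simp
    rw [hu, Matrix.mulVec_zero] at h1
    exact (smul_eq_zero.mp h1.symm).resolve_right hw
  have L_surj : Function.Surjective L := by
    rw [← LinearMap.range_eq_top]
    refine (hρ.2 (LinearMap.range L) ?_).resolve_left ?_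
    · rintro g _ ⟨u, rfl⟩
      exact ⟨_, (L_comm g u).symm⟩
    · intro h
      rw [LinearMap.range_eq_bot] at h
      have : (Pi.single 0 1 : Fin (d i) → ℂ) = 0 := L_inj (by rw [h]; simp)
      simpa using congrFun this 0
  let Le := LinearEquiv.ofBijective L ⟨L_inj, L_surj⟩
  have hd : d i = n := by simpa using Le.finrank_eq
  refine ⟨hd, ?_⟩
  subst hd
  let T : GL (Fin (d i)) ℂ := ⟨LinearMap.toMatrix' L, LinearMap.toMatrix' Le.symm.toLinearMap, by
      rw [← LinearMap.toMatrix'_comp]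
      have : L ∘ₗ Le.symm.toLinearMap = LinearMap.id := LinearMap.ext fun x => Le.apply_symm_apply x
      rw [this, LinearMap.toMatrix'_id], by
      rw [← LinearMap.toMatrix'_comp]
      have : Le.symm.toLinearMap ∘ₗ L = LinearMap.id := LinearMap.ext fun x => Le.symm_apply_apply x
      rw [this, LinearMap.toMatrix'_id]⟩
  refine ⟨T, fun g => ?_⟩
  rw [mul_inv_eq_iff_eq_mul]
  apply Units.ext
  rw [Units.val_mul, Units.val_mul]
  change LinearMap.toMatrix' L * blk Φ i g = (ρ g : Matrix _ _ ℂ) * LinearMap.toMatrix' L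
  apply Matrix.toLin'.injective
  rw [Matrix.toLin'_mul, Matrix.toLin'_mul, Matrix.toLin'_toMatrix']
  refine LinearMap.ext fun u => ?_
  simp only [LinearMap.comp_apply, Matrix.toLin'_apply]
  exact (L_comm g u).symm

theorem exists_phi {K : Type} [Group K] [TopologicalSpace K] (π : K →* G)
    (hπ : Function.Surjective π) (hc : ∀ i, RepContinuous ((blkGL Φ i).comp π)) :
    ∃ φ : κ → IrrAll K, Function.Injective φ ∧ (∀ i, (φ i).1 = d i) ∧
      ∀ (n : ℕ) (ρ : {ρ : K →* GL (Fin n) ℂ // RepContinuous ρ ∧ RepIsIrreducible ρ}),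
        (∀ k, π k = 1 → ρ.1 k = 1) → (⟨n, Quot.mk _ ρ⟩ : IrrAll K) ∈ Set.range φ := by
  refine ⟨fun i => ⟨d i, Quot.mk _ ⟨(blkGL Φ i).comp π, hc i, blkGL_irr Φ π hπ i⟩⟩, ?_, fun i => rfl, ?_⟩
  · intro i j h
    apply blk_trace_inj Φ
    intro g
    obtain ⟨k, rfl⟩ := hπ g
    exact congrArg (fun x => irrTrace x k) h
  · rintro n ⟨ρ, h1, h2⟩ hk
    let ρ' : G →* GL (Fin n) ℂ := π.liftOfSurjective hπ ⟨ρ, fun k hk' => hk k hk'⟩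
    have hρ' : ∀ k, ρ' (π k) = ρ k := fun k =>
      MonoidHom.liftOfRightInverse_comp_apply π _ _ ⟨ρ, fun k hk' => hk k hk'⟩ k
    have hirr : RepIsIrreducible ρ' := by
      refine ⟨h2.1, fun W hW => h2.2 W fun k v hv => ?_⟩
      rw [← hρ']; exact hW _ v hv
    obtain ⟨i, rfl, T, hT⟩ := irr_eq_block Φ ρ' hirr
    refine ⟨i, ?_⟩
    dsimp only
    congr 1
    apply Quot.sound
    exact ⟨T, fun k => by rw [← hρ']; exact hT _⟩

include Φ in
/-- blocks for a product with an abelian group -/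
theorem prod_blocks {A : Type} [CommGroup A] [Fintype A] {Γ : Type} [Group Γ] (e : G × A ≃* Γ) :
    Nonempty (MonoidAlgebra ℂ Γ ≃ₐ[ℂ] Π x : κ × AddChar (Additive A) ℂ,
      Matrix (Fin (d x.1)) (Fin (d x.1)) ℂ) := by
  classical
  let f : Γ →* Π x : κ × AddChar (Additive A) ℂ, Matrix (Fin (d x.1)) (Fin (d x.1)) ℂ :=
    { toFun := fun γ x => x.2 (Additive.ofMul (e.symm γ).2) • blk Φ x.1 (e.symm γ).1
      map_one' := by
        ext1 x
        simp [blk_one]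
      map_mul' := by
        intro a b
        ext1 x
        simp only [map_mul, Prod.snd_mul, Prod.fst_mul, ofMul_mul, AddChar.map_add_eq_mul, blk_mul,
          Pi.mul_apply, smul_mul_smul_comm] }
  haveI : Fintype Γ := Fintype.ofEquiv _ e.toEquiv
  let F := MonoidAlgebra.lift ℂ _ Γ f
  have hF : ∀ x y, F x y = ∑ γ, x.coeff γ • f γ y := by
    intro x y
    conv_lhs => rw [eq_sum_single x]
    simp [F]
  have hinj : Function.Injective F := by
    rw [injective_iff_map_eq_zero]
    intro x hx
    have h1 : ∀ χ : AddChar (Additive A) ℂ, ∀ g, ∑ a : A, x.coeff (e (g, a)) * χ (Additive.ofMul a) = 0 := by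
      intro χ
      let y : MonoidAlgebra ℂ G := MonoidAlgebra.ofCoeff (Finsupp.equivFunOnFinite.symm fun g =>
        ∑ a : A, x.coeff (e (g, a)) * χ (Additive.ofMul a))
      have hy : y = 0 := by
        apply Φ.injective
        rw [map_zero]
        ext1 i
        rw [apply_eq_sum_blk]
        have h2 := congrFun hx (i, χ)
        rw [hF, ← Equiv.sum_comp e.toEquiv, Fintype.sum_prod_type] at h2
        refine Eq.trans ?_ h2
        refine Finset.sum_congr rfl fun g _ => ?_
        simp [y, f, Finset.sum_smul, mul_smul]
      intro g
      have := congrArg (fun z => z.coeff g) hy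
      simpa [y] using this
    ext γ
    obtain ⟨⟨g, b⟩, rfl⟩ := e.surjective γ
    have h3 : ∑ χ : AddChar (Additive A) ℂ, (∑ a : A, x.coeff (e (g, a)) * χ (Additive.ofMul a)) * χ (-Additive.ofMul b) = 0 := by
      simp [h1]
    simp only [Finset.sum_mul] at h3
    rw [Finset.sum_comm] at h3
    simp only [mul_assoc, ← AddChar.map_add_eq_mul, ← Finset.mul_sum, AddChar.sum_apply_eq_ite] at h3
    rw [Finset.sum_eq_single b] at h3
    · rw [if_pos (by simp)] at h3
      exact (mul_eq_zero.mp h3).resolve_right (by exact_mod_cast Fintype.card_ne_zero)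
    · intro a _ ha
      rw [if_neg, mul_zero]
      intro h
      exact ha (Additive.ofMul.injective (add_neg_eq_zero.mp h))
    · simp
  have hdim : Module.finrank ℂ (MonoidAlgebra ℂ Γ) = Module.finrank ℂ (Π x : κ × AddChar (Additive A) ℂ,
      Matrix (Fin (d x.1)) (Fin (d x.1)) ℂ) := by
    have h4 : Module.finrank ℂ (MonoidAlgebra ℂ G) = Fintype.card G := by
      rw [(MonoidAlgebra.coeffLinearEquiv ℂ : MonoidAlgebra ℂ G ≃ₗ[ℂ] (G →₀ ℂ)).finrank_eq, Module.finrank_finsupp_self]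
    have h5 : Module.finrank ℂ (MonoidAlgebra ℂ Γ) = Fintype.card Γ := by
      rw [(MonoidAlgebra.coeffLinearEquiv ℂ : MonoidAlgebra ℂ Γ ≃ₗ[ℂ] (Γ →₀ ℂ)).finrank_eq, Module.finrank_finsupp_self]
    rw [Φ.toLinearEquiv.finrank_eq, Module.finrank_pi_fintype] at h4
    rw [h5, Module.finrank_pi_fintype, Fintype.sum_prod_type]
    change _ = ∑ x : κ, ∑ _y : AddChar (Additive A) ℂ, Module.finrank ℂ (Matrix (Fin (d x)) (Fin (d x)) ℂ)
    simp only [Finset.sum_const, Finset.card_univ, smul_eq_mul, AddChar.card_eq]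
    rw [← Finset.mul_sum, h4, ← Fintype.card_congr e.toEquiv, Fintype.card_prod, mul_comm,
      Fintype.card_congr (Additive.ofMul (α := A))]
  haveI : FiniteDimensional ℂ (MonoidAlgebra ℂ Γ) :=
    Module.Finite.equiv (MonoidAlgebra.coeffLinearEquiv ℂ : MonoidAlgebra ℂ Γ ≃ₗ[ℂ] (Γ →₀ ℂ)).symm
  have hbij : Function.Bijective F :=
    ⟨hinj, (LinearMap.injective_iff_surjective_of_finrank_eq_finrank hdim (f := F.toLinearMap)).mp hinj⟩
  exact ⟨AlgEquiv.ofBijective F hbij⟩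

end PartC

section PartD

/-- free algebra on two generators -/
abbrev FA (R : Type) [CommRing R] := MonoidAlgebra R (FreeMonoid Bool)

/-- divisibility by a scalar -/
def Dv {R B : Type} [CommRing R] [Ring B] [Algebra R B] (r : R) (f : B) : Prop := ∃ E, f = r • E

namespace Dv
variable {R B : Type} [CommRing R] [Ring B] [Algebra R B] {r s : R} {f g : B}

theorem zero : Dv r (0 : B) := ⟨0, by simp⟩
theorem add (h1 : Dv r f) (h2 : Dv r g) : Dv r (f + g) := by
  obtain ⟨a, rfl⟩ := h1; obtain ⟨b, rfl⟩ := h2; exact ⟨a + b, by simp⟩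
theorem neg (h1 : Dv r f) : Dv r (-f) := by
  obtain ⟨a, rfl⟩ := h1; exact ⟨-a, by simp⟩
theorem sub (h1 : Dv r f) (h2 : Dv r g) : Dv r (f - g) := by
  rw [sub_eq_add_neg]; exact h1.add h2.neg
theorem mul (h1 : Dv r f) (h2 : Dv s g) : Dv (r * s) (f * g) := by
  obtain ⟨a, rfl⟩ := h1; obtain ⟨b, rfl⟩ := h2; exact ⟨a * b, by rw [smul_mul_smul_comm]⟩
theorem mul_right (h1 : Dv r f) (g : B) : Dv r (f * g) := by
  obtain ⟨a, rfl⟩ := h1; exact ⟨a * g, by simp⟩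
theorem mul_left (h1 : Dv r f) (g : B) : Dv r (g * f) := by
  obtain ⟨a, rfl⟩ := h1; exact ⟨g * a, by simp⟩
theorem mono (h1 : Dv r f) (h : s ∣ r) : Dv s f := by
  obtain ⟨a, rfl⟩ := h1; obtain ⟨t, rfl⟩ := h; exact ⟨t • a, by rw [mul_smul]⟩
theorem smul (h1 : Dv r f) (s : R) : Dv (s * r) (s • f) := by
  obtain ⟨a, rfl⟩ := h1; exact ⟨a, by rw [mul_smul]⟩
theorem smul' (h1 : Dv r f) (s : R) : Dv r (s • f) := (h1.smul s).mono (Dvd.intro_left s rfl)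
theorem self (r : R) (f : B) : Dv r (r • f) := ⟨f, rfl⟩
theorem sum {ι : Type} (t : Finset ι) (F : ι → B) (h : ∀ i ∈ t, Dv r (F i)) : Dv r (∑ i ∈ t, F i) := by
  classical
  induction t using Finset.induction_on with
  | empty => simpa using zero
  | insert a s ha ih =>
    rw [Finset.sum_insert ha]
    exact (h a (by simp)).add (ih fun i hi => h i (by simp [hi]))
theorem pow_sub (h : Dv r (f - g)) (j : ℕ) : Dv r (f ^ j - g ^ j) := by
  induction j with
  | zero => simpa using zero
  | succ j ih =>
    have : f ^ (j+1) - g ^ (j+1) = (f ^ j - g ^ j) * f + g ^ j * (f - g) := by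
      rw [pow_succ, pow_succ]; noncomm_ring
    rw [this]
    exact (ih.mul_right f).add (h.mul_left _)
theorem one' : Dv (1 : R) f := ⟨f, by simp⟩
theorem unit_inv {a : Bˣ} (h : Dv r ((a : B) - 1)) : Dv r (((a⁻¹ : Bˣ) : B) - 1) := by
  have : ((a⁻¹ : Bˣ) : B) - 1 = -(((a⁻¹ : Bˣ) : B) * ((a : B) - 1)) := by
    rw [mul_sub, Units.inv_mul]; simp
  rw [this]
  exact (h.mul_left _).neg

end Dv

/-- conjugation lemma -/
theorem conj_step {R B : Type} [CommRing R] [Ring B] [Algebra R B] (r c p : R) (z0 Z X z : B) (a α : Bˣ)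
    (hz : z = c • (z0 + p • Z)) (hα : (α : B) = 1 - r • X) (ha : Dv p ((a : B) - 1))
    (hα' : Dv p ((α : B) - 1)) :
    Dv (r * c * p) ((((a * α : Bˣ) : B) * z * (((a * α)⁻¹ : Bˣ) : B)) - (a : B) * z * ((a⁻¹ : Bˣ) : B)
      - (r * c) • (z0 * X - X * z0)) := by
  set w := z0 * X - X * z0 with hw
  set W := Z * X - X * Z with hW
  have h1 : (α : B) * z * ((α⁻¹ : Bˣ) : B) - z = (r * c) • ((w + p • W) * ((α⁻¹ : Bˣ) : B)) := by
    have h2 : (α : B) * z - z * α = (r * c) • (w + p • W) := by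
      rw [hα, hz, hw, hW]
      simp only [sub_mul, mul_sub, one_mul, mul_one, smul_mul_assoc, mul_smul_comm, mul_add, add_mul,
        smul_add, smul_sub, smul_smul]
      simp only [mul_comm, mul_left_comm]
      abel
    have h3 : z = z * α * ((α⁻¹ : Bˣ) : B) := by rw [mul_assoc, Units.mul_inv, mul_one]
    have h3' : (α : B) * z * ((α⁻¹ : Bˣ) : B) - z = ((α : B) * z - z * α) * ((α⁻¹ : Bˣ) : B) := by
      rw [sub_mul, ← h3]
    rw [h3', h2, smul_mul_assoc]
  have h4 : (((a * α : Bˣ) : B) * z * (((a * α)⁻¹ : Bˣ) : B)) - (a : B) * z * ((a⁻¹ : Bˣ) : B)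
     = (r * c) • ((a : B) * ((w + p • W) * ((α⁻¹ : Bˣ) : B)) * ((a⁻¹ : Bˣ) : B)) := by
    rw [mul_inv_rev, Units.val_mul, Units.val_mul]
    rw [← smul_mul_assoc, ← mul_smul_comm, ← h1]
    simp only [mul_assoc, mul_sub, sub_mul]
  rw [h4, ← smul_sub]
  apply Dv.smul
  have hai := ha.unit_inv
  have hαi := hα'.unit_inv
  have h5 : (a : B) * ((w + p • W) * ((α⁻¹ : Bˣ) : B)) * ((a⁻¹ : Bˣ) : B) - w =
     ((a : B) - 1) * ((w + p • W) * ((α⁻¹ : Bˣ) : B)) * ((a⁻¹ : Bˣ) : B)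
      + ((w + p • W) * ((α⁻¹ : Bˣ) : B)) * (((a⁻¹ : Bˣ) : B) - 1)
      + (w + p • W) * (((α⁻¹ : Bˣ) : B) - 1) + p • W := by
    simp only [sub_mul, mul_sub, one_mul, mul_one]
    abel
  rw [h5]
  exact ((((ha.mul_right _).mul_right _).add (hai.mul_left _)).add (hαi.mul_left _)).add (Dv.self _ _)

variable {R : Type} [CommRing R]

/-- generator -/
noncomputable def gen (R : Type) [CommRing R] (b : Bool) : FA R := MonoidAlgebra.single (FreeMonoid.of b) 1

/-- cyclic word map -/
noncomputable def cyc : FA R →ₗ[R] (Cycle Bool →₀ R) :=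
  Finsupp.lmapDomain R R (fun w : FreeMonoid Bool => (w.toList : Cycle Bool)) ∘ₗ
    (MonoidAlgebra.coeffLinearEquiv R : FA R ≃ₗ[R] _).toLinearMap

theorem cyc_single (w : FreeMonoid Bool) (r : R) :
    cyc (MonoidAlgebra.single w r) = Finsupp.single (w.toList : Cycle Bool) r := by
  simp [cyc]

theorem cyc_coe_mul (u v : FreeMonoid Bool) :
    (((u * v).toList : List Bool) : Cycle Bool) = ((v * u).toList : List Bool) := by
  rw [Cycle.coe_eq_coe, FreeMonoid.toList_mul, FreeMonoid.toList_mul]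
  exact List.isRotated_append

theorem cyc_mul_comm (f g : FA R) : cyc (f * g) = cyc (g * f) := by
  induction f using MonoidAlgebra.induction_linear with
  | zero => simp
  | add f1 f2 h1 h2 => rw [add_mul, mul_add, map_add, map_add, h1, h2]
  | single u r =>
    induction g using MonoidAlgebra.induction_linear with
    | zero => simp
    | add f1 f2 h1 h2 => rw [add_mul, mul_add, map_add, map_add, h1, h2]
    | single v s =>
      rw [MonoidAlgebra.single_mul_single, MonoidAlgebra.single_mul_single, cyc_single, cyc_single,
        cyc_coe_mul, mul_comm]

theorem cyc_conj (a : (FA R)ˣ) (f : FA R) : cyc ((a : FA R) * f * ((a⁻¹ : (FA R)ˣ) : FA R)) = cyc f := by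
  rw [cyc_mul_comm, ← mul_assoc, Units.inv_mul, one_mul]

/-- sums of commutators with generators -/
def ComS (R : Type) [CommRing R] : Submodule R (FA R) where
  carrier := {f | ∃ A B, f = (gen R false * A - A * gen R false) + (gen R true * B - B * gen R true)}
  zero_mem' := ⟨0, 0, by simp⟩
  add_mem' := by
    rintro _ _ ⟨A, B, rfl⟩ ⟨C, D, rfl⟩
    exact ⟨A + C, B + D, by noncomm_ring⟩
  smul_mem' := by
    rintro c _ ⟨A, B, rfl⟩
    exact ⟨c • A, c • B, by simp [smul_sub]⟩

theorem word_comS (u v : FreeMonoid Bool) :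
    (MonoidAlgebra.single (u * v) 1 - MonoidAlgebra.single (v * u) 1 : FA R) ∈ ComS R := by
  induction u using FreeMonoid.inductionOn' generalizing v with
  | one => simp
  | of_mul c u ih =>
    have h1 : (MonoidAlgebra.single (FreeMonoid.of c * u * v) 1 - MonoidAlgebra.single (u * v * FreeMonoid.of c) 1 : FA R) ∈ ComS R := by
      have : (MonoidAlgebra.single (FreeMonoid.of c * u * v) 1 - MonoidAlgebra.single (u * v * FreeMonoid.of c) 1 : FA R)
        = gen R c * MonoidAlgebra.single (u * v) 1 - MonoidAlgebra.single (u * v) 1 * gen R c := by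
        simp [gen, MonoidAlgebra.single_mul_single, mul_assoc]
      rw [this]
      cases c
      · exact ⟨MonoidAlgebra.single (u * v) 1, 0, by simp⟩
      · exact ⟨0, MonoidAlgebra.single (u * v) 1, by simp⟩
    have h2 := ih (v * FreeMonoid.of c)
    have := (ComS R).add_mem h1 h2
    simpa [mul_assoc] using this

/-- section of cyc -/
noncomputable def cycSec : (Cycle Bool →₀ R) →ₗ[R] FA R :=
  (MonoidAlgebra.coeffLinearEquiv R : FA R ≃ₗ[R] _).symm.toLinearMap ∘ₗ
  Finsupp.lmapDomain R R (fun c : Cycle Bool => FreeMonoid.ofList (Quotient.out c))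

theorem cycSec_single (c : Cycle Bool) (r : R) :
    cycSec (Finsupp.single c r) = MonoidAlgebra.single (FreeMonoid.ofList (Quotient.out c)) r := by
  simp [cycSec]

theorem sub_sec_mem (f : FA R) : f - cycSec (cyc f) ∈ ComS R := by
  induction f using MonoidAlgebra.induction_linear with
  | zero => simp
  | add f g h1 h2 =>
    have := (ComS R).add_mem h1 h2
    simp only [map_add]
    convert this using 1
    abel
  | single w r =>
    rw [cyc_single, cycSec_single]
    have h1 : (Quotient.out (w.toList : Cycle Bool)) ~r w.toList := by
      rw [← Cycle.coe_eq_coe]; exact Quotient.out_eq _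
    obtain ⟨k, hk⟩ := h1.symm
    set w' := Quotient.out (w.toList : Cycle Bool) with hw'
    have h2 : ∃ u v : FreeMonoid Bool, w = u * v ∧ FreeMonoid.ofList w' = v * u := by
      rw [List.rotate_eq_drop_append_take_mod] at hk
      refine ⟨FreeMonoid.ofList (w.toList.take (k % w.toList.length)), FreeMonoid.ofList (w.toList.drop (k % w.toList.length)), ?_, ?_⟩
      · rw [← FreeMonoid.ofList_append, List.take_append_drop]; rfl
      · rw [← FreeMonoid.ofList_append, hk]
    obtain ⟨u, v, h3, h4⟩ := h2
    rw [h4, h3]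
    have := (ComS R).smul_mem r (word_comS (R := R) u v)
    rwa [smul_sub, MonoidAlgebra.smul_single, MonoidAlgebra.smul_single, smul_eq_mul, mul_one] at this

theorem comS_of_cyc (r : R) (E : FA R) (h : cyc (r • E) = 0) : ∃ A B : FA R,
    r • E = r • ((gen R false * A - A * gen R false) + (gen R true * B - B * gen R true)) := by
  obtain ⟨A, B, hAB⟩ := sub_sec_mem E
  refine ⟨A, B, ?_⟩
  rw [← hAB, smul_sub, ← map_smul, ← map_smul, h]
  simp

end PartD

section PartD2
variable {R : Type} [CommRing R]

/-- degree derivation -/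
noncomputable def deg : FA R →ₗ[R] FA R :=
  (Finsupp.lsum R fun w : FreeMonoid Bool => (w.length : R) •
    ((MonoidAlgebra.coeffLinearEquiv R : FA R ≃ₗ[R] _).symm.toLinearMap ∘ₗ Finsupp.lsingle w)) ∘ₗ
    (MonoidAlgebra.coeffLinearEquiv R : FA R ≃ₗ[R] _).toLinearMap

theorem deg_single (w : FreeMonoid Bool) (r : R) :
    deg (MonoidAlgebra.single w r) = (w.length : R) • MonoidAlgebra.single w r := by
  simp [deg]

theorem deg_mul (f g : FA R) : deg (f * g) = deg f * g + f * deg g := by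
  induction f using MonoidAlgebra.induction_linear with
  | zero => simp
  | add f1 f2 h1 h2 => rw [add_mul, map_add, map_add, h1, h2]; noncomm_ring
  | single u r =>
    induction g using MonoidAlgebra.induction_linear with
    | zero => simp
    | add f1 f2 h1 h2 => rw [mul_add, map_add, map_add, h1, h2]; noncomm_ring
    | single v s =>
      rw [MonoidAlgebra.single_mul_single, deg_single, deg_single, deg_single, smul_mul_assoc,
        mul_smul_comm, MonoidAlgebra.single_mul_single, ← add_smul]
      congr 1
      simp [FreeMonoid.length]

theorem deg_one : deg (1 : FA R) = 0 := by
  rw [MonoidAlgebra.one_def, deg_single]; simp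

theorem cyc_deg (f : FA R) (c : Cycle Bool) : cyc (deg f) c = (c.length : R) * cyc f c := by
  induction f using MonoidAlgebra.induction_linear with
  | zero => simp
  | add f1 f2 h1 h2 => simp only [map_add, Finsupp.add_apply, h1, h2]; ring
  | single u r =>
    classical
    rw [deg_single, map_smul, cyc_single]
    simp only [Finsupp.smul_apply, Finsupp.single_apply, smul_eq_mul]
    split_ifs with h
    · rw [← h]; rfl
    · simp

theorem cyc_deg_pow (u : FA R) (j i : ℕ) :
    cyc (u ^ i * deg (u ^ (j + 1))) = ((j + 1 : ℕ) : R) • cyc (u ^ (i + j) * deg u) := by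
  induction j generalizing i with
  | zero => simp
  | succ j ih =>
    rw [pow_succ, deg_mul, mul_add, map_add, ← mul_assoc, cyc_mul_comm, ← mul_assoc, ← pow_succ', ih,
      ← mul_assoc, ← pow_add]
    rw [show i + 1 + j = i + (j + 1) by ring]
    push_cast
    rw [add_smul (((j : R) + 1)) 1, one_smul]

/-- truncated logarithm -/
noncomputable def lam {B : Type} [Ring B] [Algebra R B] (k : ℕ → R) (J : ℕ) (z : B) : B :=
  ∑ j ∈ Finset.range J, k j • z ^ (j + 1)

/-- truncated geometric series -/
noncomputable def geo {B : Type} [Ring B] [Algebra R B] (q : R) (J : ℕ) (z : B) : B :=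
  ∑ j ∈ Finset.range J, (-(q • z)) ^ j

theorem cyc_deg_lam (k : ℕ → R) (q : R) (hk : ∀ j, ((j + 1 : ℕ) : R) * k j = (-q) ^ j) (J : ℕ) (u : FA R) :
    cyc (deg (lam k J u)) = cyc (geo q J u * deg u) := by
  unfold lam geo
  rw [map_sum, map_sum, Finset.sum_mul, map_sum]
  refine Finset.sum_congr rfl fun j _ => ?_
  have := cyc_deg_pow u j 0
  rw [pow_zero, one_mul, zero_add] at this
  rw [map_smul, map_smul, this, smul_smul, mul_comm, hk, ← neg_smul, smul_pow, smul_mul_assoc, map_smul]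

theorem geo_mul {B : Type} [Ring B] [Algebra R B] (q : R) (J : ℕ) (z : B) :
    Dv (q ^ J) (geo q J z * (1 + q • z) - 1) := by
  have := geom_sum_mul (-(q • z)) J
  have h2 : geo q J z * (1 + q • z) - 1 = - (-(q • z)) ^ J := by
    have h3 : (1 + q • z) = - (-(q • z) - 1) := by abel
    unfold geo
    rw [h3, mul_neg, this]
    abel
  rw [h2, ← neg_smul, smul_pow, neg_pow, mul_smul]
  refine Dv.neg ?_
  rw [smul_comm]
  exact Dv.self _ _

theorem geo_mul' {B : Type} [Ring B] [Algebra R B] (q : R) (J : ℕ) (z : B) :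
    Dv (q ^ J) ((1 + q • z) * geo q J z - 1) := by
  have h : (1 + q • z) * geo q J z = geo q J z * (1 + q • z) := by
    unfold geo
    rw [Finset.mul_sum, Finset.sum_mul]
    refine Finset.sum_congr rfl fun j _ => ?_
    rw [add_mul, mul_add, one_mul, mul_one]
    congr 1
    have : Commute (q • z) (-(q • z)) := (Commute.refl _).neg_right
    exact (this.pow_right j).eq
  rw [h]; exact geo_mul q J z

theorem cyc_Dv {r : R} {f : FA R} (h : Dv r f) (c) : r ∣ cyc f c := by
  obtain ⟨E, rfl⟩ := h
  rw [map_smul]; exact ⟨_, rfl⟩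

/-- the main cyclic identity, before dividing by q and degree -/
theorem cyc_key (k : ℕ → R) (q : R) (hk : ∀ j, ((j + 1 : ℕ) : R) * k j = (-q) ^ j) (J : ℕ) (x y : FA R)
    (c : Cycle Bool) : q ^ J ∣ q * (c.length * cyc (lam k J (x + q • y + (q ^ 2) • (x * y)) - lam k J x - lam k J (q • y)) c) := by
  set u := x + q • y + (q ^ 2) • (x * y) with hu
  set z := q • y with hz
  have hab : 1 + q • u = (1 + q • x) * (1 + q • z) := by
    rw [hu, hz]
    simp only [mul_add, add_mul, one_mul, mul_one, smul_add, smul_smul, smul_mul_assoc, mul_smul_comm, pow_two]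
    rw [mul_assoc q q q]
    abel
  rw [← cyc_deg, map_sub, map_sub, map_sub, map_sub, cyc_deg_lam k q hk, cyc_deg_lam k q hk, cyc_deg_lam k q hk]
  have hd : q • deg u = (q • deg x) * (1 + q • z) + (1 + q • x) * (q • deg z) := by
    have := congrArg deg hab
    rw [deg_mul] at this
    simpa [deg_one] using this
  have h1 : q • cyc (geo q J u * deg u) = cyc ((1 + q • z) * geo q J u * (q • deg x)) + cyc (geo q J u * (1 + q • x) * (q • deg z)) := by
    rw [← map_smul, ← mul_smul_comm, hd, mul_add, map_add, mul_assoc (1 + q • z), cyc_mul_comm (1 + q • z)]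
    simp only [mul_assoc]
  have hq : ∀ v : FA R, q • cyc (geo q J v * deg v) = cyc (geo q J v * (q • deg v)) := by
    intro v; rw [mul_smul_comm, map_smul]
  have h2 : Dv (q ^ J) ((1 + q • z) * geo q J u - geo q J x) := by
    have e1 : (1 + q • z) * geo q J u - geo q J x = geo q J x * ((1 + q • u) * geo q J u - 1)
       - (geo q J x * (1 + q • x) - 1) * ((1 + q • z) * geo q J u) := by
      rw [hab]
      generalize (1 + q • x) = a
      generalize (1 + q • z) = b
      simp only [mul_sub, sub_mul, mul_assoc, mul_one, one_mul]
      abel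
    rw [e1]
    exact ((geo_mul' q J u).mul_left _).sub ((geo_mul q J x).mul_right _)
  have h3 : Dv (q ^ J) (geo q J u * (1 + q • x) - geo q J z) := by
    have e1 : geo q J u * (1 + q • x) - geo q J z = (geo q J u * (1 + q • u) - 1) * geo q J z
       - (geo q J u * (1 + q • x)) * ((1 + q • z) * geo q J z - 1) := by
      rw [hab]
      generalize (1 + q • x) = a
      generalize (1 + q • z) = b
      simp only [mul_sub, sub_mul, mul_assoc, mul_one, one_mul]
      abel
    rw [e1]
    exact ((geo_mul q J u).mul_right _).sub ((geo_mul' q J z).mul_left _)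
  have h4 : q • (cyc (geo q J u * deg u) - cyc (geo q J x * deg x) - cyc (geo q J z * deg z)) =
     cyc (((1 + q • z) * geo q J u - geo q J x) * (q • deg x) + (geo q J u * (1 + q • x) - geo q J z) * (q • deg z)) := by
    rw [smul_sub, smul_sub, h1, hq, hq, map_add, sub_mul, sub_mul, map_sub, map_sub]
    abel
  rw [← smul_eq_mul, ← Finsupp.smul_apply, h4]
  exact cyc_Dv ((h2.mul_right _).add (h3.mul_right _)) c

/-- words of bounded length -/
noncomputable def WL (R : Type) [CommRing R] (a b : ℕ) : Submodule R (FA R) :=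
  Submodule.span R (Set.image (fun w : FreeMonoid Bool => (MonoidAlgebra.single w 1 : FA R)) {w | a ≤ w.length ∧ w.length ≤ b})

theorem WL_mul {a b c d : ℕ} {f g : FA R} (hf : f ∈ WL R a b) (hg : g ∈ WL R c d) : f * g ∈ WL R (a + c) (b + d) := by
  have := Submodule.mul_mem_mul hf hg
  unfold WL at this
  rw [Submodule.span_mul_span] at this
  refine Submodule.span_mono ?_ this
  rintro _ ⟨_, ⟨u, hu, rfl⟩, _, ⟨v, hv, rfl⟩, rfl⟩
  refine ⟨u * v, ?_, by simp [MonoidAlgebra.single_mul_single]⟩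
  simp only [Set.mem_setOf_eq, FreeMonoid.length, FreeMonoid.toList_mul, List.length_append] at *
  omega

theorem WL_mono {a b c d : ℕ} (h1 : c ≤ a) (h2 : b ≤ d) : WL R a b ≤ WL R c d := by
  refine Submodule.span_mono (Set.image_mono ?_)
  intro w hw
  simp only [Set.mem_setOf_eq] at *
  omega

theorem WL_pow {b : ℕ} {f : FA R} (hf : f ∈ WL R 1 b) (j : ℕ) : f ^ (j + 1) ∈ WL R 1 (b * (j + 1)) := by
  induction j with
  | zero => simpa using hf
  | succ j ih =>
    rw [pow_succ]
    refine WL_mono (by omega) ?_ (WL_mul ih hf)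
    apply le_of_eq; ring

theorem WL_lam {b : ℕ} {f : FA R} (hf : f ∈ WL R 1 b) (k : ℕ → R) (J : ℕ) : lam k J f ∈ WL R 1 (b * J) := by
  refine Submodule.sum_mem _ fun j hj => Submodule.smul_mem _ _ ?_
  have := Finset.mem_range.mp hj
  exact WL_mono le_rfl (Nat.mul_le_mul_left b this) (WL_pow hf j)

theorem cyc_WL {a b : ℕ} {f : FA R} (hf : f ∈ WL R a b) (c : Cycle Bool) (hc : ¬ (a ≤ c.length ∧ c.length ≤ b)) :
    cyc f c = 0 := by
  unfold WL at hf
  induction hf using Submodule.span_induction with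
  | mem x hx =>
    obtain ⟨w, hw, rfl⟩ := hx
    rw [cyc_single, Finsupp.single_apply, if_neg]
    rintro rfl
    exact hc hw
  | zero => simp
  | add x y _ _ hx hy => rw [map_add, Finsupp.add_apply, hx, hy, add_zero]
  | smul r x _ hx => rw [map_smul, Finsupp.smul_apply, hx, smul_zero]

theorem gen_WL (b : Bool) : gen R b ∈ WL R 1 1 := Submodule.subset_span ⟨_, by simp, rfl⟩

end PartD2

section PartD3

theorem fact_nat (p : ℕ) [Fact p.Prime] (N : ℕ) (hN : N ≠ 0) (J : ℕ) (h : N ≤ 2 ^ J) :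
    ∃ v, v ≤ J ∧ ∃ t : ℤ_[p]ˣ, (N : ℤ_[p]) = p ^ v * t := by
  have hp : p.Prime := Fact.out
  obtain ⟨v, t, ht, hv⟩ := Nat.exists_eq_pow_mul_and_not_dvd hN p hp.ne_one
  have ht0 : t ≠ 0 := by rintro rfl; simp at ht
  have h1 : p ^ v ≤ N := by rw [hv]; exact Nat.le_mul_of_pos_right _ (Nat.pos_of_ne_zero ht0)
  have h2 : 2 ^ v ≤ 2 ^ J := (Nat.pow_le_pow_left hp.two_le v).trans (h1.trans h)
  have hu : IsUnit ((t : ℕ) : ℤ_[p]) := by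
    by_contra hc
    rw [PadicInt.not_isUnit_iff] at hc
    apply ht
    have := (PadicInt.norm_int_lt_one_iff_dvd (p := p) (t : ℤ)).1 (by simpa using hc)
    exact_mod_cast this
  refine ⟨v, (Nat.pow_le_pow_iff_right (by norm_num)).1 h2, hu.unit, ?_⟩
  rw [hv]; simp

theorem exists_kap (p m : ℕ) [Fact p.Prime] (hm : 2 ≤ m) : ∃ k : ℕ → ℤ_[p],
    (∀ j, ((j + 1 : ℕ) : ℤ_[p]) * k j = (-(p : ℤ_[p]) ^ m) ^ j) ∧ k 0 = 1 ∧ ∀ j, (p : ℤ_[p]) ∣ k (j + 1) := by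
  have h : ∀ j : ℕ, ∃ x : ℤ_[p], ((j + 1 : ℕ) : ℤ_[p]) * x = (-(p : ℤ_[p]) ^ m) ^ j ∧
     (j ≠ 0 → (p : ℤ_[p]) ∣ x) := by
    intro j
    obtain ⟨v, hv, t, ht⟩ := fact_nat p (j + 1) (by omega) j (Nat.lt_two_pow_self)
    have h2 : m * j = v + (m * j - v) := by
      have : j ≤ m * j := Nat.le_mul_of_pos_left _ (by omega)
      omega
    refine ⟨(-1) ^ j * p ^ (m * j - v) * (t⁻¹ : ℤ_[p]ˣ), ?_, ?_⟩
    · have e : (-(p : ℤ_[p]) ^ m) ^ j = (-1) ^ j * (p ^ v * p ^ (m * j - v)) := by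
        rw [← pow_add, ← h2, neg_pow ((p : ℤ_[p]) ^ m), ← pow_mul]
      rw [ht, e]
      have := t.mul_inv
      linear_combination ((-1)^j * (p:ℤ_[p]) ^ v * p ^ (m * j - v)) * this
    · intro hj
      have : m * j - v ≠ 0 := by
        have : 2 * j ≤ m * j := Nat.mul_le_mul_right _ hm
        omega
      exact Dvd.dvd.mul_right (Dvd.dvd.mul_left (dvd_pow_self _ this) _) _
  choose k hk hk' using h
  refine ⟨k, hk, ?_, fun j => hk' (j + 1) (by omega)⟩
  simpa using hk 0

theorem key_WL {R : Type} [CommRing R] (k : ℕ → R) (q : R) (J : ℕ) :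
    (lam k J (gen R false + q • gen R true + (q ^ 2) • (gen R false * gen R true))
      - lam k J (gen R false) - lam k J (q • gen R true)) ∈ WL R 1 (2 * J) := by
  have hx := gen_WL (R := R) false
  have hy := gen_WL (R := R) true
  have h12 := WL_mono (R := R) (a := 1) (b := 1) (c := 1) (d := 2) le_rfl (by norm_num)
  have h22 := WL_mono (R := R) (a := 2) (b := 2) (c := 1) (d := 2) (by norm_num) (by norm_num)
  have hxy : gen R false * gen R true ∈ WL R 2 2 := WL_mul (a := 1) (b := 1) (c := 1) (d := 1) hx hy
  have e1 : q • gen R true ∈ WL R 1 2 := Submodule.smul_mem _ _ (h12 hy)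
  have e2 : (q ^ 2) • (gen R false * gen R true) ∈ WL R 1 2 := Submodule.smul_mem _ _ (h22 hxy)
  have e3 := Submodule.add_mem _ (Submodule.add_mem _ (h12 hx) e1) e2
  exact Submodule.sub_mem _ (Submodule.sub_mem _ (WL_lam e3 _ _) (WL_lam (h12 hx) _ _)) (WL_lam e1 _ _)

theorem cyc_dvd (p m n : ℕ) [Fact p.Prime] (hm : 2 ≤ m) (k : ℕ → ℤ_[p])
    (hk : ∀ j, ((j + 1 : ℕ) : ℤ_[p]) * k j = (-(p : ℤ_[p]) ^ m) ^ j) (c : Cycle Bool) :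
    (p : ℤ_[p]) ^ n ∣ cyc (lam k (n + 2) (gen ℤ_[p] false + ((p : ℤ_[p]) ^ m) • gen ℤ_[p] true + (((p : ℤ_[p]) ^ m) ^ 2) • (gen ℤ_[p] false * gen ℤ_[p] true))
      - lam k (n + 2) (gen ℤ_[p] false) - lam k (n + 2) (((p : ℤ_[p]) ^ m) • gen ℤ_[p] true)) c := by
  have hp0 : (p : ℤ_[p]) ≠ 0 := by exact_mod_cast (Fact.out : p.Prime).ne_zero
  by_cases hc : 1 ≤ c.length ∧ c.length ≤ 2 * (n + 2)
  · have h1 := cyc_key k ((p : ℤ_[p]) ^ m) hk (n + 2) (gen ℤ_[p] false) (gen ℤ_[p] true) c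
    set C := cyc (lam k (n + 2) (gen ℤ_[p] false + ((p : ℤ_[p]) ^ m) • gen ℤ_[p] true + (((p : ℤ_[p]) ^ m) ^ 2) • (gen ℤ_[p] false * gen ℤ_[p] true))
      - lam k (n + 2) (gen ℤ_[p] false) - lam k (n + 2) (((p : ℤ_[p]) ^ m) • gen ℤ_[p] true)) c with hC
    have hle : c.length ≤ 2 ^ (n + 2) := by
      refine hc.2.trans ?_
      have : n + 2 ≤ 2 ^ (n + 1) := Nat.lt_two_pow_self
      rw [pow_succ 2 (n+1)]; omega
    obtain ⟨v, hv, t, ht⟩ := fact_nat p c.length (by omega) (n + 2) hle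
    rw [ht, pow_succ' _ (n + 1), mul_dvd_mul_iff_left (pow_ne_zero _ hp0)] at h1
    have h2 : (p : ℤ_[p]) ^ v * p ^ n ∣ (p : ℤ_[p]) ^ v * (t * C) := by
      rw [← mul_assoc, ← pow_add]
      refine dvd_trans ?_ h1
      rw [← pow_mul]
      apply pow_dvd_pow
      have : 2 * (n + 1) ≤ m * (n + 1) := Nat.mul_le_mul_right _ hm
      omega
    rw [mul_dvd_mul_iff_left (pow_ne_zero _ hp0)] at h2
    exact (Units.dvd_mul_left).1 h2
  · rw [cyc_WL (key_WL k ((p : ℤ_[p]) ^ m) (n + 2)) c hc]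
    exact dvd_zero _

theorem cyc_map {R S : Type} [CommRing R] [CommRing S] (f : R →+* S) (x : FA R) (c : Cycle Bool) :
    cyc (MonoidAlgebra.mapRingHom (FreeMonoid Bool) f x) c = f (cyc x c) := by
  classical
  induction x using MonoidAlgebra.induction_linear with
  | zero => simp
  | add f g h1 h2 => simp only [map_add, Finsupp.add_apply, h1, h2]
  | single w r =>
    rw [MonoidAlgebra.mapRingHom_single, cyc_single, cyc_single, Finsupp.single_apply, Finsupp.single_apply]
    split_ifs <;> simp

theorem mapR_smul {R S : Type} [CommRing R] [CommRing S] (f : R →+* S) (r : R) (x : FA R) :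
    MonoidAlgebra.mapRingHom (FreeMonoid Bool) f (r • x) = f r • MonoidAlgebra.mapRingHom (FreeMonoid Bool) f x := by
  induction x using MonoidAlgebra.induction_linear with
  | zero => simp
  | add f g h1 h2 => simp only [map_add, smul_add, h1, h2]
  | single w s => simp [MonoidAlgebra.smul_single]

theorem mapR_lam {R S : Type} [CommRing R] [CommRing S] (f : R →+* S) (k : ℕ → R) (J : ℕ) (x : FA R) :
    MonoidAlgebra.mapRingHom (FreeMonoid Bool) f (lam k J x) =
      lam (fun j => f (k j)) J (MonoidAlgebra.mapRingHom (FreeMonoid Bool) f x) := by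
  simp only [lam, map_sum, mapR_smul, map_pow]

theorem mapR_gen {R S : Type} [CommRing R] [CommRing S] (f : R →+* S) (b : Bool) :
    MonoidAlgebra.mapRingHom (FreeMonoid Bool) f (gen R b) = gen S b := by
  simp [gen]

theorem cyc_zero (p m n : ℕ) [Fact p.Prime] (hm : 2 ≤ m) (k : ℕ → ℤ_[p])
    (hk : ∀ j, ((j + 1 : ℕ) : ℤ_[p]) * k j = (-(p : ℤ_[p]) ^ m) ^ j) :
    cyc (lam (fun j => PadicInt.toZModPow n (k j)) (n + 2) (gen (ZMod (p ^ n)) false + ((p : ZMod (p ^ n)) ^ m) • gen _ true + (((p : ZMod (p ^ n)) ^ m) ^ 2) • (gen _ false * gen _ true))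
      - lam (fun j => PadicInt.toZModPow n (k j)) (n + 2) (gen _ false)
      - lam (fun j => PadicInt.toZModPow n (k j)) (n + 2) (((p : ZMod (p ^ n)) ^ m) • gen _ true)) = 0 := by
  ext c
  have h := cyc_dvd p m n hm k hk c
  obtain ⟨d, hd⟩ := h
  have h2 := congrArg (PadicInt.toZModPow (p := p) n) hd
  rw [← cyc_map] at h2
  simp only [map_sub, mapR_lam, map_add, mapR_smul, map_mul, mapR_gen, map_pow, map_natCast] at h2
  rw [map_sub, map_sub, h2]
  have : ((p : ZMod (p ^ n)) ^ n) = 0 := by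
    have := ZMod.natCast_self (p ^ n)
    push_cast at this
    exact this
  rw [this]; simp

/-- abstract iteration -/
theorem iter {R : Type} [CommRing R] (p q : R) (n : ℕ) (hn : p ^ n = 0) (hq : p ∣ q) (U LX LY Z1 Z2 : FA R)
    (hLX : LX = gen R false + p • Z1) (hLY : LY = q • (gen R true + p • Z2))
    (h0 : cyc (U - LX - LY) = 0) (hb : Dv (p * q) (U - LX - LY)) :
    ∀ k, ∃ a b : (FA R)ˣ, Dv (p * q) ((a : FA R) - 1) ∧ Dv p ((b : FA R) - 1) ∧
      Dv (p ^ (k + 1) * q) (U - (a : FA R) * LX * ((a⁻¹ : (FA R)ˣ) : FA R) - (b : FA R) * LY * ((b⁻¹ : (FA R)ˣ) : FA R)) := by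
  intro k
  induction k with
  | zero => exact ⟨1, 1, by simpa using Dv.zero, by simpa using Dv.zero, by simpa using hb⟩
  | succ k ih =>
    obtain ⟨a, b, ha, hb', E, hE⟩ := ih
    have hc : cyc ((p ^ (k + 1) * q) • E) = 0 := by
      rw [← hE, map_sub, map_sub, cyc_conj, cyc_conj, ← map_sub, ← map_sub, h0]
    obtain ⟨A, B, hAB⟩ := comS_of_cyc _ E hc
    have hnil : ∀ (r : R) (X : FA R), p ∣ r → IsUnit (1 - r • X) := by
      rintro r X ⟨s, rfl⟩
      apply IsNilpotent.isUnit_one_sub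
      refine ⟨n, ?_⟩
      rw [smul_pow, mul_pow, hn]; simp
    have hα := hnil (p ^ (k + 1) * q) A ⟨p ^ k * q, by ring⟩
    have hβ := hnil (p ^ (k + 1)) B ⟨p ^ k, by ring⟩
    have hαs : ((hα.unit : (FA R)ˣ) : FA R) = 1 - (p ^ (k + 1) * q) • A := IsUnit.unit_spec _
    have hβs : ((hβ.unit : (FA R)ˣ) : FA R) = 1 - (p ^ (k + 1)) • B := IsUnit.unit_spec _
    have e1 : Dv (p * q) ((hα.unit : FA R) - 1) := by
      rw [hαs]
      refine ⟨- (p ^ k • A), ?_⟩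
      rw [smul_neg, smul_smul, show p * q * p ^ k = p ^ (k + 1) * q by ring]; abel
    have e2 : Dv p ((hβ.unit : FA R) - 1) := by
      rw [hβs]
      refine ⟨- (p ^ k • B), ?_⟩
      rw [smul_neg, smul_smul, show p * p ^ k = p ^ (k + 1) by ring]; abel
    have c1 := conj_step (p ^ (k + 1) * q) 1 p (gen R false) Z1 A LX a hα.unit (by rw [one_smul, hLX]) hαs (ha.mono ⟨q, rfl⟩) (e1.mono ⟨q, rfl⟩)
    have c2 := conj_step (p ^ (k + 1)) q p (gen R true) Z2 B LY b hβ.unit hLY hβs hb' e2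
    refine ⟨a * hα.unit, b * hβ.unit, ?_, ?_, ?_⟩
    · have : ((a * hα.unit : (FA R)ˣ) : FA R) - 1 = ((a : FA R) - 1) * (hα.unit : FA R) + ((hα.unit : FA R) - 1) := by
        rw [Units.val_mul]; noncomm_ring
      rw [this]; exact (ha.mul_right _).add e1
    · have : ((b * hβ.unit : (FA R)ˣ) : FA R) - 1 = ((b : FA R) - 1) * (hβ.unit : FA R) + ((hβ.unit : FA R) - 1) := by
        rw [Units.val_mul]; noncomm_ring
      rw [this]; exact (hb'.mul_right _).add e2
    · have c3 := (c1.mono (s := p ^ (k + 1 + 1) * q) ⟨1, by ring⟩).add (c2.mono (s := p ^ (k + 1 + 1) * q) ⟨1, by ring⟩)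
      have c4 := c3.neg
      convert c4 using 1
      rw [mul_one]
      rw [hAB] at hE
      generalize ((a * hα.unit : (FA R)ˣ) : FA R) * LX * (((a * hα.unit)⁻¹ : (FA R)ˣ) : FA R) = t1 at *
      generalize ((b * hβ.unit : (FA R)ˣ) : FA R) * LY * (((b * hβ.unit)⁻¹ : (FA R)ˣ) : FA R) = t2 at *
      generalize (a : FA R) * LX * ((a⁻¹ : (FA R)ˣ) : FA R) = t3 at *
      generalize (b : FA R) * LY * ((b⁻¹ : (FA R)ˣ) : FA R) = t4 at *
      rw [smul_add] at hE
      have hU : U = (p ^ (k + 1) * q) • (gen R false * A - A * gen R false) + (p ^ (k + 1) * q) • (gen R true * B - B * gen R true) + t3 + t4 := by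
        rw [← hE]; abel
      rw [hU]; abel

theorem lam_form {R B : Type} [CommRing R] [Ring B] [Algebra R B] (p : R) (k : ℕ → R) (k0 : k 0 = 1) (kp : ∀ j, p ∣ k (j + 1)) (J : ℕ)
    (x : B) : lam k (J + 1) x = x + ∑ j ∈ Finset.range J, k (j + 1) • x ^ (j + 2) := by
  unfold lam
  rw [Finset.sum_range_succ']
  rw [k0, zero_add, pow_one, one_smul, add_comm]

theorem lam_base {R B : Type} [CommRing R] [Ring B] [Algebra R B] (p q : R) (hq : p ∣ q) (k : ℕ → R) (k0 : k 0 = 1) (kp : ∀ j, p ∣ k (j + 1)) (J : ℕ)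
    (x y : B) : (∃ Z1, lam k (J + 1) x = x + p • Z1) ∧ (∃ Z2, lam k (J + 1) (q • y) = q • (y + p • Z2)) ∧
     Dv (p * q) (lam k (J + 1) (x + q • y + q ^ 2 • (x * y)) - lam k (J + 1) x - lam k (J + 1) (q • y)) := by
  simp only [lam_form p k k0 kp]
  choose k' hk' using kp
  have key : ∀ x' : B, Dv q (x' - x) → ∀ t, Dv (p * q) (∑ j ∈ Finset.range J, k (j + 1) • x' ^ (j + t) - ∑ j ∈ Finset.range J, k (j + 1) • x ^ (j + t)) := by
    intro x' hx' t
    rw [← Finset.sum_sub_distrib]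
    apply Dv.sum
    intro j _
    rw [← smul_sub, hk']
    exact ((hx'.pow_sub _).smul _).mono ⟨k' j, by ring⟩
  have h2 : ∃ E, ∑ j ∈ Finset.range J, k (j + 1) • (q • y) ^ (j + 2) = (q * p) • E := by
    apply Dv.sum
    intro j _
    rw [smul_pow, smul_smul, hk', pow_add, pow_two]
    exact ⟨(k' j * (q ^ j * q)) • y ^ (j + 2), by rw [smul_smul]; congr 1; ring⟩
  refine ⟨⟨∑ j ∈ Finset.range J, k' j • x ^ (j + 2), ?_⟩, ?_, ?_⟩
  · rw [Finset.smul_sum]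
    simp only [hk', smul_smul]
  · obtain ⟨E, hE⟩ := h2
    exact ⟨E, by rw [hE, smul_add, smul_smul]⟩
  · have h1 := key (x + q • y + q ^ 2 • (x * y)) ⟨y + q • (x * y), by rw [smul_add, smul_smul]; simp only [pow_two]; abel⟩ 2
    have h3 : Dv (p * q) (q ^ 2 • (x * y)) := by
      obtain ⟨c, rfl⟩ := hq
      exact ⟨c • (x * y), by rw [smul_smul]; congr 1; ring⟩
    have h4 : Dv (p * q) (∑ j ∈ Finset.range J, k (j + 1) • (q • y) ^ (j + 2)) := by
      rw [mul_comm]; exact h2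
    convert (h1.add h3).sub h4 using 1
    abel

/-- evaluation -/
noncomputable def evl {R B : Type} [CommRing R] [Ring B] [Algebra R B] (X Y : B) : FA R →ₐ[R] B :=
  MonoidAlgebra.lift R B (FreeMonoid Bool) (FreeMonoid.lift fun b => cond b Y X)

theorem evl_gen {R B : Type} [CommRing R] [Ring B] [Algebra R B] (X Y : B) (b : Bool) :
    evl X Y (gen R b) = cond b Y X := by
  simp [evl, gen]

theorem evl_lam {R B : Type} [CommRing R] [Ring B] [Algebra R B] (X Y : B) (k : ℕ → R) (J : ℕ) (f : FA R) :
    evl X Y (lam k J f) = lam k J (evl X Y f) := by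
  simp [lam, map_sum, map_smul, map_pow]

theorem evl_Dv {R B : Type} [CommRing R] [Ring B] [Algebra R B] (X Y : B) {r : R} {f : FA R} (h : Dv r f) :
    Dv r (evl X Y f) := by
  obtain ⟨E, rfl⟩ := h
  exact ⟨evl X Y E, by rw [map_smul]⟩

theorem evl_congr {R B : Type} [CommRing R] [Ring B] [Algebra R B] (X Y X' Y' : B) (r : R)
    (h1 : Dv r (X - X')) (h2 : Dv r (Y - Y')) (f : FA R) : Dv r (evl X Y f - evl X' Y' f) := by
  induction f using MonoidAlgebra.induction_linear with
  | zero => simpa using Dv.zero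
  | add f g hf hg =>
    rw [map_add, map_add, add_sub_add_comm]; exact hf.add hg
  | single w s =>
    have : ∀ w : FreeMonoid Bool, Dv r (evl X Y (MonoidAlgebra.single w (1 : R)) - evl X' Y' (MonoidAlgebra.single w (1 : R))) := by
      intro w
      induction w using FreeMonoid.inductionOn' with
      | one => simpa [← MonoidAlgebra.one_def] using Dv.zero
      | of_mul b w ih =>
        have h : (MonoidAlgebra.single (FreeMonoid.of b * w) 1 : FA R) = gen R b * MonoidAlgebra.single w 1 := by
          simp [gen, MonoidAlgebra.single_mul_single]
        rw [h, map_mul, map_mul, evl_gen, evl_gen, show ∀ a b c d : B, a * b - c * d = a * (b - d) + (a - c) * d by intro a b c d; noncomm_ring]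
        refine Dv.add (Dv.mul_left ih _) (Dv.mul_right ?_ _)
        cases b
        · exact h1
        · exact h2
    have h3 : (MonoidAlgebra.single w s : FA R) = s • MonoidAlgebra.single w 1 := by
      simp [MonoidAlgebra.smul_single]
    rw [h3, map_smul, map_smul, ← smul_sub]
    exact (this w).smul' _

theorem conj_congr {R B : Type} [CommRing R] [Ring B] [Algebra R B] (r : R) (a a' : Bˣ) (X X' : B)
    (h : (a : B) * X * ((a⁻¹ : Bˣ) : B) = (a' : B) * X' * ((a'⁻¹ : Bˣ) : B)) (ha : Dv r ((a : B) - a')) : Dv r (X - X') := by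
  have h1 : X * (((a⁻¹ * a' : Bˣ)) : B) = ((a⁻¹ * a' : Bˣ) : B) * X' := by
    have := congrArg (fun z => ((a⁻¹ : Bˣ) : B) * z * a') h
    simp only [mul_assoc, Units.inv_mul, mul_one] at this
    simp only [← mul_assoc, Units.inv_mul, one_mul] at this
    rw [Units.val_mul, ← mul_assoc, this]
  have h2 : Dv r (((a⁻¹ * a' : Bˣ) : B) - 1) := by
    have : ((a⁻¹ * a' : Bˣ) : B) - 1 = - (((a⁻¹ : Bˣ) : B) * ((a : B) - a')) := by
      rw [mul_sub, Units.inv_mul, Units.val_mul]; abel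
    rw [this]
    exact (ha.mul_left _).neg
  have h3 : X - X' = (((a⁻¹ * a' : Bˣ) : B) - 1) * X' - X * (((a⁻¹ * a' : Bˣ) : B) - 1) := by
    rw [mul_sub, sub_mul, h1]; simp
  rw [h3]
  exact (h2.mul_right _).sub (h2.mul_left _)

theorem D_main (p m n : ℕ) [Fact p.Prime] (hm : 2 ≤ m) : ∃ (k : ℕ → ZMod (p ^ n)) (J : ℕ), k 0 = 1 ∧
    (∀ j, (p : ZMod (p ^ n)) ∣ k (j + 1)) ∧ ∀ (B : Type) [Ring B] [Algebra (ZMod (p ^ n)) B] [Finite B],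
    ∃ Ψ : B × B → B × B, Function.Bijective Ψ ∧ ∀ X Y,
     (∃ a : Bˣ, Dv ((p : ZMod (p ^ n)) ^ m) ((a : B) - 1) ∧ (Ψ (X, Y)).1 = a * X * ((a⁻¹ : Bˣ) : B)) ∧
     (∃ b : Bˣ, (Ψ (X, Y)).2 = b * Y * ((b⁻¹ : Bˣ) : B)) ∧
     lam k (J + 1) (X + ((p : ZMod (p ^ n)) ^ m) • Y + ((p : ZMod (p ^ n)) ^ m) ^ 2 • (X * Y)) =
       lam k (J + 1) (Ψ (X, Y)).1 + lam k (J + 1) (((p : ZMod (p ^ n)) ^ m) • (Ψ (X, Y)).2) := by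
  obtain ⟨κ, hκ, hκ0, hκp⟩ := exists_kap p m hm
  have hpn : ((p : ZMod (p ^ n)) ^ n) = 0 := by
    have := ZMod.natCast_self (p ^ n)
    push_cast at this
    exact this
  set k : ℕ → ZMod (p ^ n) := fun j => PadicInt.toZModPow n (κ j) with hk
  have k0 : k 0 = 1 := by simp [hk, hκ0]
  have kp : ∀ j, (p : ZMod (p ^ n)) ∣ k (j + 1) := by
    intro j
    have := map_dvd (PadicInt.toZModPow (p := p) n) (hκp j)
    simpa using this
  refine ⟨k, n + 1, k0, kp, ?_⟩
  intro B _ _ _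
  have hq : (p : ZMod (p ^ n)) ∣ (p : ZMod (p ^ n)) ^ m := dvd_pow_self _ (by omega)
  obtain ⟨⟨Z1, hZ1⟩, ⟨Z2, hZ2⟩, hbase⟩ := lam_base (p : ZMod (p ^ n)) ((p : ZMod (p ^ n)) ^ m) hq k k0 kp (n + 1)
    (gen (ZMod (p ^ n)) false) (gen (ZMod (p ^ n)) true)
  obtain ⟨a, b, ha, hb, E, hE⟩ := iter (p : ZMod (p ^ n)) ((p : ZMod (p ^ n)) ^ m) n hpn hq _ _ _ Z1 Z2 hZ1 hZ2
    (cyc_zero p m n hm κ hκ) hbase n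
  rw [pow_succ (p : ZMod (p ^ n)) n, hpn, zero_mul, zero_mul, zero_smul] at hE
  set ua : B × B → Bˣ := fun Z => Units.map (evl Z.1 Z.2 : FA (ZMod (p ^ n)) →ₐ[ZMod (p ^ n)] B).toMonoidHom a with hua
  set ub : B × B → Bˣ := fun Z => Units.map (evl Z.1 Z.2 : FA (ZMod (p ^ n)) →ₐ[ZMod (p ^ n)] B).toMonoidHom b with hub
  have huav : ∀ Z, ((ua Z : Bˣ) : B) = evl Z.1 Z.2 (a : FA (ZMod (p ^ n))) := fun Z => rfl
  have hubv : ∀ Z, ((ub Z : Bˣ) : B) = evl Z.1 Z.2 (b : FA (ZMod (p ^ n))) := fun Z => rfl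
  have huai : ∀ Z, (((ua Z)⁻¹ : Bˣ) : B) = evl Z.1 Z.2 ((a⁻¹ : (FA (ZMod (p ^ n)))ˣ) : FA (ZMod (p ^ n))) := fun Z => rfl
  have hubi : ∀ Z, (((ub Z)⁻¹ : Bˣ) : B) = evl Z.1 Z.2 ((b⁻¹ : (FA (ZMod (p ^ n)))ˣ) : FA (ZMod (p ^ n))) := fun Z => rfl
  have lconj : ∀ (c : Bˣ) (X : B), lam k (n + 1 + 1) ((c : B) * X * ((c⁻¹ : Bˣ) : B)) = (c : B) * lam k (n + 1 + 1) X * ((c⁻¹ : Bˣ) : B) := by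
    intro c X
    unfold lam
    rw [Finset.mul_sum, Finset.sum_mul]
    refine Finset.sum_congr rfl fun j _ => ?_
    rw [Units.conj_pow, mul_smul_comm, smul_mul_assoc]
  have cong : ∀ (c : (FA (ZMod (p ^ n)))ˣ), Dv (p : ZMod (p ^ n)) ((c : FA (ZMod (p ^ n))) - 1) → ∀ (Z Z' : B × B) (i : ℕ),
     Dv ((p : ZMod (p ^ n)) ^ i) (Z.1 - Z'.1) → Dv ((p : ZMod (p ^ n)) ^ i) (Z.2 - Z'.2) →
     Dv ((p : ZMod (p ^ n)) ^ (i + 1)) (evl Z.1 Z.2 (c : FA (ZMod (p ^ n))) - evl Z'.1 Z'.2 (c : FA (ZMod (p ^ n)))) := by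
    rintro c ⟨F, hF⟩ Z Z' i h1 h2
    have hc : (c : FA (ZMod (p ^ n))) = 1 + (p : ZMod (p ^ n)) • F := by rw [← hF]; abel
    rw [hc, map_add, map_add, map_smul, map_smul, map_one, map_one, add_sub_add_left_eq_sub, ← smul_sub, pow_succ']
    exact (evl_congr _ _ _ _ _ h1 h2 F).smul _
  refine ⟨fun Z => (ua Z * Z.1 * (((ua Z)⁻¹ : Bˣ) : B), ub Z * Z.2 * (((ub Z)⁻¹ : Bˣ) : B)), ?_, ?_⟩
  · rw [← Finite.injective_iff_bijective]
    intro Z Z' hZ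
    have hZ1 := congrArg Prod.fst hZ
    have hZ2 := congrArg Prod.snd hZ
    have : ∀ i, Dv ((p : ZMod (p ^ n)) ^ i) (Z.1 - Z'.1) ∧ Dv ((p : ZMod (p ^ n)) ^ i) (Z.2 - Z'.2) := by
      intro i
      induction i with
      | zero => rw [pow_zero]; exact ⟨Dv.one', Dv.one'⟩
      | succ i ih =>
        exact ⟨conj_congr _ _ _ _ _ hZ1 (cong a (ha.mono ⟨_, rfl⟩) Z Z' i ih.1 ih.2),
          conj_congr _ _ _ _ _ hZ2 (cong b hb Z Z' i ih.1 ih.2)⟩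
    obtain ⟨⟨E1, h1⟩, ⟨E2, h2⟩⟩ := this n
    rw [hpn, zero_smul, sub_eq_zero] at h1 h2
    exact Prod.ext h1 h2
  · intro X Y
    refine ⟨⟨ua (X, Y), ?_, rfl⟩, ⟨ub (X, Y), rfl⟩, ?_⟩
    · have := evl_Dv X Y (ha.mono (s := (p : ZMod (p ^ n)) ^ m) ⟨p, mul_comm _ _⟩)
      rw [map_sub, map_one] at this
      exact this
    · have h := congrArg (evl X Y) hE
      simp only [map_sub, map_mul, map_zero, evl_lam, map_add, map_smul, evl_gen, cond] at h
      rw [sub_sub, sub_eq_zero] at h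
      rw [h]
      simp only [lconj, ← mul_smul_comm, ← smul_mul_assoc]
      rw [huav, hubv, huai, hubi]
      have l2 := lconj (ub (X, Y)) (((p : ZMod (p ^ n)) ^ m) • Y)
      rw [mul_smul_comm, smul_mul_assoc] at l2
      simp only [mul_smul_comm, smul_mul_assoc]
      rw [hubv, hubi] at l2
      rw [l2]

end PartD3

section PartE

/-- the group `B` with the operation `x + y + q x y` -/
@[ext]
structure Gam (R B : Type) (q : R) : Type where
  v : B

/-- the underlying equivalence -/
def Gam.equiv (R B : Type) (q : R) : Gam R B q ≃ B := ⟨fun x => x.v, fun b => ⟨b⟩, fun _ => rfl, fun _ => rfl⟩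

variable {R B : Type} [CommRing R] [Ring B] [Algebra R B] (q : R)

theorem gu_isUnit [hq : Fact (IsNilpotent q)] (x : B) : IsUnit (1 + q • x) := by
  apply IsNilpotent.isUnit_one_add
  obtain ⟨n, hn⟩ := hq.out
  exact ⟨n, by rw [smul_pow, hn, zero_smul]⟩

/-- the unit `1 + q x` -/
noncomputable def gu [hq : Fact (IsNilpotent q)] (x : B) : Bˣ := (gu_isUnit q x).unit

theorem gu_val [hq : Fact (IsNilpotent q)] (x : B) : ((gu q x : Bˣ) : B) = 1 + q • x := IsUnit.unit_spec _

noncomputable instance [hq : Fact (IsNilpotent q)] : Group (Gam R B q) :=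
  letI : Mul (Gam R B q) := ⟨fun x y => ⟨x.v + y.v + q • (x.v * y.v)⟩⟩
  letI : One (Gam R B q) := ⟨⟨0⟩⟩
  letI : Inv (Gam R B q) := ⟨fun x => ⟨-(x.v * ((gu q x.v)⁻¹ : Bˣ))⟩⟩
  Group.ofLeftAxioms (G := Gam R B q)
    (fun x y z => by
      apply Gam.ext
      change (x.v + y.v + q • (x.v * y.v)) + z.v + q • ((x.v + y.v + q • (x.v * y.v)) * z.v) =
        x.v + (y.v + z.v + q • (y.v * z.v)) + q • (x.v * (y.v + z.v + q • (y.v * z.v)))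
      simp only [mul_add, add_mul, smul_add, smul_mul_assoc, mul_smul_comm, mul_assoc]
      abel)
    (fun x => by
      apply Gam.ext
      change 0 + x.v + q • (0 * x.v) = x.v
      simp)
    (fun x => by
      apply Gam.ext
      change -(x.v * ((gu q x.v)⁻¹ : Bˣ)) + x.v + q • (-(x.v * ((gu q x.v)⁻¹ : Bˣ)) * x.v) = 0
      have h : -(x.v * ((gu q x.v)⁻¹ : Bˣ)) + x.v + q • (-(x.v * ((gu q x.v)⁻¹ : Bˣ)) * x.v) =
        x.v - x.v * (((gu q x.v)⁻¹ : Bˣ) : B) * (gu q x.v : B) := by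
        rw [gu_val]
        simp only [mul_add, mul_one, mul_smul_comm, neg_mul, smul_neg]
        abel
      rw [h, mul_assoc, Units.inv_mul, mul_one, sub_self])

instance [Fintype B] : Fintype (Gam R B q) := Fintype.ofEquiv B (Gam.equiv R B q).symm

variable [hq : Fact (IsNilpotent q)]

theorem gam_mul (x y : Gam R B q) : (x * y).v = x.v + y.v + q • (x.v * y.v) := rfl
theorem gam_one : (1 : Gam R B q).v = (0 : B) := rfl

/-- conjugation -/
noncomputable def conjAdd : Bˣ →* AddMonoid.End B where
  toFun h := { toFun := fun v => h * v * ((h⁻¹ : Bˣ) : B), map_zero' := by simp, map_add' := by intro x y; rw [mul_add, add_mul] }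
  map_one' := by
    apply AddMonoidHom.ext
    intro v
    change ((1 : Bˣ) : B) * v * (((1 : Bˣ)⁻¹ : Bˣ) : B) = v
    simp
  map_mul' := by
    intro x y
    apply AddMonoidHom.ext
    intro v
    change ((x * y : Bˣ) : B) * v * (((x * y)⁻¹ : Bˣ) : B) = x * (y * v * ((y⁻¹ : Bˣ) : B)) * ((x⁻¹ : Bˣ) : B)
    rw [mul_inv_rev, Units.val_mul, Units.val_mul]
    simp only [mul_assoc]

theorem conjAdd_apply (h : Bˣ) (v : B) : conjAdd h v = h * v * ((h⁻¹ : Bˣ) : B) := rfl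

theorem conj_mul' (h : Bˣ) (x y : B) : (h : B) * (x * y) * ((h⁻¹ : Bˣ) : B) = (h * x * ((h⁻¹ : Bˣ) : B)) * (h * y * ((h⁻¹ : Bˣ) : B)) := by
  simp only [mul_assoc]
  rw [← mul_assoc ((h⁻¹ : Bˣ) : B) (h : B), Units.inv_mul, one_mul]

/-- conjugation action on the group -/
noncomputable def conjGam : Bˣ →* MulAut (Gam R B q) where
  toFun h :=
    { toFun := fun x => ⟨h * x.v * ((h⁻¹ : Bˣ) : B)⟩
      invFun := fun x => ⟨((h⁻¹ : Bˣ) : B) * x.v * h⟩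
      left_inv := by
        intro x
        apply Gam.ext
        simp only [mul_assoc, Units.inv_mul, mul_one]
        rw [← mul_assoc, Units.inv_mul, one_mul]
      right_inv := by
        intro x
        apply Gam.ext
        simp only [mul_assoc, Units.mul_inv, mul_one]
        rw [← mul_assoc, Units.mul_inv, one_mul]
      map_mul' := by
        intro x y
        apply Gam.ext
        simp only [gam_mul]
        rw [← conj_mul']
        simp only [mul_add, add_mul, mul_smul_comm, smul_mul_assoc] }
  map_one' := by
    ext x
    change ((1 : Bˣ) : B) * x.v * (((1 : Bˣ)⁻¹ : Bˣ) : B) = x.v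
    simp
  map_mul' := by
    intro x y
    ext v
    change ((x * y : Bˣ) : B) * v.v * (((x * y)⁻¹ : Bˣ) : B) = x * (y * v.v * ((y⁻¹ : Bˣ) : B)) * ((x⁻¹ : Bˣ) : B)
    rw [mul_inv_rev, Units.val_mul, Units.val_mul]
    simp only [mul_assoc]

theorem conjGam_apply (h : Bˣ) (x : Gam R B q) : (conjGam q h x).v = h * x.v * ((h⁻¹ : Bˣ) : B) := rfl

/-- embedding -/
noncomputable def guHom : Gam R B q →* Bˣ where
  toFun x := gu q x.v
  map_one' := by
    ext
    rw [gu_val, gam_one]; simp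
  map_mul' := by
    intro x y
    ext
    rw [Units.val_mul, gu_val, gu_val, gu_val, gam_mul]
    simp only [mul_add, add_mul, one_mul, mul_one, smul_add, smul_mul_assoc, mul_smul_comm]
    abel

theorem guHom_val (x : Gam R B q) : ((guHom q x : Bˣ) : B) = 1 + q • x.v := gu_val q x.v

theorem gam_iconj (g x : Gam R B q) : conjGam q (guHom q g) x = g * x * g⁻¹ := by
  rw [eq_mul_inv_iff_mul_eq]
  apply Gam.ext
  have h1 : (conjGam q (guHom q g) x * g).v = (guHom q g) * x.v * (((guHom q g)⁻¹ : Bˣ) : B) * ((guHom q g : Bˣ) : B) + g.v := by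
    rw [gam_mul, conjGam_apply]
    generalize (guHom q g) * x.v * (((guHom q g)⁻¹ : Bˣ) : B) = w
    rw [guHom_val, mul_add, mul_one, mul_smul_comm]
    abel
  have h2 : (g * x).v = (guHom q g) * x.v + g.v := by
    rw [gam_mul, guHom_val, add_mul, one_mul, smul_mul_assoc]; abel
  rw [h1, h2, mul_assoc _ _ ((guHom q g : Bˣ) : B), Units.inv_mul, mul_one]

theorem gam_iact (h : Bˣ) (g : Gam R B q) : guHom q (conjGam q h g) = h * guHom q g * h⁻¹ := by
  ext
  rw [Units.val_mul, Units.val_mul, guHom_val, guHom_val, conjGam_apply, mul_add, add_mul, mul_one, Units.mul_inv,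
    mul_smul_comm, smul_mul_assoc]

/-- multiples of q -/
def NN (R B : Type) [CommRing R] [Ring B] [Algebra R B] (q : R) : AddSubgroup B where
  carrier := {v | Dv q v}
  zero_mem' := Dv.zero
  add_mem' := fun h1 h2 => Dv.add h1 h2
  neg_mem' := fun h => Dv.neg h

theorem mem_NN (v : B) : v ∈ NN R B q ↔ Dv q v := Iff.rfl

theorem gam_Nsub (γ : Gam R B q) (v : B) : conjAdd (guHom q γ) v - v ∈ NN R B q := by
  rw [mem_NN, conjAdd_apply]
  refine ⟨(γ.v * v - v * γ.v) * (((guHom q γ)⁻¹ : Bˣ) : B), ?_⟩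
  have h3 : v = v * (guHom q γ : Bˣ) * (((guHom q γ)⁻¹ : Bˣ) : B) := by rw [mul_assoc, Units.mul_inv, mul_one]
  have h4 : (guHom q γ : B) * v * (((guHom q γ)⁻¹ : Bˣ) : B) - v = ((guHom q γ : B) * v - v * (guHom q γ : B)) * (((guHom q γ)⁻¹ : Bˣ) : B) := by
    rw [sub_mul, ← h3]
  rw [h4, guHom_val, ← smul_mul_assoc, smul_sub]
  congr 1
  simp only [add_mul, mul_add, one_mul, mul_one, smul_mul_assoc, mul_smul_comm]
  abel

theorem gam_comm (g h : Gam R B q) : Dv q (g * (h * g⁻¹ * h⁻¹)).v := by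
  rw [← gam_iconj]
  have h1 : (g * conjGam q (guHom q h) g⁻¹).v - (g * g⁻¹).v =
     (conjAdd (guHom q h) (g⁻¹).v - (g⁻¹).v) +
       q • (g.v * (conjGam q (guHom q h) g⁻¹).v - g.v * (g⁻¹).v) := by
    rw [gam_mul, gam_mul, smul_sub, conjAdd_apply, conjGam_apply]
    abel
  rw [mul_inv_cancel, gam_one, sub_zero] at h1
  rw [h1]
  exact Dv.add (gam_Nsub q h _) (Dv.self _ _)

theorem lam_conj (k : ℕ → R) (J : ℕ) (c : Bˣ) (X : B) : lam k J ((c : B) * X * ((c⁻¹ : Bˣ) : B)) = (c : B) * lam k J X * ((c⁻¹ : Bˣ) : B) := by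
  unfold lam
  rw [Finset.mul_sum, Finset.sum_mul]
  refine Finset.sum_congr rfl fun j _ => ?_
  rw [Units.conj_pow, mul_smul_comm, smul_mul_assoc]

theorem lam_bij [Finite B] (p : R) (n : ℕ) (hn : p ^ n = 0) (k : ℕ → R) (k0 : k 0 = 1) (kp : ∀ j, p ∣ k (j + 1)) (J : ℕ) :
    Function.Bijective (lam k (J + 1) : B → B) := by
  rw [← Finite.injective_iff_bijective]
  intro x y h
  have : ∀ i, Dv (p ^ i) (x - y) := by
    intro i
    induction i with
    | zero => rw [pow_zero]; exact Dv.one'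
    | succ i ih =>
      rw [lam_form p k k0 kp, lam_form p k k0 kp] at h
      have h2 : x - y = - (∑ j ∈ Finset.range J, k (j + 1) • (x ^ (j + 2) - y ^ (j + 2))) := by
        simp only [smul_sub, Finset.sum_sub_distrib]
        have : x = y + ∑ j ∈ Finset.range J, k (j + 1) • y ^ (j + 2) - ∑ j ∈ Finset.range J, k (j + 1) • x ^ (j + 2) := by
          rw [← h]; abel
        conv_lhs => rw [this]
        abel
      rw [h2]
      apply Dv.neg
      apply Dv.sum
      intro j _
      refine ((ih.pow_sub (j + 2)).smul (k (j + 1))).mono ?_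
      rw [pow_succ']
      exact mul_dvd_mul_right (kp j) _
  obtain ⟨E, hE⟩ := this n
  rw [hn, zero_smul, sub_eq_zero] at hE
  exact hE

theorem lam_N (k : ℕ → R) (J : ℕ) (x : B) (hx : Dv q x) : Dv q (lam k J x) := by
  apply Dv.sum
  intro j _
  rw [pow_succ]
  exact (hx.mul_left _).smul' _

theorem lam_N_iff [Finite B] (p : R) (n : ℕ) (hn : p ^ n = 0) (k : ℕ → R) (k0 : k 0 = 1) (kp : ∀ j, p ∣ k (j + 1)) (J : ℕ) (x : B) :
    Dv q (lam k (J + 1) x) ↔ Dv q x := by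
  refine ⟨fun h => ?_, lam_N q k _ x⟩
  have hinj := (lam_bij (B := B) p n hn k k0 kp J).1
  let f : {v : B // Dv q v} → {v : B // Dv q v} := fun v => ⟨lam k (J + 1) v.1, lam_N q k _ _ v.2⟩
  have hf : Function.Injective f := fun a b hab => Subtype.ext (hinj (congrArg Subtype.val hab))
  obtain ⟨y, hy⟩ := (Finite.injective_iff_surjective.1 hf) ⟨_, h⟩
  have := hinj (congrArg Subtype.val hy)
  rw [← this]; exact y.2

theorem sum_smul_fiber [Fintype B] (F : B → ℂ) (hF : ∀ z, ¬ Dv q z → F z = 0) :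
    ∃ c : ℂ, c ≠ 0 ∧ ∀ F : B → ℂ, (∀ z, ¬ Dv q z → F z = 0) → ∑ y, F (q • y) = c * ∑ z, F z := by
  classical
  let φ : B →+ B := DistribSMul.toAddMonoidHom B q
  refine ⟨((Finset.univ.filter fun y : B => φ y = 0).card : ℂ), ?_, ?_⟩
  · rw [Nat.cast_ne_zero, ← Nat.pos_iff_ne_zero, Finset.card_pos]
    exact ⟨0, by simp⟩
  · intro F hF
    rw [← Finset.sum_fiberwise Finset.univ (fun y => q • y), Finset.mul_sum]
    refine Finset.sum_congr rfl fun z _ => ?_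
    by_cases hz : Dv q z
    · have : (Finset.univ.filter fun y : B => φ y = z).card = (Finset.univ.filter fun y : B => φ y = 0).card := by
        obtain ⟨E, hE⟩ := hz
        exact AddMonoidHom.card_fiber_eq_of_mem_range φ ⟨E, hE.symm⟩ ⟨0, map_zero φ⟩
      rw [← this, ← nsmul_eq_mul, ← Finset.sum_const]
      refine Finset.sum_congr rfl fun y hy => ?_
      exact congrArg F (Finset.mem_filter.1 hy).2
    · rw [hF z hz, mul_zero]
      apply Finset.sum_eq_zero
      intro y hy
      rw [(Finset.mem_filter.1 hy).2, hF z hz]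

theorem sum_mul_coeff {Γ : Type} [Group Γ] [Fintype Γ] (f1 f2 : MonoidAlgebra ℂ Γ) (χ : Γ → ℂ) :
    ∑ g, (f1 * f2).coeff g * χ g = ∑ x, ∑ y, f1.coeff x * f2.coeff y * χ (x * y) := by
  classical
  let L : MonoidAlgebra ℂ Γ →ₗ[ℂ] ℂ :=
    { toFun := fun f => ∑ g, f.coeff g * χ g
      map_add' := by intro a b; simp [add_mul, Finset.sum_add_distrib]
      map_smul' := by intro a b; simp [Finset.mul_sum, mul_assoc] }
  have hL : ∀ g c, L (MonoidAlgebra.single g c) = c * χ g := by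
    intro g c
    change ∑ h, (MonoidAlgebra.single g c).coeff h * χ h = _
    rw [Finset.sum_eq_single g]
    · simp
    · intro b _ hb
      simp [MonoidAlgebra.coeff_single, Finsupp.single_apply, hb.symm]
    · simp
  change L (f1 * f2) = _
  conv_lhs => rw [eq_sum_single f1, eq_sum_single f2]
  rw [Finset.sum_mul, map_sum]
  refine Finset.sum_congr rfl fun x _ => ?_
  rw [Finset.mul_sum, map_sum]
  refine Finset.sum_congr rfl fun y _ => ?_
  rw [smul_mul_smul_comm, MonoidAlgebra.single_mul_single, map_smul, hL]
  simp

/-- the concrete orbit data -/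
noncomputable def mkOrb [Fintype B] (p : R) (n : ℕ) (hn : p ^ n = 0) (k : ℕ → R) (k0 : k 0 = 1)
    (kp : ∀ j, p ∣ k (j + 1)) (J : ℕ)
    (hΨ : ∃ Ψ : B × B → B × B, Function.Bijective Ψ ∧ ∀ X Y,
     (∃ a : Bˣ, Dv q ((a : B) - 1) ∧ (Ψ (X, Y)).1 = a * X * ((a⁻¹ : Bˣ) : B)) ∧
     (∃ b : Bˣ, (Ψ (X, Y)).2 = b * Y * ((b⁻¹ : Bˣ) : B)) ∧
     lam k (J + 1) (X + q • Y + q ^ 2 • (X * Y)) =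
       lam k (J + 1) (Ψ (X, Y)).1 + lam k (J + 1) (q • (Ψ (X, Y)).2)) : OrbData (Gam R B q) B Bˣ where
  ℓ := (Gam.equiv R B q).trans (Equiv.ofBijective (lam k (J + 1)) (lam_bij p n hn k k0 kp J))
  l_one := by
    change lam k (J + 1) (0 : B) = 0
    simp [lam]
  aΓ := conjGam q
  ag := conjAdd
  l_act := fun h γ => lam_conj k _ h γ.v
  ι := guHom q
  i_conj := gam_iconj q
  i_act := gam_iact q
  N := NN R B q
  N_act := fun h v hv => by
    rw [mem_NN, conjAdd_apply]
    exact (Dv.mul_left hv _).mul_right _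
  N_comm := fun g h => lam_N q k _ _ (gam_comm q g h)
  N_sub := gam_Nsub q
  mul := by
    intro f1 f2 h1 h2 h3 ω
    obtain ⟨c, hc, hcF⟩ := sum_smul_fiber (B := B) q (fun _ => 0) (fun _ _ => rfl)
    apply mul_left_cancel₀ hc
    have hN : ∀ z : B, ¬ Dv q z → f2.coeff ⟨z⟩ = 0 := by
      intro z hz
      apply h3
      intro h
      exact hz ((lam_N_iff q p n hn k k0 kp J z).1 h)
    let A1 : B → ℂ := fun x => f1.coeff ⟨x⟩
    let A2 : B → ℂ := fun x => f2.coeff ⟨x⟩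
    let E : B → ℂ := fun x => ω (lam k (J + 1) x)
    have e1 : ∑ g : Gam R B q, (f1 * f2).coeff g * ω (lam k (J + 1) g.v) = ∑ x : B, ∑ y : B, A1 x * A2 y * E (x + y + q • (x * y)) :=
by
      rw [sum_mul_coeff f1 f2 (fun g => ω (lam k (J + 1) g.v))]
      rw [← (Gam.equiv R B q).sum_comp]
      refine Finset.sum_congr rfl fun x _ => ?_
      rw [← (Gam.equiv R B q).sum_comp]
      rfl
    have e2 : ∑ g : Gam R B q, f1.coeff g * ω (lam k (J + 1) g.v) = ∑ x : B, A1 x * E x := by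
      rw [← (Gam.equiv R B q).sum_comp]; rfl
    have e3 : ∑ g : Gam R B q, f2.coeff g * ω (lam k (J + 1) g.v) = ∑ x : B, A2 x * E x := by
      rw [← (Gam.equiv R B q).sum_comp]; rfl
    change c * (∑ g : Gam R B q, (f1 * f2).coeff g * ω (lam k (J + 1) g.v)) =
      c * ((∑ g : Gam R B q, f1.coeff g * ω (lam k (J + 1) g.v)) * ∑ g : Gam R B q, f2.coeff g * ω (lam k (J + 1) g.v))
    rw [e1, e2, e3, mul_left_comm, ← hcF (fun y => A2 y * E y) (fun z hz => by simp only [A2, hN z hz, zero_mul]), Finset.mul_sum]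
    have e4 : ∀ x : B, c * ∑ y : B, A1 x * A2 y * E (x + y + q • (x * y)) = ∑ y : B, A1 x * A2 (q • y) * E (x + q • y + q ^ 2 • (x * y)) := by
      intro x
      rw [← hcF (fun y => A1 x * A2 y * E (x + y + q • (x * y))) (fun z hz => by simp only [A2, hN z hz, mul_zero, zero_mul])]
      refine Finset.sum_congr rfl fun y _ => ?_
      simp only [mul_smul_comm, smul_smul, pow_two]
    simp only [e4]
    rw [Finset.sum_mul_sum, ← Finset.sum_product', ← Finset.sum_product']
    obtain ⟨Ψ, hΨb, hΨ⟩ := hΨ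
    refine Finset.sum_nbij' (i := Ψ) (j := (Equiv.ofBijective Ψ hΨb).symm) ?_ ?_ ?_ ?_ ?_
    · intro x _; simp
    · intro x _; simp
    · intro x _; exact (Equiv.ofBijective Ψ hΨb).symm_apply_apply x
    · intro x _; exact (Equiv.ofBijective Ψ hΨb).apply_symm_apply x
    · rintro ⟨X, Y⟩ _
      obtain ⟨⟨a, ⟨a', ha'⟩, ha⟩, ⟨b, hb⟩, hl⟩ := hΨ X Y
      have i1 : A1 (Ψ (X, Y)).1 = A1 X := by
        have hg : guHom q ⟨a'⟩ = a := by
          ext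
          rw [guHom_val]
          have : (a : B) = 1 + q • a' := by rw [← ha']; abel
          exact this.symm
        have := h1 ⟨a'⟩ ⟨X⟩
        rw [← gam_iconj, hg] at this
        rw [ha]
        exact this
      have i2 : A2 (q • (Ψ (X, Y)).2) = A2 (q • Y) := by
        have := h2 b ⟨q • Y⟩
        rw [hb, ← smul_mul_assoc, ← mul_smul_comm]
        exact this
      have i3 : E (X + q • Y + q ^ 2 • (X * Y)) = E (Ψ (X, Y)).1 * E (q • (Ψ (X, Y)).2) := by
        change ω (lam k (J + 1) (X + q • Y + q ^ 2 • (X * Y))) = _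
        rw [hl, AddChar.map_add_eq_mul]
      change A1 X * A2 (q • Y) * E (X + q • Y + q ^ 2 • (X * Y)) = A1 (Ψ (X, Y)).1 * E (Ψ (X, Y)).1 * (A2 (q • (Ψ (X, Y)).2) * E (q • (Ψ (X, Y)).2))
      rw [i1, i2, i3]; ring

end PartE

section PartF1

theorem sum_fiber_surj {A C : Type} [AddCommGroup A] [AddCommGroup C] [Fintype A] [Fintype C] (φ : A →+ C)
    (hφ : Function.Surjective φ) : ∃ c : ℕ, Fintype.card A = c * Fintype.card C ∧
     (∀ g : C → ℝ, ∑ a, g (φ a) = c * ∑ b, g b) ∧ (∀ P : C → Prop, Nat.card {a // P (φ a)} = c * Nat.card {b // P b}) := by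
  classical
  set c := (Finset.univ.filter fun y : A => φ y = 0).card with hc
  have h1 : ∀ g : C → ℝ, ∑ a, g (φ a) = c * ∑ b, g b := by
    intro g
    rw [← Finset.sum_fiberwise Finset.univ φ, Finset.mul_sum]
    refine Finset.sum_congr rfl fun z _ => ?_
    have : (Finset.univ.filter fun y : A => φ y = z).card = (Finset.univ.filter fun y : A => φ y = 0).card :=
      AddMonoidHom.card_fiber_eq_of_mem_range φ (hφ z) (hφ 0)
    rw [hc, ← this, ← nsmul_eq_mul, ← Finset.sum_const]
    refine Finset.sum_congr rfl fun y hy => ?_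
    exact congrArg g (Finset.mem_filter.1 hy).2
  refine ⟨c, ?_, h1, ?_⟩
  · have := h1 (fun _ => 1)
    simp at this
    exact_mod_cast this
  · intro P
    have := h1 (fun b => if P b then 1 else 0)
    simp only [Finset.sum_boole] at this
    rw [Nat.card_eq_fintype_card, Nat.card_eq_fintype_card, Fintype.card_subtype, Fintype.card_subtype]
    exact_mod_cast this

/-- matrices -/
abbrev M3 (R : Type) := Matrix (Fin 3) (Fin 3) R

theorem card_M3 (N : ℕ) [NeZero N] : Fintype.card (M3 (ZMod N)) = N ^ 9 := by
  have h : Fintype.card (M3 (ZMod N)) = Fintype.card (Fin 3 → Fin 3 → ZMod N) := rfl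
  rw [h, Fintype.card_fun, Fintype.card_fun, ZMod.card, Fintype.card_fin]; ring

/-- size of centralizer -/
noncomputable def cent {N : ℕ} (b : M3 (ZMod N)) : ℕ := Nat.card {γ : M3 (ZMod N) // b * γ = γ * b}

/-- characters of matrices -/
noncomputable def omg {N : ℕ} [NeZero N] (a : M3 (ZMod N)) : AddChar (M3 (ZMod N)) ℂ :=
  (ZMod.stdAddChar (N := N)).compAddMonoidHom ((Matrix.traceAddMonoidHom (Fin 3) (ZMod N)).comp (AddMonoidHom.mulLeft a))

theorem omg_apply {N : ℕ} [NeZero N] (a x : M3 (ZMod N)) : omg a x = ZMod.stdAddChar (N := N) (Matrix.trace (a * x)) := rfl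

theorem omg_bij {N : ℕ} [NeZero N] : Function.Bijective (omg (N := N)) := by
  have : Function.Injective (omg (N := N)) := by
    intro a b h
    rw [Matrix.ext_iff_trace_mul_right]
    intro x
    exact ZMod.injective_stdAddChar (by rw [← omg_apply, ← omg_apply, h])
  exact (Fintype.bijective_iff_injective_and_card _).2 ⟨this, AddChar.card_eq.symm⟩

theorem omg_conj {N : ℕ} [NeZero N] (a : M3 (ZMod N)) (g : (M3 (ZMod N))ˣ) :
    (∀ v, omg a (conjAdd g v) = omg a v) ↔ a * (g : M3 (ZMod N)) = (g : M3 (ZMod N)) * a := by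
  have h1 : ∀ v, omg a (conjAdd g v) = omg (((g⁻¹ : (M3 (ZMod N))ˣ) : M3 (ZMod N)) * a * (g : M3 (ZMod N))) v := by
    intro v
    rw [omg_apply, omg_apply, conjAdd_apply, ← mul_assoc, Matrix.trace_mul_comm]
    simp only [mul_assoc]
  have h2 : (∀ v, omg a (conjAdd g v) = omg a v) ↔ ((g⁻¹ : (M3 (ZMod N))ˣ) : M3 (ZMod N)) * a * (g : M3 (ZMod N)) = a := by
    simp only [h1]
    refine ⟨fun h => omg_bij.1 (DFunLike.ext _ _ (fun v => h v)), fun h v => by rw [h]⟩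
  rw [h2, mul_assoc, Units.inv_mul_eq_iff_eq_mul]

variable (p : ℕ) [hp : Fact p.Prime]

instance (k : ℕ) : NeZero (p ^ k) := ⟨pow_ne_zero _ hp.out.ne_zero⟩

theorem zp_pow (n : ℕ) : ((p : ZMod (p ^ n)) ^ n) = 0 := by
  have := ZMod.natCast_self (p ^ n)
  push_cast at this
  exact this

/-- reduction -/
noncomputable def red (k m : ℕ) : ZMod (p ^ (k + m)) →+* ZMod (p ^ k) := ZMod.castHom (pow_dvd_pow p (Nat.le_add_right k m)) _

theorem red_surj (k m : ℕ) : Function.Surjective (red p k m) := ZMod.castHom_surjective _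

theorem red_zero_iff (k m : ℕ) (x : ZMod (p ^ (k + m))) : red p k m x = 0 ↔ (p : ZMod (p ^ (k + m))) ^ m * x = 0 := by
  obtain ⟨x, rfl⟩ := ZMod.natCast_zmod_surjective x
  rw [map_natCast, ← Nat.cast_pow, ← Nat.cast_mul, ZMod.natCast_eq_zero_iff, ZMod.natCast_eq_zero_iff, pow_add, mul_comm (p ^ k)]
  exact (Nat.mul_dvd_mul_iff_left (pow_pos hp.out.pos _)).symm

theorem redM_surj (k m : ℕ) : Function.Surjective ((red p k m).mapMatrix : M3 (ZMod (p ^ (k + m))) →+* M3 (ZMod (p ^ k))) := by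
  intro b
  choose a ha using red_surj p k m
  exact ⟨Matrix.of fun i j => a (b i j), by ext i j; simp [ha]⟩

theorem redM_zero_iff (k m : ℕ) (x : M3 (ZMod (p ^ (k + m)))) : (red p k m).mapMatrix x = 0 ↔ ((p : ZMod (p ^ (k + m))) ^ m) • x = 0 := by
  rw [← Matrix.ext_iff, ← Matrix.ext_iff]
  refine forall_congr' fun i => forall_congr' fun j => ?_
  simpa using red_zero_iff p k m (x i j)

instance nilp (m n : ℕ) [hm : NeZero m] : Fact (IsNilpotent ((p : ZMod (p ^ n)) ^ m)) :=
  ⟨⟨n, by rw [← pow_mul, mul_comm, pow_mul, zp_pow, zero_pow hm.out]⟩⟩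

/-- result of the orbit method for GL3 -/
theorem gl_count (m k : ℕ) [NeZero m] (hm : 2 ≤ m) {κ : Type} [Fintype κ] [DecidableEq κ] {d : κ → ℕ} [∀ i, NeZero (d i)]
    (Φ : MonoidAlgebra ℂ (Gam (ZMod (p ^ (k + m))) (M3 (ZMod (p ^ (k + m)))) ((p : ZMod (p ^ (k + m))) ^ m)) ≃ₐ[ℂ]
      Π i, Matrix (Fin (d i)) (Fin (d i)) ℂ) (f : ℝ → ℝ) :
    ∑ i, f (d i ^ 2) = (p : ℝ) ^ (9 * m) * ∑ b : M3 (ZMod (p ^ k)), f ((p : ℝ) ^ (9 * k) / cent b) * (cent b / (p : ℝ) ^ (9 * k)) := by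
  classical
  obtain ⟨kk, J, k0, kp, hΨ⟩ := D_main p m (k + m) hm
  let D := mkOrb (B := M3 (ZMod (p ^ (k + m)))) ((p : ZMod (p ^ (k + m))) ^ m) (p : ZMod (p ^ (k + m))) (k + m) (zp_pow p _) kk k0 kp J
    (hΨ (M3 (ZMod (p ^ (k + m)))))
  rw [D.main Φ f]
  obtain ⟨c, hc1, hc2, hc3⟩ := sum_fiber_surj ((red p k m).mapMatrix : M3 (ZMod (p ^ (k + m))) →+* M3 (ZMod (p ^ k))).toAddMonoidHom (redM_surj p k m)
  have hc : c = p ^ (9 * m) := by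
    rw [card_M3, card_M3, ← pow_mul, ← pow_mul, show (k + m) * 9 = 9 * m + k * 9 by ring, pow_add] at hc1
    exact (Nat.eq_of_mul_eq_mul_right (pow_pos hp.out.pos _) hc1).symm
  have hst : ∀ a : M3 (ZMod (p ^ (k + m))), D.stab (omg a) = c * cent ((red p k m).mapMatrix a) := by
    intro a
    unfold OrbData.stab cent
    refine Eq.trans ?_ (hc3 (fun γ => (red p k m).mapMatrix a * γ = γ * (red p k m).mapMatrix a))
    refine Nat.card_congr ((Gam.equiv _ _ _).subtypeEquiv fun γ => ?_)
    change (∀ v, omg a (conjAdd (guHom _ γ) v) = omg a v) ↔ _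
    rw [omg_conj, guHom_val]
    change _ ↔ (red p k m).mapMatrix a * (red p k m).mapMatrix γ.v = (red p k m).mapMatrix γ.v * (red p k m).mapMatrix a
    rw [← map_mul, ← map_mul, ← sub_eq_zero, ← sub_eq_zero (a := (red p k m).mapMatrix (a * γ.v)), ← map_sub, redM_zero_iff]
    rw [smul_sub]
    simp only [mul_add, add_mul, mul_one, one_mul, mul_smul_comm, smul_mul_assoc, add_sub_add_left_eq_sub]
  have hG : (Fintype.card (Gam (ZMod (p ^ (k + m))) (M3 (ZMod (p ^ (k + m)))) ((p : ZMod (p ^ (k + m))) ^ m)) : ℝ) = c * (p : ℝ) ^ (9 * k) := by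
    rw [Fintype.card_congr (Gam.equiv _ _ _), card_M3, hc]
    push_cast
    rw [← pow_mul, ← pow_add]; congr 1; ring
  rw [← (Equiv.ofBijective _ (omg_bij (N := p ^ (k + m)))).sum_comp]
  simp only [Equiv.ofBijective_apply, hst, hG]
  have hcp : (c : ℝ) ≠ 0 := by
    rw [hc]; exact_mod_cast pow_ne_zero _ hp.out.ne_zero
  push_cast
  simp only [mul_div_mul_left _ _ hcp]
  refine Eq.trans (hc2 (fun b => f ((p : ℝ) ^ (9 * k) / cent b) * (cent b / (p : ℝ) ^ (9 * k)))) ?_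
  rw [hc]; push_cast; rfl

end PartF1

section PartF2

variable (p : ℕ) [hp : Fact p.Prime]

/-- the principal congruence subgroup -/
noncomputable abbrev KK (m : ℕ) : Subgroup (Matrix.SpecialLinearGroup (Fin 3) ℤ_[p]) :=
  (Matrix.SpecialLinearGroup.map (n := Fin 3) (PadicInt.toZModPow (p := p) m)).ker

theorem tz_iff (N : ℕ) (x : ℤ_[p]) : PadicInt.toZModPow N x = 0 ↔ ∃ y, x = (p : ℤ_[p]) ^ N * y := by
  rw [← RingHom.mem_ker, PadicInt.ker_toZModPow, Ideal.mem_span_singleton]; rfl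

theorem tz_iff' (N : ℕ) (x y : ℤ_[p]) : PadicInt.toZModPow N x = PadicInt.toZModPow N y ↔ ∃ z, x - y = (p : ℤ_[p]) ^ N * z := by
  rw [← sub_eq_zero, ← map_sub, tz_iff]

theorem tz_surj (N : ℕ) : Function.Surjective (PadicInt.toZModPow (p := p) N) := ZMod.ringHom_surjective _

theorem tzM_iff (N : ℕ) (x y : M3 ℤ_[p]) :
    (PadicInt.toZModPow N).mapMatrix x = (PadicInt.toZModPow N).mapMatrix y ↔ ∃ z : M3 ℤ_[p], x - y = ((p : ℤ_[p]) ^ N) • z := by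
  constructor
  · intro h
    have : ∀ i j, ∃ z, x i j - y i j = (p : ℤ_[p]) ^ N * z := fun i j => (tz_iff' p N _ _).1 (congrFun (congrFun h i) j)
    choose z hz using this
    exact ⟨Matrix.of z, by ext i j; simp [hz]⟩
  · rintro ⟨z, hz⟩
    ext i j
    exact (tz_iff' p N _ _).2 ⟨z i j, congrFun (congrFun hz i) j⟩

theorem pz_ne (N : ℕ) : ((p : ℤ_[p]) ^ N) ≠ 0 := pow_ne_zero _ (by exact_mod_cast hp.out.ne_zero)

theorem pz_smul_inj (N : ℕ) (x y : M3 ℤ_[p]) (h : ((p : ℤ_[p]) ^ N) • x = ((p : ℤ_[p]) ^ N) • y) : x = y := by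
  ext i j
  have := congrFun (congrFun h i) j
  simp only [Matrix.smul_apply, smul_eq_mul] at this
  exact mul_left_cancel₀ (pz_ne p N) this

theorem mem_KK (m : ℕ) (g : Matrix.SpecialLinearGroup (Fin 3) ℤ_[p]) : g ∈ KK p m ↔ ∃ x : M3 ℤ_[p], (g : M3 ℤ_[p]) = 1 + ((p : ℤ_[p]) ^ m) • x := by
  rw [MonoidHom.mem_ker]
  have : Matrix.SpecialLinearGroup.map (n := Fin 3) (PadicInt.toZModPow (p := p) m) g = 1 ↔
    (PadicInt.toZModPow m).mapMatrix (g : M3 ℤ_[p]) = (PadicInt.toZModPow m).mapMatrix 1 := by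
    rw [map_one]; exact ⟨fun h => congrArg Subtype.val h, fun h => Subtype.ext h⟩
  rw [this, tzM_iff]
  simp only [sub_eq_iff_eq_add']

/-- the coordinate -/
noncomputable def xco (m : ℕ) (g : KK p m) : M3 ℤ_[p] := ((mem_KK p m g.1).1 g.2).choose

theorem xco_spec (m : ℕ) (g : KK p m) : ((g : Matrix.SpecialLinearGroup (Fin 3) ℤ_[p]) : M3 ℤ_[p]) = 1 + ((p : ℤ_[p]) ^ m) • xco p m g :=
  ((mem_KK p m g.1).1 g.2).choose_spec

theorem xco_unique (m : ℕ) (g : KK p m) (x : M3 ℤ_[p]) (h : ((g : Matrix.SpecialLinearGroup (Fin 3) ℤ_[p]) : M3 ℤ_[p]) = 1 + ((p : ℤ_[p]) ^ m) • x) :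
    xco p m g = x := by
  rw [xco_spec] at h
  exact pz_smul_inj p m _ _ (add_left_cancel h)

theorem tzp (m n : ℕ) : PadicInt.toZModPow (p := p) n ((p : ℤ_[p]) ^ m) = (p : ZMod (p ^ n)) ^ m := by
  rw [map_pow, map_natCast]

theorem tz_smul (n : ℕ) (c : ℤ_[p]) (x : M3 ℤ_[p]) : (PadicInt.toZModPow n).mapMatrix (c • x) = PadicInt.toZModPow n c • (PadicInt.toZModPow n).mapMatrix x := by
  ext i j; simp

/-- the group of level `n` -/
abbrev GG (m n : ℕ) := Gam (ZMod (p ^ n)) (M3 (ZMod (p ^ n))) ((p : ZMod (p ^ n)) ^ m)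

/-- projection to the finite group -/
noncomputable def piK (m n : ℕ) [NeZero m] : KK p m →* GG p m n where
  toFun g := ⟨(PadicInt.toZModPow n).mapMatrix (xco p m g)⟩
  map_one' := by
    apply Gam.ext
    rw [xco_unique p m 1 0 (by simp)]
    simp [gam_one]
  map_mul' g h := by
    apply Gam.ext
    rw [gam_mul]
    rw [xco_unique p m (g * h) (xco p m g + xco p m h + ((p : ℤ_[p]) ^ m) • (xco p m g * xco p m h))]
    · dsimp only
      rw [map_add, map_add, tz_smul, map_mul, tzp]
    · rw [Subgroup.coe_mul, Matrix.SpecialLinearGroup.coe_mul, xco_spec, xco_spec p m h]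
      simp only [mul_add, add_mul, mul_one, one_mul, smul_mul_assoc, mul_smul_comm, smul_add]
      abel

theorem piK_one (m n : ℕ) [NeZero m] (g : KK p m) (h : piK p m n g = 1) : (g : Matrix.SpecialLinearGroup (Fin 3) ℤ_[p]) ∈ KK p (n + m) := by
  have h1 : (PadicInt.toZModPow n).mapMatrix (xco p m g) = (PadicInt.toZModPow n).mapMatrix 0 := by
    rw [map_zero]; exact congrArg Gam.v h
  obtain ⟨z, hz⟩ := (tzM_iff p n _ _).1 h1
  rw [sub_zero] at hz
  rw [mem_KK]
  refine ⟨z, ?_⟩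
  rw [xco_spec, hz, smul_smul, ← pow_add, add_comm m n]

theorem piK_congr (m n : ℕ) [NeZero m] (g h : KK p m) (H : ∀ i j, ‖(g.1 : M3 ℤ_[p]) i j - (h.1 : M3 ℤ_[p]) i j‖ ≤ (p : ℝ) ^ (-((n + m : ℕ)) : ℤ)) : piK p m n g = piK p m n h := by
  apply Gam.ext
  change (PadicInt.toZModPow n).mapMatrix (xco p m g) = (PadicInt.toZModPow n).mapMatrix (xco p m h)
  rw [tzM_iff]
  have : ∀ i j, ∃ z, (g.1 : M3 ℤ_[p]) i j - (h.1 : M3 ℤ_[p]) i j = (p : ℤ_[p]) ^ (n + m) * z := by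
    intro i j
    have := H i j
    rwa [PadicInt.norm_le_pow_iff_mem_span_pow, Ideal.mem_span_singleton] at this
  choose z hz using this
  refine ⟨Matrix.of z, ?_⟩
  apply pz_smul_inj p m
  have h2 : (g.1 : M3 ℤ_[p]) - (h.1 : M3 ℤ_[p]) = ((p : ℤ_[p]) ^ m) • (xco p m g - xco p m h) := by
    rw [xco_spec, xco_spec p m h, smul_sub]; abel
  rw [← h2, smul_smul, ← pow_add, add_comm m n]
  ext i j
  simp [hz]

theorem cont_of_piK (m n : ℕ) [NeZero m] {X : Type*} [TopologicalSpace X] (F : KK p m → X) (hF : ∀ g h, piK p m n g = piK p m n h → F g = F h) : Continuous F := by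
  rw [continuous_iff_continuousAt]
  intro g
  have hopen : ∀ᶠ h : KK p m in nhds g, ∀ i j, ‖(h.1 : M3 ℤ_[p]) i j - (g.1 : M3 ℤ_[p]) i j‖ ≤ (p : ℝ) ^ (-((n + m : ℕ)) : ℤ) := by
    rw [Filter.eventually_all]; intro i
    rw [Filter.eventually_all]; intro j
    have hc : Continuous fun h : KK p m => ‖(h.1 : M3 ℤ_[p]) i j - (g.1 : M3 ℤ_[p]) i j‖ := by
      have : Continuous fun h : Matrix.SpecialLinearGroup (Fin 3) ℤ_[p] => (h : M3 ℤ_[p]) := continuous_subtype_val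
      have h2 : Continuous fun h : KK p m => (h.1 : M3 ℤ_[p]) := this.comp continuous_subtype_val
      exact ((h2.matrix_elem i j).sub continuous_const).norm
    have : ∀ᶠ h : KK p m in nhds g, ‖(h.1 : M3 ℤ_[p]) i j - (g.1 : M3 ℤ_[p]) i j‖ < (p : ℝ) ^ (-((n + m : ℕ)) : ℤ) := by
      apply hc.continuousAt.eventually_lt continuousAt_const
      simp only [sub_self, norm_zero]
      exact zpow_pos (by exact_mod_cast hp.out.pos) _
    exact this.mono fun h hh => hh.le
  apply ContinuousAt.congr (continuousAt_const (y := F g))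
  filter_upwards [hopen] with h hh
  exact (hF _ _ (piK_congr p m n h g hh)).symm

noncomputable instance gamComm (n m : ℕ) [NeZero m] : CommGroup (Gam (ZMod (p ^ n)) (ZMod (p ^ n)) ((p : ZMod (p ^ n)) ^ m)) :=
  { (inferInstance : Group (Gam (ZMod (p ^ n)) (ZMod (p ^ n)) ((p : ZMod (p ^ n)) ^ m))) with
    mul_comm := fun a b => by
      apply Gam.ext
      rw [gam_mul, gam_mul, mul_comm a.v, add_comm a.v] }

/-- scalars -/
noncomputable def iot (m n : ℕ) [NeZero m] : Gam (ZMod (p ^ n)) (ZMod (p ^ n)) ((p : ZMod (p ^ n)) ^ m) →* GG p m n where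
  toFun c := ⟨c.v • 1⟩
  map_one' := by
    apply Gam.ext
    change (0 : ZMod (p ^ n)) • (1 : M3 (ZMod (p ^ n))) = 0
    simp
  map_mul' a b := by
    apply Gam.ext
    change (a.v + b.v + _ • (a.v * b.v)) • (1 : M3 (ZMod (p ^ n))) = a.v • (1 : M3 (ZMod (p ^ n))) + b.v • (1 : M3 (ZMod (p ^ n))) + _ • (a.v • (1 : M3 (ZMod (p ^ n))) * b.v • (1 : M3 (ZMod (p ^ n))))
    simp only [add_smul, smul_mul_assoc, mul_smul_comm, one_mul, smul_smul, smul_eq_mul, mul_assoc, mul_comm b.v]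

theorem iot_central (m n : ℕ) [NeZero m] (c) (x : GG p m n) : iot p m n c * x = x * iot p m n c := by
  apply Gam.ext
  rw [gam_mul, gam_mul]
  change c.v • (1 : M3 (ZMod (p ^ n))) + x.v + _ • (c.v • (1 : M3 (ZMod (p ^ n))) * x.v) = x.v + c.v • (1 : M3 (ZMod (p ^ n))) + _ • (x.v * (c.v • (1 : M3 (ZMod (p ^ n)))))
  rw [smul_mul_assoc, mul_smul_comm, one_mul, mul_one, add_comm x.v]

theorem det_one_add' {S : Type} [CommRing S] (q : S) (x : M3 S) : ∃ D, (1 + q • x).det = 1 + q * D := by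
  rw [Matrix.det_one_add_smul]
  generalize Polynomial.eval (R := S) _ _ = e
  exact ⟨x.trace + q * e, by ring⟩

theorem three_unit (h3 : p ≠ 3) : IsUnit (3 : ℤ_[p]) := by
  by_contra h
  rw [PadicInt.not_isUnit_iff] at h
  have : ((3 : ℕ) : ℤ_[p]) = 3 := by norm_num
  rw [← this, PadicInt.norm_lt_one_iff_dvd] at h
  have h' := map_dvd (PadicInt.toZMod (p := p)) h
  rw [map_natCast, map_natCast, ZMod.natCast_self, zero_dvd_iff, ZMod.natCast_eq_zero_iff] at h'
  exact h3 ((Nat.prime_dvd_prime_iff_eq hp.out Nat.prime_three).1 h')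

theorem unit_add_p {u : ℤ_[p]} (hu : IsUnit u) (x : ℤ_[p]) (h : ‖x‖ < 1) : IsUnit (u + x) := by
  rw [PadicInt.isUnit_iff] at *
  rw [PadicInt.norm_add_eq_max_of_ne (by rw [hu]; exact h.ne'), hu, max_eq_left h.le]

theorem pm_norm (m : ℕ) (hm : m ≠ 0) (y : ℤ_[p]) : ‖(p : ℤ_[p]) ^ m * y‖ < 1 := by
  rw [PadicInt.norm_lt_one_iff_dvd]
  exact (dvd_pow_self _ hm).mul_right _

theorem cube_root (h3 : p ≠ 3) (m : ℕ) (hm : m ≠ 0) (D : ℤ_[p]) : ∃ c, (1 + (p : ℤ_[p]) ^ m * c) ^ 3 = 1 + (p : ℤ_[p]) ^ m * D := by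
  have hn3 : ‖(3 : ℤ_[p])‖ = 1 := PadicInt.isUnit_iff.1 (three_unit p h3)
  obtain ⟨z, hz1, hz2, -, -⟩ := hensels_lemma (p := p) (R := ℤ_[p]) (F := (Polynomial.X ^ 3 - Polynomial.C (1 + (p : ℤ_[p]) ^ m * D))) (a := 1) (by
    simp only [map_sub, map_pow, Polynomial.aeval_X, Polynomial.aeval_C, Polynomial.derivative_sub, Polynomial.derivative_X_pow, Polynomial.derivative_C]
    simp [hn3]
    simpa using pm_norm p m hm D)
  have hz3 : z ^ 3 = 1 + (p : ℤ_[p]) ^ m * D := by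
    simpa [sub_eq_zero] using hz1
  have hz4 : ‖z - 1‖ < 1 := by
    simp only [Polynomial.derivative_sub, Polynomial.derivative_X_pow, Polynomial.derivative_C, sub_zero] at hz2
    simpa [hn3] using hz2
  have hu : IsUnit (3 + (z - 1) * (z + 2)) := by
    apply unit_add_p p (three_unit p h3)
    rw [norm_mul]
    exact mul_lt_one_of_nonneg_of_lt_one_left (norm_nonneg _) hz4 (PadicInt.norm_le_one _)
  obtain ⟨u, hu⟩ := hu
  refine ⟨D * (u⁻¹ : ℤ_[p]ˣ), ?_⟩
  have : z = 1 + (p : ℤ_[p]) ^ m * (D * (u⁻¹ : ℤ_[p]ˣ)) := by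
    have h1 : (z - 1) * u = (p : ℤ_[p]) ^ m * D := by
      rw [hu]; linear_combination hz3
    rw [← mul_assoc, ← h1, mul_assoc, Units.mul_inv]; ring
  rw [← this, hz3]

/-- the splitting -/
noncomputable def splitHom (m n : ℕ) [NeZero m] : (piK p m n).range × Gam (ZMod (p ^ n)) (ZMod (p ^ n)) ((p : ZMod (p ^ n)) ^ m) →* GG p m n where
  toFun x := x.1 * iot p m n x.2
  map_one' := by simp
  map_mul' x y := by
    rw [Prod.fst_mul, Prod.snd_mul, map_mul, Subgroup.coe_mul]
    simp only [mul_assoc]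
    rw [← mul_assoc (iot p m n x.2) (y.1 : GG p m n), iot_central p m n x.2 (y.1 : GG p m n)]
    simp only [mul_assoc]

theorem split_surj (h3 : p ≠ 3) (m n : ℕ) [hm : NeZero m] : Function.Surjective (splitHom p m n) := by
  rintro ⟨x⟩
  choose f hf using tz_surj p n
  set x' : M3 ℤ_[p] := x.map f with hx'
  have hx : (PadicInt.toZModPow n).mapMatrix x' = x := by ext i j; simp [hx', hf]
  obtain ⟨D, hD⟩ := det_one_add' ((p : ℤ_[p]) ^ m) x'
  obtain ⟨c, hc⟩ := cube_root p h3 m hm.out D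
  obtain ⟨u, hu⟩ := unit_add_p p isUnit_one _ (pm_norm p m hm.out c)
  have hdet : (((u⁻¹ : ℤ_[p]ˣ) : ℤ_[p]) • (1 + ((p : ℤ_[p]) ^ m) • x')).det = 1 := by
    rw [Matrix.det_smul, hD, ← hc, Fintype.card_fin, ← mul_pow, ← hu, Units.inv_mul, one_pow]
  have hy : ((u⁻¹ : ℤ_[p]ˣ) : ℤ_[p]) • (1 + ((p : ℤ_[p]) ^ m) • x') = 1 + ((p : ℤ_[p]) ^ m) • (((u⁻¹ : ℤ_[p]ˣ) : ℤ_[p]) • (x' - c • 1)) := by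
    have h1 : ((u⁻¹ : ℤ_[p]ˣ) : ℤ_[p]) * (1 + (p : ℤ_[p]) ^ m * c) = 1 := by rw [← hu, Units.inv_mul]
    have h2 : (1 : M3 ℤ_[p]) = (((u⁻¹ : ℤ_[p]ˣ) : ℤ_[p]) * (1 + (p : ℤ_[p]) ^ m * c)) • (1 : M3 ℤ_[p]) := by rw [h1, one_smul]
    nth_rewrite 2 [h2]
    module
  let g : KK p m := ⟨⟨_, hdet⟩, (mem_KK p m _).2 ⟨_, hy⟩⟩
  refine ⟨⟨⟨piK p m n g, ⟨g, rfl⟩⟩, ⟨PadicInt.toZModPow n c⟩⟩, ?_⟩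
  apply Gam.ext
  change (piK p m n g * iot p m n _).v = x
  rw [gam_mul]
  change (PadicInt.toZModPow n).mapMatrix (xco p m g) + PadicInt.toZModPow n c • 1 + _ • ((PadicInt.toZModPow n).mapMatrix (xco p m g) * PadicInt.toZModPow n c • 1) = x
  rw [xco_unique p m g _ hy, mul_smul_comm, mul_one, ← hx, ← tzp, ← tz_smul, ← tz_smul, ← map_one (PadicInt.toZModPow n).mapMatrix, ← tz_smul, ← map_add, ← map_add]
  congr 1
  have h1 : ((u⁻¹ : ℤ_[p]ˣ) : ℤ_[p]) * (1 + (p : ℤ_[p]) ^ m * c) = 1 := by rw [← hu, Units.inv_mul]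
  calc _ = (((u⁻¹ : ℤ_[p]ˣ) : ℤ_[p]) * (1 + (p : ℤ_[p]) ^ m * c)) • (x' - c • 1) + c • 1 := by module
    _ = x' := by rw [h1, one_smul]; abel

theorem split_inj (h3 : p ≠ 3) (m n : ℕ) [hm : NeZero m] : Function.Injective (splitHom p m n) := by
  rw [injective_iff_map_eq_one]
  rintro ⟨⟨_, ⟨g, rfl⟩⟩, ⟨c⟩⟩ h
  obtain ⟨c, rfl⟩ := tz_surj p n c
  have h0 := congrArg Gam.v h
  change (piK p m n g * iot p m n _).v = 0 at h0
  rw [gam_mul] at h0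
  change (PadicInt.toZModPow n).mapMatrix (xco p m g) + PadicInt.toZModPow n c • 1 + _ • ((PadicInt.toZModPow n).mapMatrix (xco p m g) * PadicInt.toZModPow n c • 1) = 0 at h0
  rw [mul_smul_comm, mul_one, ← tzp, ← tz_smul, ← tz_smul, ← map_one (PadicInt.toZModPow n).mapMatrix, ← tz_smul, ← map_add, ← map_add, ← map_zero (PadicInt.toZModPow n).mapMatrix, tzM_iff] at h0
  obtain ⟨z, hz⟩ := h0
  rw [sub_zero] at hz
  have h1 : (1 + (p : ℤ_[p]) ^ m * c) • (g.1 : M3 ℤ_[p]) = 1 + ((p : ℤ_[p]) ^ (m + n)) • z := by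
    rw [xco_spec, pow_add, mul_smul, ← hz]
    module
  have h2 := congrArg Matrix.det h1
  obtain ⟨D, hD⟩ := det_one_add' ((p : ℤ_[p]) ^ (m + n)) z
  rw [hD, Matrix.det_smul, g.1.2, mul_one, Fintype.card_fin] at h2
  have h4 : c * (3 + (p : ℤ_[p]) ^ m * (3 * c + (p : ℤ_[p]) ^ m * c ^ 2)) = (p : ℤ_[p]) ^ n * D := by
    apply mul_left_cancel₀ (pz_ne p m)
    rw [pow_add] at h2
    linear_combination h2
  obtain ⟨u, hu⟩ := unit_add_p p (three_unit p h3) _ (pm_norm p m hm.out (3 * c + (p : ℤ_[p]) ^ m * c ^ 2))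
  have h5 : PadicInt.toZModPow n c = 0 := by
    rw [tz_iff]
    refine ⟨D * (u⁻¹ : ℤ_[p]ˣ), ?_⟩
    rw [← mul_assoc, ← h4, ← hu, mul_assoc, Units.mul_inv, mul_one]
  have h6 : (⟨PadicInt.toZModPow n c⟩ : Gam (ZMod (p ^ n)) (ZMod (p ^ n)) ((p : ZMod (p ^ n)) ^ m)) = 1 := Gam.ext h5
  rw [h6] at h ⊢
  have h7 : piK p m n g = 1 := by
    have : piK p m n g * iot p m n 1 = 1 := h
    rwa [map_one, mul_one] at this
  apply Prod.ext
  · exact Subtype.ext h7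
  · rfl

theorem sl_count (h3 : p ≠ 3) (m k : ℕ) [NeZero m] (hm : 2 ≤ m) :
    ∃ (N : ℕ) (φ : Fin N → IrrAll (KK p m)), Function.Injective φ ∧
      (∀ (n : ℕ) (ρ : {ρ : KK p m →* GL (Fin n) ℂ // RepContinuous ρ ∧ RepIsIrreducible ρ}),
        (∀ g : KK p m, (g : Matrix.SpecialLinearGroup (Fin 3) ℤ_[p]) ∈ KK p (k + m + m) → ρ.1 g = 1) → (⟨n, Quot.mk _ ρ⟩ : IrrAll (KK p m)) ∈ Set.range φ) ∧
      ∀ f : ℝ → ℝ, (p : ℝ) ^ k * ∑ i, f (((φ i).1 : ℝ) ^ 2) = (p : ℝ) ^ (8 * m) * ∑ b : M3 (ZMod (p ^ k)), f ((p : ℝ) ^ (9 * k) / cent b) * (cent b / (p : ℝ) ^ (9 * k)) := by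
  classical
  haveI : Fintype (piK p m (k + m)).range := Fintype.ofFinite _
  haveI : IsSemisimpleRing (MonoidAlgebra ℂ (piK p m (k + m)).range) := inferInstance
  haveI : FiniteDimensional ℂ (MonoidAlgebra ℂ (piK p m (k + m)).range) := inferInstance
  obtain ⟨N, d, hd, ⟨Φ⟩⟩ := IsSemisimpleRing.exists_algEquiv_pi_matrix_of_isAlgClosed ℂ (MonoidAlgebra ℂ (piK p m (k + m)).range)
  obtain ⟨φ, hφ1, hφ2, hφ3⟩ := exists_phi Φ (piK p m (k + m)).rangeRestrict (piK p m (k + m)).rangeRestrict_surjective (by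
    intro i
    apply cont_of_piK p m (k + m)
    intro g h hgh
    have : (piK p m (k + m)).rangeRestrict g = (piK p m (k + m)).rangeRestrict h := Subtype.ext hgh
    rw [MonoidHom.comp_apply, MonoidHom.comp_apply, this])
  refine ⟨N, φ, hφ1, fun n ρ hρ => hφ3 n ρ fun g hg => hρ g (piK_one p m (k + m) g (congrArg Subtype.val hg)), fun f => ?_⟩
  obtain ⟨Φ'⟩ := prod_blocks Φ (MulEquiv.ofBijective (splitHom p m (k + m)) ⟨split_inj p h3 m _, split_surj p h3 m _⟩)
  have h := gl_count p m k hm Φ' f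
  rw [Fintype.sum_prod_type] at h
  simp only [Finset.sum_const, Finset.card_univ, nsmul_eq_mul] at h
  rw [AddChar.card_eq, Fintype.card_congr Additive.toMul, Fintype.card_congr (Gam.equiv _ _ _), ZMod.card, ← Finset.mul_sum] at h
  simp only [hφ2]
  apply mul_left_cancel₀ (pow_ne_zero m (by exact_mod_cast hp.out.ne_zero : (p : ℝ) ≠ 0))
  push_cast at h
  rw [← mul_assoc, ← pow_add, add_comm m k, h, ← mul_assoc, ← pow_add]
  congr 2; ring

end PartF2

section PartG1

section generic
variable {R : Type} [CommRing R]

/-- normal form -/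
def NF (b c d g h : R) : M3 R := !![0, b, c; 1, d, 0; 0, g, h]

/-- similarity -/
def Sim (a b : M3 R) : Prop := ∃ P : (M3 R)ˣ, (P : M3 R) * b = a * P

/-- scalar plus rank one -/
def Lv (a : M3 R) : Prop := ∃ (l : R) (u w : Fin 3 → R), a = l • 1 + Matrix.vecMulVec u w

theorem Sim.trans {a b c : M3 R} (h : Sim a b) (h' : Sim b c) : Sim a c := by
  obtain ⟨P, hP⟩ := h
  obtain ⟨Q, hQ⟩ := h'
  exact ⟨P * Q, by rw [Units.val_mul, mul_assoc, hQ, ← mul_assoc, hP, mul_assoc]⟩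

theorem Sim.symm {a b : M3 R} (h : Sim a b) : Sim b a := by
  obtain ⟨P, hP⟩ := h
  refine ⟨P⁻¹, ?_⟩
  rw [Units.inv_mul_eq_iff_eq_mul, ← mul_assoc, hP, mul_assoc, Units.mul_inv, mul_one]

theorem Sim.map {S : Type} [CommRing S] (f : R →+* S) {a b : M3 R} (h : Sim a b) : Sim (f.mapMatrix a) (f.mapMatrix b) := by
  obtain ⟨P, hP⟩ := h
  exact ⟨Units.map f.mapMatrix.toMonoidHom P, by
    change f.mapMatrix (P : M3 R) * _ = _ * f.mapMatrix (P : M3 R)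
    rw [← map_mul, ← map_mul, hP]⟩

theorem Sim.lv {a b : M3 R} (h : Sim a b) (hb : Lv b) : Lv a := by
  obtain ⟨P, hP⟩ := h
  obtain ⟨l, u, w, rfl⟩ := hb
  refine ⟨l, (P : M3 R).mulVec u, Matrix.vecMul w ((P⁻¹ : (M3 R)ˣ) : M3 R), ?_⟩
  rw [← Matrix.vecMulVec_mul, ← Matrix.mul_vecMulVec]
  have : a = a * P * ((P⁻¹ : (M3 R)ˣ) : M3 R) := by rw [mul_assoc, Units.mul_inv, mul_one]
  rw [this, ← hP, mul_add, add_mul, mul_smul_comm, mul_one, smul_mul_assoc, Units.mul_inv]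

theorem Sim.cent {a b : M3 R} (h : Sim a b) : Nat.card {γ : M3 R // a * γ = γ * a} = Nat.card {γ : M3 R // b * γ = γ * b} := by
  obtain ⟨P, hP⟩ := h
  have hb : b = ((P⁻¹ : (M3 R)ˣ) : M3 R) * a * P := by
    rw [mul_assoc, ← hP, ← mul_assoc, Units.inv_mul, one_mul]
  let e : M3 R ≃ M3 R := ⟨fun γ => ((P⁻¹ : (M3 R)ˣ) : M3 R) * γ * P, fun γ => P * γ * ((P⁻¹ : (M3 R)ˣ) : M3 R),
    fun γ => by simp only [mul_assoc, Units.mul_inv, mul_one]; rw [← mul_assoc, Units.mul_inv, one_mul],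
    fun γ => by simp only [mul_assoc, Units.inv_mul, mul_one]; rw [← mul_assoc, Units.inv_mul, one_mul]⟩
  refine Nat.card_congr (e.subtypeEquiv fun γ => ?_)
  change _ ↔ b * (((P⁻¹ : (M3 R)ˣ) : M3 R) * γ * P) = ((P⁻¹ : (M3 R)ˣ) : M3 R) * γ * P * b
  have h1 : b * (((P⁻¹ : (M3 R)ˣ) : M3 R) * γ * P) = ((P⁻¹ : (M3 R)ˣ) : M3 R) * ((a * γ) * P) := by
    rw [hb]; simp only [mul_assoc]; rw [← mul_assoc (P : M3 R) ((P⁻¹ : (M3 R)ˣ) : M3 R), Units.mul_inv, one_mul]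
  have h2 : ((P⁻¹ : (M3 R)ˣ) : M3 R) * γ * P * b = ((P⁻¹ : (M3 R)ˣ) : M3 R) * ((γ * a) * P) := by
    rw [hb]; simp only [mul_assoc]; rw [← mul_assoc (P : M3 R) ((P⁻¹ : (M3 R)ˣ) : M3 R), Units.mul_inv, one_mul]
  rw [h1, h2, Units.mul_right_inj, Units.mul_left_inj]

theorem lv_NF (b c d g h : R) : Lv (NF b c d g h) ↔ c = 0 ∧ h ^ 2 - d * h - b = 0 ∧ g = 0 := by
  constructor
  · rintro ⟨l, u, w, H⟩
    have H' : ∀ i j, NF b c d g h i j = l * (1 : M3 R) i j + u i * w j := by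
      intro i j; rw [H]; simp [Matrix.vecMulVec_apply]
    have e00 := H' 0 0
    have e01 := H' 0 1
    have e02 := H' 0 2
    have e10 := H' 1 0
    have e11 := H' 1 1
    have e12 := H' 1 2
    have e20 := H' 2 0
    have e21 := H' 2 1
    have e22 := H' 2 2
    simp [NF] at e00 e01 e02 e10 e11 e12 e20 e21 e22
    have hg : g = 0 := by linear_combination e21 + u 2 * w 1 * e10 - u 1 * w 1 * e20
    have hc : c = 0 := by linear_combination e02 + u 0 * w 2 * e10 - u 0 * w 0 * e12
    have hl : h = l := by linear_combination e22 + u 2 * w 2 * e10 - u 1 * w 2 * e20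
    refine ⟨hc, ?_, hg⟩
    rw [hl]
    linear_combination (-l) * e11 - e01 + u 1 * w 1 * e00 - u 0 * w 1 * e10
  · rintro ⟨rfl, hb, rfl⟩
    refine ⟨h, ![-h, 1, 0], ![1, d - h, 0], ?_⟩
    have hb' : b = h ^ 2 - d * h := by linear_combination -hb
    subst hb'
    ext i j
    fin_cases i <;> fin_cases j <;> simp [NF, Matrix.vecMulVec_apply] <;> ring

/-- the equivalence computing the centralizer -/
def centEquiv (b c d g h : R) : {γ : M3 R // NF b c d g h * γ = γ * NF b c d g h} ≃
    R × R × {y : R × R × R // c * y.2.1 = (h ^ 2 - d * h - b) * y.1 ∧ c * y.2.2 = g * y.1 ∧ (h ^ 2 - d * h - b) * y.2.2 = g * y.2.1} where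
  toFun γ := (γ.1 0 0, γ.1 1 0, ⟨(γ.1 1 2, γ.1 2 2 - γ.1 0 0 - h * γ.1 1 0, γ.1 2 0), by
    have H : ∀ i j, (NF b c d g h * γ.1) i j = (γ.1 * NF b c d g h) i j := fun i j => by rw [γ.2]
    have e10 := H 1 0
    have e20 := H 2 0
    have e21 := H 2 1
    have e02 := H 0 2
    have e12 := H 1 2
    have e22 := H 2 2
    simp [NF, Matrix.mul_apply, Fin.sum_univ_three] at e10 e20 e21 e02 e12 e22
    refine ⟨?_, ?_, ?_⟩
    · linear_combination e02 + h * e12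
    · linear_combination -e22
    · linear_combination e21 + g * e10 + (h - d) * e20⟩)
  invFun t := ⟨!![t.1, b * t.2.1 + c * t.2.2.1.2.2, c * t.2.1 - (d - h) * t.2.2.1.1;
      t.2.1, t.1 + d * t.2.1, t.2.2.1.1;
      t.2.2.1.2.2, g * t.2.1 + h * t.2.2.1.2.2, t.2.2.1.2.1 + t.1 + h * t.2.1], by
    obtain ⟨x, y, ⟨⟨w, r, z⟩, h1, h2, h3⟩⟩ := t
    dsimp only at *
    ext i j
    fin_cases i <;> fin_cases j <;> simp [NF, Matrix.mul_apply, Fin.sum_univ_three]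
    · linear_combination (h - d) * h2
    · linear_combination h1
    · linear_combination h2
    · ring
    · linear_combination h3
    · linear_combination -h2⟩
  left_inv := by
    rintro ⟨γ, hγ⟩
    have H : ∀ i j, (NF b c d g h * γ) i j = (γ * NF b c d g h) i j := fun i j => by rw [hγ]
    have e00 := H 0 0
    have e10 := H 1 0
    have e20 := H 2 0
    have e12 := H 1 2
    simp [NF, Matrix.mul_apply, Fin.sum_univ_three] at e00 e10 e20 e12
    apply Subtype.ext
    ext i j
    fin_cases i <;> fin_cases j <;> simp
    · linear_combination e00
    · linear_combination -e12
    · linear_combination e10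
    · linear_combination e20
    · ring
  right_inv := by
    rintro ⟨x, y, ⟨⟨w, r, z⟩, h1, h2, h3⟩⟩
    simp
    ring

theorem sim_NF0 (b c d g h f : R) : Sim (!![0, b, c; 1, d, f; 0, g, h]) (NF (b + g * f) (c + h * f) d g h) := by
  refine ⟨⟨!![1, 0, -f; 0, 1, 0; 0, 0, 1], !![1, 0, f; 0, 1, 0; 0, 0, 1], ?_, ?_⟩, ?_⟩
  · ext i j; fin_cases i <;> fin_cases j <;> simp [Matrix.mul_apply, Fin.sum_univ_three]
  · ext i j; fin_cases i <;> fin_cases j <;> simp [Matrix.mul_apply, Fin.sum_univ_three]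
  · ext i j; fin_cases i <;> fin_cases j <;> simp [NF, Matrix.mul_apply, Fin.sum_univ_three] <;> ring

theorem sim_NF (a : M3 R) (v f : Fin 3 → R) (hdet : IsUnit (Matrix.of fun r s => ![v r, a.mulVec v r, f r] s : M3 R).det) :
    ∃ b c d g h, Sim a (NF b c d g h) := by
  obtain ⟨P, hP⟩ := (Matrix.isUnit_iff_isUnit_det _).2 hdet
  set N : M3 R := ((P⁻¹ : (M3 R)ˣ) : M3 R) * (a * P) with hN
  have h0 : ∀ r, N r 0 = (1 : M3 R) r 1 := by
    intro r
    have h1 : ∀ t, (a * (P : M3 R)) t 0 = (P : M3 R) t 1 := by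
      intro t
      rw [hP, Matrix.mul_apply]
      simp [Matrix.mulVec, dotProduct]
    rw [hN, Matrix.mul_apply]
    simp only [h1]
    rw [← Matrix.mul_apply, Units.inv_mul]
  have hs : Sim a N := ⟨P, by rw [hN, ← mul_assoc, Units.mul_inv, one_mul]⟩
  have hN' : N = !![0, N 0 1, N 0 2; 1, N 1 1, N 1 2; 0, N 2 1, N 2 2] := by
    ext i j; fin_cases i <;> fin_cases j <;> simp [h0]
  rw [hN'] at hs
  exact ⟨_, _, _, _, _, hs.trans (sim_NF0 _ _ _ _ _ _)⟩

end generic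

end PartG1

section PartG2

variable (p : ℕ) [hp : Fact p.Prime]

theorem nu_iff (k : ℕ) (hk : k ≠ 0) (x : ZMod (p ^ k)) : ¬ IsUnit x ↔ ∃ y, x = (p : ZMod (p ^ k)) * y := by
  constructor
  · intro h
    obtain ⟨n, rfl⟩ := ZMod.natCast_zmod_surjective x
    rw [ZMod.isUnit_iff_coprime] at h
    have : p ∣ n := by
      by_contra h'
      exact h (((Nat.Prime.coprime_iff_not_dvd hp.out).2 h').symm.pow_right k)
    obtain ⟨m, rfl⟩ := this
    exact ⟨m, by push_cast; rfl⟩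
  · rintro ⟨y, rfl⟩ h
    have h1 := isUnit_of_mul_isUnit_left h
    have : ((p : ℕ) : ZMod (p ^ k)) = p := rfl
    rw [ZMod.isUnit_iff_coprime] at h1
    rw [Nat.coprime_pow_right_iff (Nat.pos_of_ne_zero hk), Nat.coprime_self] at h1
    exact hp.out.one_lt.ne' h1

/-- reduction -/
noncomputable def rd (i k : ℕ) (h : i ≤ k) : ZMod (p ^ k) →+* ZMod (p ^ i) := ZMod.castHom (pow_dvd_pow p h) _

theorem rd_zero_iff (i k : ℕ) (h : i ≤ k) (x : ZMod (p ^ k)) : rd p i k h x = 0 ↔ ∃ y, x = (p : ZMod (p ^ k)) ^ i * y := by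
  constructor
  · intro hx
    obtain ⟨n, rfl⟩ := ZMod.natCast_zmod_surjective x
    rw [map_natCast, ZMod.natCast_eq_zero_iff] at hx
    obtain ⟨y, rfl⟩ := hx
    exact ⟨y, by push_cast; rfl⟩
  · rintro ⟨y, rfl⟩
    rw [map_mul, map_pow, map_natCast, zp_pow, zero_mul]

theorem card_tors (k j : ℕ) (h : j ≤ k) : Nat.card {y : ZMod (p ^ k) // (p : ZMod (p ^ k)) ^ j * y = 0} = p ^ j := by
  obtain ⟨i, rfl⟩ := Nat.exists_eq_add_of_le' h
  obtain ⟨c, hc1, -, hc3⟩ := sum_fiber_surj (red p i j).toAddMonoidHom (red_surj p i j)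
  have h2 := hc3 (fun b => b = 0)
  rw [ZMod.card, ZMod.card, pow_add, mul_comm] at hc1
  have hc : p ^ j = c := Nat.eq_of_mul_eq_mul_right (pow_pos hp.out.pos _) hc1
  rw [hc]
  have h3 : Nat.card {b : ZMod (p ^ i) // b = 0} = 1 := by simp
  rw [h3, mul_one] at h2
  rw [← h2]
  refine Nat.card_congr (Equiv.subtypeEquivRight fun y => ?_)
  exact (red_zero_iff p i j y).symm

theorem card_sys (k j : ℕ) (h : j ≤ k) (n1 n2 n3 : ZMod (p ^ k)) (hu : IsUnit n1) :
    Nat.card {y : ZMod (p ^ k) × ZMod (p ^ k) × ZMod (p ^ k) //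
      (p : ZMod (p ^ k)) ^ j * (n1 * y.2.1 - n2 * y.1) = 0 ∧ (p : ZMod (p ^ k)) ^ j * (n1 * y.2.2 - n3 * y.1) = 0 ∧
      (p : ZMod (p ^ k)) ^ j * (n2 * y.2.2 - n3 * y.2.1) = 0} = p ^ (k + 2 * j) := by
  obtain ⟨u, rfl⟩ := hu
  have hu' : (u : ZMod (p ^ k)) * ((u⁻¹ : (ZMod (p ^ k))ˣ) : ZMod (p ^ k)) = 1 := Units.mul_inv _
  generalize hv : ((u⁻¹ : (ZMod (p ^ k))ˣ) : ZMod (p ^ k)) = v at hu'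
  generalize hx : (u : ZMod (p ^ k)) = x at hu'
  let e : {y : ZMod (p ^ k) × ZMod (p ^ k) × ZMod (p ^ k) //
      (p : ZMod (p ^ k)) ^ j * (x * y.2.1 - n2 * y.1) = 0 ∧ (p : ZMod (p ^ k)) ^ j * (x * y.2.2 - n3 * y.1) = 0 ∧
      (p : ZMod (p ^ k)) ^ j * (n2 * y.2.2 - n3 * y.2.1) = 0} ≃
      ZMod (p ^ k) × {y : ZMod (p ^ k) // (p : ZMod (p ^ k)) ^ j * y = 0} × {y : ZMod (p ^ k) // (p : ZMod (p ^ k)) ^ j * y = 0} :=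
    { toFun := fun y => (y.1.1, ⟨_, y.2.1⟩, ⟨_, y.2.2.1⟩)
      invFun := fun z => ⟨(z.1, v * (z.2.1.1 + n2 * z.1), v * (z.2.2.1 + n3 * z.1)), by
        obtain ⟨a, ⟨b, hb⟩, ⟨c, hc⟩⟩ := z
        dsimp only
        refine ⟨?_, ?_, ?_⟩
        · linear_combination hb + (p : ZMod (p ^ k)) ^ j * (b + n2 * a) * hu'
        · linear_combination hc + (p : ZMod (p ^ k)) ^ j * (c + n3 * a) * hu'
        · linear_combination n2 * v * hc - n3 * v * hb⟩
      left_inv := by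
        rintro ⟨⟨a, b, c⟩, h1, h2, h3⟩
        apply Subtype.ext
        refine Prod.ext rfl (Prod.ext ?_ ?_)
        · change v * (x * b - n2 * a + n2 * a) = b
          linear_combination b * hu'
        · change v * (x * c - n3 * a + n3 * a) = c
          linear_combination c * hu'
      right_inv := by
        rintro ⟨a, ⟨b, hb⟩, ⟨c, hc⟩⟩
        refine Prod.ext rfl (Prod.ext (Subtype.ext ?_) (Subtype.ext ?_))
        · change x * (v * (b + n2 * a)) - n2 * a = b
          linear_combination (b + n2 * a) * hu'
        · change x * (v * (c + n3 * a)) - n3 * a = c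
          linear_combination (c + n3 * a) * hu' }
  rw [Nat.card_congr e, Nat.card_prod, Nat.card_prod, card_tors p k j h, Nat.card_zmod]
  ring

theorem card_sys' (k j : ℕ) (h : j ≤ k) (n1 n2 n3 : ZMod (p ^ k)) (hu : IsUnit n1 ∨ IsUnit n2 ∨ IsUnit n3) :
    Nat.card {y : ZMod (p ^ k) × ZMod (p ^ k) × ZMod (p ^ k) //
      (p : ZMod (p ^ k)) ^ j * n1 * y.2.1 = (p : ZMod (p ^ k)) ^ j * n2 * y.1 ∧ (p : ZMod (p ^ k)) ^ j * n1 * y.2.2 = (p : ZMod (p ^ k)) ^ j * n3 * y.1 ∧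
      (p : ZMod (p ^ k)) ^ j * n2 * y.2.2 = (p : ZMod (p ^ k)) ^ j * n3 * y.2.1} = p ^ (k + 2 * j) := by
  rcases hu with hu | hu | hu
  · rw [← card_sys p k j h n1 n2 n3 hu]
    refine Nat.card_congr (Equiv.subtypeEquivRight fun y => ?_)
    simp only [mul_sub, sub_eq_zero, mul_assoc]
  · rw [← card_sys p k j h n2 n1 n3 hu]
    refine Nat.card_congr (Equiv.subtypeEquiv (⟨fun y => (y.2.1, y.1, y.2.2), fun y => (y.2.1, y.1, y.2.2), fun _ => rfl, fun _ => rfl⟩) fun y => ?_)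
    simp only [mul_sub, sub_eq_zero, mul_assoc, Equiv.coe_fn_mk]
    constructor
    · rintro ⟨h1, h2, h3⟩; exact ⟨h1.symm, h3, h2⟩
    · rintro ⟨h1, h2, h3⟩; exact ⟨h1.symm, h3, h2⟩
  · rw [← card_sys p k j h n3 n1 n2 hu]
    refine Nat.card_congr (Equiv.subtypeEquiv (⟨fun y => (y.2.2, y.1, y.2.1), fun y => (y.2.1, y.2.2, y.1), fun _ => rfl, fun _ => rfl⟩) fun y => ?_)
    simp only [mul_sub, sub_eq_zero, mul_assoc, Equiv.coe_fn_mk]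
    constructor
    · rintro ⟨h1, h2, h3⟩; exact ⟨h2.symm, h3.symm, h1⟩
    · rintro ⟨h1, h2, h3⟩; exact ⟨h3, h1.symm, h2.symm⟩

theorem triple_val (k : ℕ) (hk : k ≠ 0) (x1 x2 x3 : ZMod (p ^ k)) : ∃ j ≤ k, (∃ n1 n2 n3, (IsUnit n1 ∨ IsUnit n2 ∨ IsUnit n3) ∧
    x1 = (p : ZMod (p ^ k)) ^ j * n1 ∧ x2 = (p : ZMod (p ^ k)) ^ j * n2 ∧ x3 = (p : ZMod (p ^ k)) ^ j * n3) ∧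
    ∀ i (h : i ≤ k), (rd p i k h x1 = 0 ∧ rd p i k h x2 = 0 ∧ rd p i k h x3 = 0) ↔ i ≤ j := by
  classical
  let Q : ℕ → Prop := fun j => ∃ n1 n2 n3, x1 = (p : ZMod (p ^ k)) ^ j * n1 ∧ x2 = (p : ZMod (p ^ k)) ^ j * n2 ∧ x3 = (p : ZMod (p ^ k)) ^ j * n3
  have hQ0 : Q 0 := ⟨x1, x2, x3, by simp⟩
  set j := Nat.findGreatest Q k with hj
  have hjk : j ≤ k := Nat.findGreatest_le k
  have hQj : Q j := Nat.findGreatest_spec (Nat.zero_le k) hQ0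
  refine ⟨j, hjk, ?_, ?_⟩
  · rcases hjk.eq_or_lt with h | h
    · obtain ⟨n1, n2, n3, h1, h2, h3⟩ := hQj
      refine ⟨1, 1, 1, Or.inl isUnit_one, ?_⟩
      have : (p : ZMod (p ^ k)) ^ j = 0 := by rw [h]; exact zp_pow p k
      rw [this, zero_mul] at h1 h2 h3 ⊢
      exact ⟨h1, h2, h3⟩
    · obtain ⟨n1, n2, n3, h1, h2, h3⟩ := hQj
      refine ⟨n1, n2, n3, ?_, h1, h2, h3⟩
      by_contra hn
      push Not at hn
      obtain ⟨g1, g2, g3⟩ := hn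
      rw [nu_iff p k hk] at g1 g2 g3
      obtain ⟨m1, rfl⟩ := g1
      obtain ⟨m2, rfl⟩ := g2
      obtain ⟨m3, rfl⟩ := g3
      have : Q (j + 1) := ⟨m1, m2, m3, by rw [h1]; ring, by rw [h2]; ring, by rw [h3]; ring⟩
      have := Nat.le_findGreatest (show j + 1 ≤ k by omega) this
      omega
  · intro i hi
    rw [rd_zero_iff, rd_zero_iff, rd_zero_iff]
    constructor
    · rintro ⟨⟨n1, h1⟩, ⟨n2, h2⟩, ⟨n3, h3⟩⟩
      exact Nat.le_findGreatest hi ⟨n1, n2, n3, h1, h2, h3⟩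
    · intro hij
      obtain ⟨n1, n2, n3, h1, h2, h3⟩ := hQj
      obtain ⟨l, hl⟩ := Nat.exists_eq_add_of_le hij
      rw [hl, pow_add] at h1 h2 h3
      exact ⟨⟨_, h1.trans (mul_assoc _ _ _)⟩, ⟨_, h2.trans (mul_assoc _ _ _)⟩, ⟨_, h3.trans (mul_assoc _ _ _)⟩⟩

/-- scalar modulo p -/
def Sc {k : ℕ} (b : M3 (ZMod (p ^ k))) : Prop := ∃ (c : ZMod (p ^ k)) (a : M3 (ZMod (p ^ k))), b = c • 1 + (p : ZMod (p ^ k)) • a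

theorem sc_of (k : ℕ) (b : M3 (ZMod (p ^ k))) (h : ∀ i j : Fin 3, i ≠ j → ∃ y, b i j = (p : ZMod (p ^ k)) * y)
    (h' : ∀ i, ∃ y, b i i - b 0 0 = (p : ZMod (p ^ k)) * y) : Sc p b := by
  have : ∀ i j : Fin 3, ∃ y, b i j - b 0 0 * (1 : M3 (ZMod (p ^ k))) i j = (p : ZMod (p ^ k)) * y := by
    intro i j
    by_cases hij : i = j
    · subst hij; simpa using h' i
    · simpa [Matrix.one_apply_ne hij] using h i j hij
  choose a ha using this
  refine ⟨b 0 0, Matrix.of a, ?_⟩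
  ext i j
  have := ha i j
  simp only [Matrix.add_apply, Matrix.smul_apply, Matrix.of_apply, smul_eq_mul]
  linear_combination this

theorem nf_exists (k : ℕ) (hk : k ≠ 0) (a : M3 (ZMod (p ^ k))) (ha : ¬ Sc p a) : ∃ b c d g h, Sim a (NF b c d g h) := by
  by_contra hn
  have key : ∀ v f : Fin 3 → ZMod (p ^ k), ∃ y, (Matrix.of fun r s => ![v r, a.mulVec v r, f r] s : M3 (ZMod (p ^ k))).det = (p : ZMod (p ^ k)) * y := by
    intro v f
    rw [← nu_iff p k hk]
    exact fun h => hn (sim_NF a v f h)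
  apply ha
  obtain ⟨y1, h1⟩ := key ![1, 0, 0] ![0, 0, 1]
  obtain ⟨y2, h2⟩ := key ![1, 0, 0] ![0, 1, 0]
  obtain ⟨y3, h3⟩ := key ![0, 1, 0] ![0, 0, 1]
  obtain ⟨y4, h4⟩ := key ![0, 1, 0] ![1, 0, 0]
  obtain ⟨y5, h5⟩ := key ![0, 0, 1] ![0, 1, 0]
  obtain ⟨y6, h6⟩ := key ![0, 0, 1] ![1, 0, 0]
  obtain ⟨y7, h7⟩ := key ![1, 1, 0] ![0, 0, 1]
  obtain ⟨y8, h8⟩ := key ![1, 0, 1] ![0, 1, 0]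
  simp [Matrix.det_fin_three, Matrix.mulVec, dotProduct, Fin.sum_univ_three] at h1 h2 h3 h4 h5 h6 h7 h8
  apply sc_of
  · intro i j hij
    fin_cases i <;> fin_cases j <;> simp at hij ⊢
    all_goals first
      | exact ⟨y1, by linear_combination h1⟩
      | exact ⟨-y1, by linear_combination -h1⟩
      | exact ⟨y2, by linear_combination h2⟩
      | exact ⟨-y2, by linear_combination -h2⟩
      | exact ⟨y3, by linear_combination h3⟩
      | exact ⟨-y3, by linear_combination -h3⟩
      | exact ⟨y4, by linear_combination h4⟩
      | exact ⟨-y4, by linear_combination -h4⟩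
      | exact ⟨y5, by linear_combination h5⟩
      | exact ⟨-y5, by linear_combination -h5⟩
      | exact ⟨y6, by linear_combination h6⟩
      | exact ⟨-y6, by linear_combination -h6⟩
  · intro i
    fin_cases i
    · exact ⟨0, by simp⟩
    · simp
      exact ⟨y7 - y1 - y3, by linear_combination h7 - h1 - h3⟩
    · simp
      exact ⟨-y8 + y2 + y5, by linear_combination -h8 + h2 + h5⟩

theorem levelA (k : ℕ) (hk : k ≠ 0) (a : M3 (ZMod (p ^ k))) (ha : ¬ Sc p a) : ∃ j ≤ k, cent a = p ^ (3 * k + 2 * j) ∧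
    ∀ i (h : i ≤ k), Lv ((rd p i k h).mapMatrix a) ↔ i ≤ j := by
  obtain ⟨b, c, d, g, h, hs⟩ := nf_exists p k hk a ha
  obtain ⟨j, hj, ⟨n1, n2, n3, hu, h1, h2, h3⟩, hi⟩ := triple_val p k hk c (h ^ 2 - d * h - b) g
  refine ⟨j, hj, ?_, ?_⟩
  · unfold cent
    rw [hs.cent, Nat.card_congr (centEquiv b c d g h), Nat.card_prod, Nat.card_prod, h1, h2, h3, card_sys' p k j hj n1 n2 n3 hu, Nat.card_zmod]
    ring
  · intro i hik
    rw [← hi i hik]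
    have hs' := hs.map (rd p i k hik)
    have h4 : (rd p i k hik).mapMatrix (NF b c d g h) = NF (rd p i k hik b) (rd p i k hik c) (rd p i k hik d) (rd p i k hik g) (rd p i k hik h) := by
      ext r s; fin_cases r <;> fin_cases s <;> simp [NF]
    rw [h4] at hs'
    rw [show Lv ((rd p i k hik).mapMatrix a) ↔ _ from ⟨hs'.symm.lv, hs'.lv⟩, lv_NF]
    simp only [map_sub, map_mul, map_pow]

end PartG2

section PartG3

variable (p : ℕ) [hp : Fact p.Prime]

/-- primitive vectors -/
def Prim {R : Type} [CommRing R] (u : Fin 3 → R) : Prop := ∃ r, IsUnit (u r)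

theorem card_unit (t : ℕ) : Fintype.card (ZMod (p ^ (t + 1)))ˣ = p ^ t * (p - 1) := by
  rw [ZMod.card_units_eq_totient, Nat.totient_prime_pow_succ hp.out]

theorem card_nonunit (t : ℕ) : Nat.card {x : ZMod (p ^ (t + 1)) // ¬ IsUnit x} = p ^ t := by
  classical
  have h1 : Fintype.card {x : ZMod (p ^ (t + 1)) // IsUnit x} = p ^ t * (p - 1) := by
    rw [← card_unit]
    exact Fintype.card_congr (Equiv.ofBijective (fun u : (ZMod (p ^ (t + 1)))ˣ => (⟨u, u.isUnit⟩ : {x : ZMod (p ^ (t + 1)) // IsUnit x}))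
      ⟨fun a b h => Units.ext (congrArg Subtype.val h), fun x => ⟨x.2.unit, Subtype.ext rfl⟩⟩).symm
  have h2 := Fintype.card_subtype_compl (fun x : ZMod (p ^ (t + 1)) => IsUnit x)
  rw [h1, ZMod.card] at h2
  rw [Nat.card_eq_fintype_card]
  rw [h2, pow_succ, ← Nat.mul_sub]
  have := hp.out.pos
  rw [show p - (p - 1) = 1 by omega, mul_one]

theorem card_prim (t : ℕ) : (Nat.card {u : Fin 3 → ZMod (p ^ (t + 1)) // Prim u} : ℝ) = (p : ℝ) ^ (3 * t) * ((p : ℝ) ^ 3 - 1) := by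
  classical
  have h2 := Fintype.card_subtype_compl (fun u : Fin 3 → ZMod (p ^ (t + 1)) => Prim u)
  have h3 : Fintype.card {u : Fin 3 → ZMod (p ^ (t + 1)) // ¬ Prim u} = (p ^ t) ^ 3 := by
    have hcn := card_nonunit p t
    rw [Nat.card_eq_fintype_card] at hcn
    have : Fintype.card (Fin 3 → {x : ZMod (p ^ (t + 1)) // ¬ IsUnit x}) = Fintype.card {x : ZMod (p ^ (t + 1)) // ¬ IsUnit x} ^ 3 := by
      rw [Fintype.card_fun, Fintype.card_fin]
    rw [hcn] at this
    refine Eq.trans ?_ this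
    refine Fintype.card_congr ((Equiv.subtypeEquivRight fun u => ?_).trans (Equiv.subtypePiEquivPi (p := fun _ x => ¬ IsUnit x)))
    simp [Prim]
  have h4 := Fintype.card_subtype_le (fun u : Fin 3 → ZMod (p ^ (t + 1)) => Prim u)
  rw [h3] at h2
  have h5 : Fintype.card (Fin 3 → ZMod (p ^ (t + 1))) = (p ^ (t + 1)) ^ 3 := by
    rw [Fintype.card_fun, Fintype.card_fin, ZMod.card]
  rw [h5] at h2 h4
  rw [Nat.card_eq_fintype_card]
  have h6 : Fintype.card {u : Fin 3 → ZMod (p ^ (t + 1)) // Prim u} + (p ^ t) ^ 3 = (p ^ (t + 1)) ^ 3 := by omega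
  have h7 : (Fintype.card {u : Fin 3 → ZMod (p ^ (t + 1)) // Prim u} : ℝ) + ((p : ℝ) ^ t) ^ 3 = ((p : ℝ) ^ (t + 1)) ^ 3 := by exact_mod_cast h6
  rw [pow_mul']
  linear_combination h7

theorem lv_unique (k : ℕ) (hk : k ≠ 0) (b : M3 (ZMod (p ^ k))) (hb : ¬ Sc p b) (l l' : ZMod (p ^ k)) (u w u' w' : Fin 3 → ZMod (p ^ k))
    (h : b = l • 1 + Matrix.vecMulVec u w) (h' : b = l' • 1 + Matrix.vecMulVec u' w') : l = l' := by
  obtain ⟨b', c, d, g, x, P, hP⟩ := nf_exists p k hk b hb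
  have key : ∀ (l : ZMod (p ^ k)) (u w : Fin 3 → ZMod (p ^ k)), b = l • 1 + Matrix.vecMulVec u w → x = l := by
    intro l u w h
    have h1 : NF b' c d g x = l • 1 + Matrix.vecMulVec (Matrix.mulVec ((P⁻¹ : (M3 (ZMod (p ^ k)))ˣ) : M3 (ZMod (p ^ k))) u) (Matrix.vecMul w (P : M3 (ZMod (p ^ k)))) := by
      rw [← Matrix.vecMulVec_mul, ← Matrix.mul_vecMulVec]
      have hh : NF b' c d g x = ((P⁻¹ : (M3 (ZMod (p ^ k)))ˣ) : M3 (ZMod (p ^ k))) * (b * P) := by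
        rw [← hP, ← mul_assoc, Units.inv_mul, one_mul]
      rw [hh, h]
      rw [add_mul, mul_add, smul_mul_assoc, one_mul, mul_smul_comm, Units.inv_mul, mul_assoc]
    generalize Matrix.mulVec ((P⁻¹ : (M3 (ZMod (p ^ k)))ˣ) : M3 (ZMod (p ^ k))) u = u at h1
    generalize Matrix.vecMul w (P : M3 (ZMod (p ^ k))) = w at h1
    have H' : ∀ i j, NF b' c d g x i j = l * (1 : M3 (ZMod (p ^ k))) i j + u i * w j := by
      intro i j; rw [h1]; simp [Matrix.vecMulVec_apply]
    have e10 := H' 1 0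
    have e20 := H' 2 0
    have e22 := H' 2 2
    simp [NF] at e10 e20 e22
    linear_combination e22 + u 2 * w 2 * e10 - u 1 * w 2 * e20
  exact (key l u w h).symm.trans (key l' u' w' h')

theorem not_sc (k : ℕ) (hk : k ≠ 0) (l : ZMod (p ^ k)) (u w : Fin 3 → ZMod (p ^ k)) (hu : Prim u) (hw : Prim w) : ¬ Sc p (l • 1 + Matrix.vecMulVec u w) := by
  rintro ⟨c, a, h⟩
  obtain ⟨r, hr⟩ := hu
  obtain ⟨s, hs⟩ := hw
  have H : ∀ i j, (l - c) * (1 : M3 (ZMod (p ^ k))) i j + u i * w j = (p : ZMod (p ^ k)) * a i j := by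
    intro i j
    have := congrFun (congrFun h i) j
    simp only [Matrix.add_apply, Matrix.smul_apply, Matrix.vecMulVec_apply, smul_eq_mul] at this
    linear_combination this
  have hrs : ∀ y, u r * w s ≠ (p : ZMod (p ^ k)) * y := fun y hy => (nu_iff p k hk _).2 ⟨y, hy⟩ (hr.mul hs)
  by_cases hrs' : r = s
  · subst hrs'
    have hne : r ≠ r + 1 := by fin_cases r <;> simp
    have h1 := H r (r + 1)
    have h2 := H (r + 1) (r + 1)
    have h3 := H r r
    rw [Matrix.one_apply_ne hne] at h1
    rw [Matrix.one_apply_eq] at h2 h3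
    obtain ⟨v, hv⟩ := hr
    have hv' : u r * ((v⁻¹ : (ZMod (p ^ k))ˣ) : ZMod (p ^ k)) = 1 := by rw [← hv, Units.mul_inv]
    generalize ((v⁻¹ : (ZMod (p ^ k))ˣ) : ZMod (p ^ k)) = z at hv'
    apply hrs (a r r - a (r + 1) (r + 1) + u (r + 1) * z * a r (r + 1))
    linear_combination h3 - h2 + u (r + 1) * z * h1 - u (r + 1) * w (r + 1) * hv'
  · have := H r s
    rw [Matrix.one_apply_ne hrs'] at this
    exact hrs (a r s) (by linear_combination this)

theorem prim_of (k : ℕ) (hk : k ≠ 0) (l : ZMod (p ^ k)) (u w : Fin 3 → ZMod (p ^ k)) (h : ¬ Sc p (l • 1 + Matrix.vecMulVec u w)) : Prim u ∧ Prim w := by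
  constructor
  · by_contra hu
    simp only [Prim, not_exists] at hu
    have : ∀ r, ∃ y, u r = (p : ZMod (p ^ k)) * y := fun r => (nu_iff p k hk _).1 (hu r)
    choose y hy using this
    exact h ⟨l, Matrix.vecMulVec y w, by ext i j; simp [Matrix.vecMulVec_apply, hy, mul_assoc]⟩
  · by_contra hu
    simp only [Prim, not_exists] at hu
    have : ∀ r, ∃ y, w r = (p : ZMod (p ^ k)) * y := fun r => (nu_iff p k hk _).1 (hu r)
    choose y hy using this
    exact h ⟨l, Matrix.vecMulVec u y, by ext i j; simp [Matrix.vecMulVec_apply, hy, mul_left_comm]⟩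

/-- parametrization of scalar plus rank one -/
def parL (k : ℕ) (hk : k ≠ 0) (d : ZMod (p ^ k) × {u : Fin 3 → ZMod (p ^ k) // Prim u} × {u : Fin 3 → ZMod (p ^ k) // Prim u}) :
    {b : M3 (ZMod (p ^ k)) // ¬ Sc p b ∧ Lv b} :=
  ⟨d.1 • 1 + Matrix.vecMulVec d.2.1.1 d.2.2.1, not_sc p k hk _ _ _ d.2.1.2 d.2.2.2, ⟨_, _, _, rfl⟩⟩

theorem parL_fiber (k : ℕ) (hk : k ≠ 0) (x : {b : M3 (ZMod (p ^ k)) // ¬ Sc p b ∧ Lv b}) :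
    Nat.card {d // parL p k hk d = x} = Fintype.card (ZMod (p ^ k))ˣ := by
  obtain ⟨b, hb, l, u, w, hl⟩ := x
  have hb' := hb
  rw [hl] at hb'
  obtain ⟨hu, hw⟩ := prim_of p k hk l u w hb'
  have hpt : ∀ t : (ZMod (p ^ k))ˣ, ∀ u : Fin 3 → ZMod (p ^ k), Prim u → Prim ((t : ZMod (p ^ k)) • u) := by
    rintro t u ⟨r, hr⟩
    exact ⟨r, t.isUnit.mul hr⟩
  rw [← Nat.card_eq_fintype_card]
  symm
  refine Nat.card_congr (Equiv.ofBijective (fun t : (ZMod (p ^ k))ˣ => ⟨(l, ⟨(t : ZMod (p ^ k)) • u, hpt t u hu⟩, ⟨((t⁻¹ : (ZMod (p ^ k))ˣ) : ZMod (p ^ k)) • w, hpt _ w hw⟩), ?_⟩) ⟨?_, ?_⟩)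
  · apply Subtype.ext
    change l • 1 + Matrix.vecMulVec ((t : ZMod (p ^ k)) • u) (((t⁻¹ : (ZMod (p ^ k))ˣ) : ZMod (p ^ k)) • w) = b
    rw [hl]
    congr 1
    ext i j
    simp only [Matrix.vecMulVec_apply, Pi.smul_apply, smul_eq_mul]
    have := Units.mul_inv t
    linear_combination u i * w j * this
  · intro t t' h
    have h1 := congrArg (fun z => z.1.2.1.1) h
    dsimp only at h1
    obtain ⟨r, hr⟩ := hu
    have h2 := congrFun h1 r
    simp only [Pi.smul_apply, smul_eq_mul] at h2
    exact Units.ext (hr.mul_right_cancel h2)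
  · rintro ⟨⟨l', ⟨u', hu'⟩, ⟨w', hw'⟩⟩, h⟩
    have h1 : l' • 1 + Matrix.vecMulVec u' w' = b := congrArg Subtype.val h
    have hll := lv_unique p k hk b hb l l' u w u' w' hl h1.symm
    subst hll
    rw [← h1] at hl
    have hl2 : Matrix.vecMulVec u' w' = Matrix.vecMulVec u w := add_left_cancel hl
    have hl' : ∀ i j, u' i * w' j = u i * w j := fun i j => congrFun (congrFun hl2 i) j
    have hr' : ∀ r s, IsUnit (u r) → IsUnit (w s) → IsUnit (u' r) := fun r s hr hs => isUnit_of_mul_isUnit_left (by rw [hl']; exact hr.mul hs : IsUnit (u' r * w' s))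
    have hw0 := hw
    obtain ⟨r, hr⟩ := hu
    obtain ⟨s, hs⟩ := hw0
    have hs' : IsUnit (w' s) := isUnit_of_mul_isUnit_right (by rw [hl']; exact hr.mul hs : IsUnit (u' r * w' s))
    have hr2 := hr' r s hr hs
    obtain ⟨v, hv⟩ := hs
    obtain ⟨v', hv'⟩ := hs'
    have e1 : ((v⁻¹ : (ZMod (p ^ k))ˣ) : ZMod (p ^ k)) * w s = 1 := by rw [← hv, Units.inv_mul]
    have e2 : ((v'⁻¹ : (ZMod (p ^ k))ˣ) : ZMod (p ^ k)) * w' s = 1 := by rw [← hv', Units.inv_mul]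
    refine ⟨v * v'⁻¹, ?_⟩
    apply Subtype.ext
    refine Prod.ext rfl (Prod.ext (Subtype.ext ?_) (Subtype.ext ?_))
    · funext i
      simp only [Pi.smul_apply, smul_eq_mul, Units.val_mul]
      rw [hv]
      have := hl' i s
      linear_combination (-((v'⁻¹ : (ZMod (p ^ k))ˣ) : ZMod (p ^ k))) * this + u' i * e2
    · funext j
      simp only [Pi.smul_apply, smul_eq_mul, mul_inv_rev, inv_inv, Units.val_mul]
      rw [hv']
      have h3 := hl' r s
      have h4 := hl' r j
      apply hr2.mul_left_cancel
      linear_combination ((v⁻¹ : (ZMod (p ^ k))ˣ) : ZMod (p ^ k)) * w j * h3 + u r * w j * e1 - h4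

theorem card_Lv (t : ℕ) : (Nat.card {b : M3 (ZMod (p ^ (t + 1))) // ¬ Sc p b ∧ Lv b} : ℝ) = (p : ℝ) ^ (6 * t + 1) * ((p : ℝ) ^ 3 - 1) ^ 2 / ((p : ℝ) - 1) := by
  classical
  have h1 : Nat.card (ZMod (p ^ (t + 1)) × {u : Fin 3 → ZMod (p ^ (t + 1)) // Prim u} × {u : Fin 3 → ZMod (p ^ (t + 1)) // Prim u}) =
      Nat.card {b : M3 (ZMod (p ^ (t + 1))) // ¬ Sc p b ∧ Lv b} * (p ^ t * (p - 1)) := by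
    rw [← Nat.card_congr (Equiv.sigmaFiberEquiv (parL p (t + 1) (Nat.succ_ne_zero t)))]
    rw [Nat.card_sigma]
    simp only [parL_fiber]
    rw [Finset.sum_const, card_unit, smul_eq_mul, Finset.card_univ, Nat.card_eq_fintype_card]
  rw [Nat.card_prod, Nat.card_prod, Nat.card_zmod] at h1
  have h2 : ((p ^ (t + 1) * (Nat.card {u : Fin 3 → ZMod (p ^ (t + 1)) // Prim u} * Nat.card {u : Fin 3 → ZMod (p ^ (t + 1)) // Prim u}) : ℕ) : ℝ) =
    ((Nat.card {b : M3 (ZMod (p ^ (t + 1))) // ¬ Sc p b ∧ Lv b} * (p ^ t * (p - 1)) : ℕ) : ℝ) := by rw [h1]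
  have hp1 : 1 ≤ p := hp.out.pos
  have hp2 : (1 : ℝ) < p := by exact_mod_cast hp.out.one_lt
  push_cast [Nat.cast_sub hp1] at h2
  rw [card_prim] at h2
  have h0 : (p : ℝ) - 1 ≠ 0 := by linarith
  have h00 : (p : ℝ) ^ t ≠ 0 := by positivity
  rw [eq_div_iff h0]
  apply mul_left_cancel₀ h00
  calc _ = _ := by ring
    _ = _ := h2.symm
    _ = _ := by ring

end PartG3

section PartG4

variable (p : ℕ) [hp : Fact p.Prime]

theorem rd_surj (i k : ℕ) (h : i ≤ k) : Function.Surjective (rd p i k h) := ZMod.castHom_surjective _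

theorem rdM_surj (i k : ℕ) (h : i ≤ k) : Function.Surjective ((rd p i k h).mapMatrix : M3 (ZMod (p ^ k)) →+* M3 (ZMod (p ^ i))) := by
  intro b
  choose a ha using rd_surj p i k h
  exact ⟨Matrix.of fun r s => a (b r s), by ext r s; simp [ha]⟩

theorem sc_rd (i k : ℕ) (h : i ≤ k) (hi : i ≠ 0) (b : M3 (ZMod (p ^ k))) : Sc p ((rd p i k h).mapMatrix b) ↔ Sc p b := by
  constructor
  · rintro ⟨c, a, hb⟩
    obtain ⟨c, rfl⟩ := rd_surj p i k h c
    obtain ⟨a, rfl⟩ := rdM_surj p i k h a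
    have h1 : ∀ r s, ∃ y, b r s - c * (1 : M3 (ZMod (p ^ k))) r s - (p : ZMod (p ^ k)) * a r s = (p : ZMod (p ^ k)) ^ i * y := by
      intro r s
      rw [← rd_zero_iff p i k h]
      have := congrFun (congrFun hb r) s
      simp only [RingHom.mapMatrix_apply, Matrix.map_apply, Matrix.add_apply, Matrix.smul_apply, smul_eq_mul] at this
      rw [map_sub, map_sub, this, map_mul, map_mul, map_natCast]
      have h1 : rd p i k h ((1 : M3 (ZMod (p ^ k))) r s) = (1 : M3 (ZMod (p ^ i))) r s := by
        rw [Matrix.one_apply, Matrix.one_apply]; split_ifs <;> simp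
      rw [h1]; ring
    choose y hy using h1
    refine ⟨c, a + (p : ZMod (p ^ k)) ^ (i - 1) • Matrix.of y, ?_⟩
    ext r s
    simp only [Matrix.add_apply, Matrix.smul_apply, smul_eq_mul, Matrix.of_apply]
    have := hy r s
    obtain ⟨i, rfl⟩ := Nat.exists_eq_succ_of_ne_zero hi
    rw [Nat.succ_eq_add_one, Nat.add_sub_cancel]
    rw [Nat.succ_eq_add_one] at this
    linear_combination this
  · rintro ⟨c, a, hb⟩
    refine ⟨rd p i k h c, (rd p i k h).mapMatrix a, ?_⟩
    rw [hb]
    ext r s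
    simp only [RingHom.mapMatrix_apply, Matrix.map_apply, Matrix.add_apply, Matrix.smul_apply, smul_eq_mul, map_add, map_mul, map_natCast]
    rw [Matrix.one_apply, Matrix.one_apply]; split_ifs <;> simp

theorem card_Ni (i k : ℕ) (h : i + 1 ≤ k) : (Nat.card {b : M3 (ZMod (p ^ k)) // ¬ Sc p b ∧ Lv ((rd p (i + 1) k h).mapMatrix b)} : ℝ) =
    (p : ℝ) ^ (9 * (k - (i + 1))) * ((p : ℝ) ^ (6 * i + 1) * ((p : ℝ) ^ 3 - 1) ^ 2 / ((p : ℝ) - 1)) := by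
  obtain ⟨c, h1, -, h2⟩ := sum_fiber_surj ((rd p (i + 1) k h).mapMatrix : M3 (ZMod (p ^ k)) →+* M3 (ZMod (p ^ (i + 1)))).toAddMonoidHom (rdM_surj p (i + 1) k h)
  have h3 := h2 (fun b => ¬ Sc p b ∧ Lv b)
  have h4 : Nat.card {b : M3 (ZMod (p ^ k)) // ¬ Sc p b ∧ Lv ((rd p (i + 1) k h).mapMatrix b)} = c * Nat.card {b : M3 (ZMod (p ^ (i + 1))) // ¬ Sc p b ∧ Lv b} := by
    rw [← h3]
    refine Nat.card_congr (Equiv.subtypeEquivRight fun b => ?_)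
    rw [← sc_rd p (i + 1) k h (Nat.succ_ne_zero i)]
    rfl
  rw [card_M3, card_M3] at h1
  have h5 : c = p ^ (9 * (k - (i + 1))) := by
    have h6 : 0 < (p ^ (i + 1)) ^ 9 := by have := hp.out.pos; positivity
    apply Nat.eq_of_mul_eq_mul_right h6
    rw [← h1, ← pow_mul, ← pow_mul, ← pow_add]
    congr 1; omega
  rw [h4, Nat.cast_mul, card_Lv, h5]; push_cast; rfl

/-- lifting -/
noncomputable def scMap (t : ℕ) (x : Fin p × M3 (ZMod (p ^ t))) : {b : M3 (ZMod (p ^ (t + 1))) // Sc p b} :=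
  ⟨((x.1 : ℕ) : ZMod (p ^ (t + 1))) • 1 + (p : ZMod (p ^ (t + 1))) • Function.surjInv (redM_surj p t 1) x.2, _, _, rfl⟩

theorem p_smul (t : ℕ) (x y : M3 (ZMod (p ^ (t + 1)))) : (p : ZMod (p ^ (t + 1))) • x = (p : ZMod (p ^ (t + 1))) • y ↔
    (red p t 1).mapMatrix x = (red p t 1).mapMatrix y := by
  rw [← sub_eq_zero, ← smul_sub, ← sub_eq_zero (a := (red p t 1).mapMatrix x), ← map_sub, redM_zero_iff, pow_one]

theorem scMap_bij (t : ℕ) : Function.Bijective (scMap p t) := by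
  constructor
  · rintro ⟨c, a⟩ ⟨c', a'⟩ h
    have h1 : ((c : ℕ) : ZMod (p ^ (t + 1))) • (1 : M3 (ZMod (p ^ (t + 1)))) + (p : ZMod (p ^ (t + 1))) • Function.surjInv (redM_surj p t 1) a =
      ((c' : ℕ) : ZMod (p ^ (t + 1))) • 1 + (p : ZMod (p ^ (t + 1))) • Function.surjInv (redM_surj p t 1) a' := congrArg Subtype.val h
    have h2 : c = c' := by
      have h3 := congrFun (congrFun h1 0) 0
      simp only [Matrix.add_apply, Matrix.smul_apply, smul_eq_mul, Matrix.one_apply_eq] at h3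
      have h4 := congrArg (rd p 1 (t + 1) (Nat.le_add_left _ _)) h3
      have h5 : (p : ZMod (p ^ 1)) = 0 := by simpa using zp_pow p 1
      simp only [map_add, map_mul, map_natCast, map_one, mul_one, h5, zero_mul, add_zero] at h4
      rw [ZMod.natCast_eq_natCast_iff', pow_one, Nat.mod_eq_of_lt c.2, Nat.mod_eq_of_lt c'.2] at h4
      exact Fin.ext h4
    subst h2
    have h3 := (p_smul p t _ _).1 (add_left_cancel h1)
    rw [Function.surjInv_eq (redM_surj p t 1) a, Function.surjInv_eq (redM_surj p t 1) a'] at h3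
    rw [h3]
  · rintro ⟨b, c, a, hb⟩
    obtain ⟨n, rfl⟩ := ZMod.natCast_zmod_surjective c
    refine ⟨(⟨n % p, Nat.mod_lt _ hp.out.pos⟩, (red p t 1).mapMatrix (a + ((n / p : ℕ) : ZMod (p ^ (t + 1))) • 1)), ?_⟩
    apply Subtype.ext
    have h1 := (p_smul p t _ _).2 (Function.surjInv_eq (redM_surj p t 1) ((red p t 1).mapMatrix (a + ((n / p : ℕ) : ZMod (p ^ (t + 1))) • 1)))
    change ((n % p : ℕ) : ZMod (p ^ (t + 1))) • (1 : M3 (ZMod (p ^ (t + 1)))) + _ = b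
    rw [h1, hb, smul_add, smul_smul, add_comm ((p : ZMod (p ^ (t + 1))) • a), ← add_assoc, ← add_smul, ← Nat.cast_mul, ← Nat.cast_add, Nat.mod_add_div]

theorem cent_scMap (t : ℕ) (x) : cent (scMap p t x).1 = p ^ 9 * cent x.2 := by
  obtain ⟨c, a⟩ := x
  obtain ⟨d, h1, -, h2⟩ := sum_fiber_surj ((red p t 1).mapMatrix : M3 (ZMod (p ^ (t + 1))) →+* M3 (ZMod (p ^ t))).toAddMonoidHom (redM_surj p t 1)
  have h3 := h2 (fun γ => a * γ = γ * a)
  rw [card_M3, card_M3] at h1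
  have h5 : d = p ^ 9 := by
    have h6 : 0 < (p ^ t) ^ 9 := by have := hp.out.pos; positivity
    apply Nat.eq_of_mul_eq_mul_right h6
    rw [← h1]; ring
  rw [← h5]
  change Nat.card _ = d * Nat.card _
  rw [← h3]
  refine Nat.card_congr (Equiv.subtypeEquivRight fun γ => ?_)
  have h7 := Function.surjInv_eq (redM_surj p t 1) a
  change (((c : ℕ) : ZMod (p ^ (t + 1))) • (1 : M3 (ZMod (p ^ (t + 1)))) + (p : ZMod (p ^ (t + 1))) • Function.surjInv (redM_surj p t 1) a) * γ =
     γ * (((c : ℕ) : ZMod (p ^ (t + 1))) • (1 : M3 (ZMod (p ^ (t + 1)))) + (p : ZMod (p ^ (t + 1))) • Function.surjInv (redM_surj p t 1) a) ↔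
     a * (red p t 1).mapMatrix γ = (red p t 1).mapMatrix γ * a
  rw [add_mul, mul_add, smul_mul_assoc, one_mul, mul_smul_comm, mul_one, add_right_inj, smul_mul_assoc, mul_smul_comm, p_smul, map_mul, map_mul, h7]

open Classical in
theorem sum_Sc (t : ℕ) (g : ℝ → ℝ) : (∑ b : M3 (ZMod (p ^ (t + 1))), if Sc p b then g (cent b / (p : ℝ) ^ (9 * (t + 1))) else 0) =
    p * ∑ a : M3 (ZMod (p ^ t)), g (cent a / (p : ℝ) ^ (9 * t)) := by
  rw [← Finset.sum_filter, Finset.sum_subtype (p := fun b => Sc p b) _ (by simp)]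
  rw [← Fintype.sum_equiv (Equiv.ofBijective _ (scMap_bij p t)) (fun x => g (cent x.2 / (p : ℝ) ^ (9 * t))) _ ?_]
  · rw [Fintype.sum_prod_type]
    simp
  · intro x
    rw [Equiv.ofBijective_apply, cent_scMap]
    congr 1
    have : (p : ℝ) ≠ 0 := by exact_mod_cast hp.out.ne_zero
    push_cast
    rw [mul_add, pow_add]
    field_simp

theorem card_N0 (t : ℕ) : (Nat.card {b : M3 (ZMod (p ^ (t + 1))) // ¬ Sc p b} : ℝ) = (p : ℝ) ^ (9 * (t + 1)) - (p : ℝ) ^ (9 * t + 1) := by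
  classical
  have h1 := sum_Sc p t (fun _ => 1)
  rw [Finset.sum_boole, Finset.sum_const, Finset.card_univ, card_M3] at h1
  have h2 := Finset.card_filter_add_card_filter_not (s := (Finset.univ : Finset (M3 (ZMod (p ^ (t + 1)))))) (fun b => Sc p b)
  rw [Finset.card_univ, card_M3] at h2
  have h3 : ((Finset.univ.filter fun b : M3 (ZMod (p ^ (t + 1))) => Sc p b).card : ℝ) + (Finset.univ.filter fun b : M3 (ZMod (p ^ (t + 1))) => ¬ Sc p b).card = ((p ^ (t + 1)) ^ 9 : ℕ) := by exact_mod_cast h2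
  rw [Nat.card_eq_fintype_card, Fintype.card_subtype]
  rw [h1] at h3
  push_cast at h3
  simp only [nsmul_eq_mul] at h3
  push_cast at h3
  rw [pow_mul', pow_add (p : ℝ) (9 * t), pow_mul' (p : ℝ) 9 t]
  linear_combination h3

theorem tele (T : ℝ) (k j n : ℕ) (hj : j ≤ k) (hn : k ≤ n) : T ^ (n - j) = T ^ n + ∑ i ∈ Finset.range k, if i + 1 ≤ j then T ^ (n - (i + 1)) - T ^ (n - i) else 0 := by
  rw [← Finset.sum_filter]
  have : (Finset.range k).filter (fun i => i + 1 ≤ j) = Finset.range j := by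
    ext i; simp; omega
  rw [this, Finset.sum_range_sub (fun i => T ^ (n - i))]
  simp

open Classical in
theorem sum_nSc (t : ℕ) (g : ℝ → ℝ) (T : ℝ) (hg : ∀ n : ℕ, g (((p : ℝ) ^ (2 * n))⁻¹) = T ^ n) :
   (∑ b : M3 (ZMod (p ^ (t + 1))), if ¬ Sc p b then g (cent b / (p : ℝ) ^ (9 * (t + 1))) else 0) =
    ((p : ℝ) ^ (9 * (t + 1)) - (p : ℝ) ^ (9 * t + 1)) * T ^ (3 * (t + 1)) +
     ∑ i ∈ Finset.range (t + 1), (T ^ (3 * (t + 1) - (i + 1)) - T ^ (3 * (t + 1) - i)) *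
      ((p : ℝ) ^ (9 * (t - i)) * ((p : ℝ) ^ (6 * i + 1) * ((p : ℝ) ^ 3 - 1) ^ 2 / ((p : ℝ) - 1))) := by
  have hp0 : (p : ℝ) ≠ 0 := by exact_mod_cast hp.out.ne_zero
  have key : ∀ b : M3 (ZMod (p ^ (t + 1))), (if ¬ Sc p b then g (cent b / (p : ℝ) ^ (9 * (t + 1))) else 0) =
      (if ¬ Sc p b then 1 else 0) * T ^ (3 * (t + 1)) + ∑ i ∈ Finset.range (t + 1), (T ^ (3 * (t + 1) - (i + 1)) - T ^ (3 * (t + 1) - i)) *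
        (if ¬ Sc p b ∧ ∃ h : i + 1 ≤ t + 1, Lv ((rd p (i + 1) (t + 1) h).mapMatrix b) then 1 else 0) := by
    intro b
    by_cases hb : Sc p b
    · simp [hb]
    obtain ⟨j, hj, h1, h2⟩ := levelA p (t + 1) (Nat.succ_ne_zero t) b hb
    have h3 : (cent b : ℝ) / (p : ℝ) ^ (9 * (t + 1)) = ((p : ℝ) ^ (2 * (3 * (t + 1) - j)))⁻¹ := by
      rw [h1]; push_cast
      rw [div_eq_iff (by positivity), eq_comm, inv_mul_eq_iff_eq_mul₀ (by positivity), ← pow_add]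
      congr 1; omega
    rw [h3, hg, tele T (t + 1) j (3 * (t + 1)) hj (by omega)]
    simp only [hb, not_false_eq_true, if_true, true_and, one_mul]
    congr 1
    refine Finset.sum_congr rfl fun i hi => ?_
    have hi' : i + 1 ≤ t + 1 := by simpa using hi
    simp only [hi', exists_true_left, h2, mul_ite, mul_one, mul_zero]
  rw [Finset.sum_congr rfl (fun b _ => key b), Finset.sum_add_distrib, ← Finset.sum_mul, Finset.sum_comm]
  congr 1
  · rw [Finset.sum_boole, ← card_N0, Nat.card_eq_fintype_card, Fintype.card_subtype]
  · refine Finset.sum_congr rfl fun i hi => ?_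
    have hi' : i + 1 ≤ t + 1 := by simpa using hi
    rw [← Finset.mul_sum, Finset.sum_boole]
    congr 1
    have := card_Ni p i (t + 1) hi'
    rw [show t + 1 - (i + 1) = t - i by omega] at this
    rw [← this, Nat.card_eq_fintype_card, Fintype.card_subtype]
    congr 2
    ext b
    simp [hi']

theorem Z_step (t : ℕ) (g : ℝ → ℝ) (T : ℝ) (hg : ∀ n : ℕ, g (((p : ℝ) ^ (2 * n))⁻¹) = T ^ n) :
   (∑ b : M3 (ZMod (p ^ (t + 1))), g (cent b / (p : ℝ) ^ (9 * (t + 1)))) = p * (∑ a : M3 (ZMod (p ^ t)), g (cent a / (p : ℝ) ^ (9 * t))) +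
    (((p : ℝ) ^ (9 * (t + 1)) - (p : ℝ) ^ (9 * t + 1)) * T ^ (3 * (t + 1)) +
     ∑ i ∈ Finset.range (t + 1), (T ^ (3 * (t + 1) - (i + 1)) - T ^ (3 * (t + 1) - i)) *
      ((p : ℝ) ^ (9 * (t - i)) * ((p : ℝ) ^ (6 * i + 1) * ((p : ℝ) ^ 3 - 1) ^ 2 / ((p : ℝ) - 1)))) := by
  classical
  rw [← sum_nSc p t g T hg, ← sum_Sc, ← Finset.sum_add_distrib]
  refine Finset.sum_congr rfl fun b _ => ?_
  by_cases hb : Sc p b <;> simp [hb]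

theorem Z_zero (g : ℝ → ℝ) (h : g 1 = 1) : (∑ b : M3 (ZMod (p ^ 0)), g (cent b / (p : ℝ) ^ (9 * 0))) = 1 := by
  haveI : Subsingleton (ZMod (p ^ 0)) := by rw [pow_zero]; infer_instance
  have hc : ∀ b : M3 (ZMod (p ^ 0)), cent b = 1 := by
    intro b
    rw [cent, Nat.card_eq_one_iff_unique]
    exact ⟨inferInstance, ⟨⟨0, Subsingleton.elim _ _⟩⟩⟩
  simp only [hc, mul_zero, pow_zero, Nat.cast_one, div_one]
  rw [h, Finset.sum_const, Finset.card_univ, Fintype.card_eq_one_iff.2 ⟨0, fun y => Subsingleton.elim _ _⟩]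
  simp

end PartG4

section PartG5

theorem lim_aux (X Y a b : ℝ) (hX0 : 0 < X) (hX : X < 1) (hY0 : 0 < Y) (hY : Y < 1) (W : ℕ → ℝ) (hW0 : W 0 = 1)
    (hW : ∀ t, W (t + 1) = W t + (a * X ^ (t + 1) + b * ∑ i ∈ Finset.range (t + 1), Y ^ (i + 1) * X ^ (t - i))) :
    Filter.Tendsto W Filter.atTop (nhds (1 + (a * X / (1 - X) + b * Y / ((1 - X) * (1 - Y))))) := by
  have h1 : ∀ n, W n = 1 + ∑ t ∈ Finset.range n, (a * X ^ (t + 1) + b * ∑ i ∈ Finset.range (t + 1), Y ^ (i + 1) * X ^ (t - i)) := by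
    intro n
    induction n with
    | zero => simp [hW0]
    | succ n ih => rw [Finset.sum_range_succ, ← add_assoc, ← ih, hW]
  have hsX : HasSum (fun n => X ^ n) (1 - X)⁻¹ := hasSum_geometric_of_lt_one hX0.le hX
  have hsY : HasSum (fun n => Y ^ n) (1 - Y)⁻¹ := hasSum_geometric_of_lt_one hY0.le hY
  have hnX : Summable (fun n => ‖X ^ n‖) := by simpa using hsX.summable.norm
  have hnY : Summable (fun n => ‖Y ^ n‖) := by simpa using hsY.summable.norm
  have h2 : HasSum (fun n => ∑ i ∈ Finset.range (n + 1), Y ^ i * X ^ (n - i)) ((1 - Y)⁻¹ * (1 - X)⁻¹) := by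
    have h3 := tsum_mul_tsum_eq_tsum_sum_range_of_summable_norm hnY hnX
    rw [hsX.tsum_eq, hsY.tsum_eq] at h3
    rw [h3]
    exact (summable_norm_sum_mul_range_of_summable_norm hnY hnX).of_norm.hasSum
  have h4 : HasSum (fun t => (a * X ^ (t + 1) + b * ∑ i ∈ Finset.range (t + 1), Y ^ (i + 1) * X ^ (t - i))) (a * X * (1 - X)⁻¹ + b * Y * ((1 - Y)⁻¹ * (1 - X)⁻¹)) := by
    have h5 := (hsX.mul_left (a * X)).add (h2.mul_left (b * Y))
    refine h5.congr_fun ?_ |> id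
    intro t
    congr 1
    · ring
    · rw [mul_assoc b]
      congr 1
      rw [Finset.mul_sum]
      refine Finset.sum_congr rfl fun i _ => ?_
      ring
  have h6 := (h4.tendsto_sum_nat).const_add 1
  have e : (1 + (a * X / (1 - X) + b * Y / ((1 - X) * (1 - Y)))) = 1 + (a * X * (1 - X)⁻¹ + b * Y * ((1 - Y)⁻¹ * (1 - X)⁻¹)) := by
    rw [div_eq_mul_inv, div_eq_mul_inv, mul_inv, mul_comm (1 - X)⁻¹ (1 - Y)⁻¹]
  rw [e]
  refine h6.congr fun n => (h1 n).symm

variable (p : ℕ) [hp : Fact p.Prime]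

theorem W_step (t : ℕ) (g : ℝ → ℝ) (T : ℝ) (hg : ∀ n : ℕ, g (((p : ℝ) ^ (2 * n))⁻¹) = T ^ n) :
   ((p : ℝ) ^ (t + 1))⁻¹ * (∑ b : M3 (ZMod (p ^ (t + 1))), g (cent b / (p : ℝ) ^ (9 * (t + 1)))) =
    ((p : ℝ) ^ t)⁻¹ * (∑ a : M3 (ZMod (p ^ t)), g (cent a / (p : ℝ) ^ (9 * t))) +
    ((1 - ((p : ℝ) ^ 8)⁻¹) * ((p : ℝ) ^ 8 * T ^ 3) ^ (t + 1) +
     (((p : ℝ) ^ 3 - 1) ^ 2 / ((p : ℝ) - 1) * ((p : ℝ) ^ 5)⁻¹ * (1 - T)) * ∑ i ∈ Finset.range (t + 1), ((p : ℝ) ^ 5 * T ^ 2) ^ (i + 1) * ((p : ℝ) ^ 8 * T ^ 3) ^ (t - i)) := by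
  have hp0 : (p : ℝ) ≠ 0 := by exact_mod_cast hp.out.ne_zero
  rw [Z_step p t g T hg, mul_add, mul_add]
  congr 1
  · rw [pow_succ]; field_simp
  congr 1
  · rw [mul_pow, ← pow_mul, ← pow_mul]
    rw [show 9 * (t + 1) = (t + 1) + 8 * (t + 1) by ring, show 9 * t + 1 = (t + 1) + 8 * t by ring, show 8 * (t + 1) = 8 * t + 8 by ring]
    rw [pow_add _ (t + 1), pow_add _ (t + 1), pow_add _ (8 * t)]
    field_simp
  · rw [Finset.mul_sum, Finset.mul_sum]
    refine Finset.sum_congr rfl fun i hi => ?_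
    have hi' : i ≤ t := by simpa [Nat.lt_succ_iff] using hi
    obtain ⟨j, rfl⟩ := Nat.exists_eq_add_of_le hi'
    rw [Nat.add_sub_cancel_left, show 3 * (i + j + 1) - (i + 1) = 2 * (i + 1) + 3 * j by omega, show 3 * (i + j + 1) - i = 2 * (i + 1) + 3 * j + 1 by omega]
    rw [mul_pow, mul_pow, ← pow_mul, ← pow_mul, ← pow_mul, ← pow_mul]
    have e : (p : ℝ) ^ (9 * j) * (p : ℝ) ^ (6 * i + 1) * (p : ℝ) ^ 5 = (p : ℝ) ^ (i + j + 1) * (p : ℝ) ^ (5 * (i + 1)) * (p : ℝ) ^ (8 * j) := by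
      rw [← pow_add, ← pow_add, ← pow_add, ← pow_add]; congr 1; ring
    have e' : (p : ℝ) ^ (9 * j) * (p : ℝ) ^ (6 * i + 1) = (p : ℝ) ^ (i + j + 1) * (p : ℝ) ^ (5 * (i + 1)) * (p : ℝ) ^ (8 * j) * ((p : ℝ) ^ 5)⁻¹ := by
      rw [← e]; field_simp
    calc _ = ((p : ℝ) ^ (i + j + 1))⁻¹ * ((p : ℝ) ^ (9 * j) * (p : ℝ) ^ (6 * i + 1)) * (T ^ (2 * (i + 1) + 3 * j) * (1 - T) * (((p : ℝ) ^ 3 - 1) ^ 2 / ((p : ℝ) - 1))) := by ring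
      _ = (((p : ℝ) ^ (i + j + 1))⁻¹ * (p : ℝ) ^ (i + j + 1)) * ((p : ℝ) ^ (5 * (i + 1)) * (p : ℝ) ^ (8 * j) * ((p : ℝ) ^ 5)⁻¹) * (T ^ (2 * (i + 1) + 3 * j) * (1 - T) * (((p : ℝ) ^ 3 - 1) ^ 2 / ((p : ℝ) - 1))) := by rw [e']; ring
      _ = _ := by rw [inv_mul_cancel₀ (by positivity)]; ring

/-- the limit -/
noncomputable def zlim (s : ℝ) : ℝ := (let u : ℝ → ℝ := fun x => x ^ 3 + x ^ 2 - x - 1 - x⁻¹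
           (1 + u (p : ℝ) * (p : ℝ) ^ (-3 - 2 * s) + u ((p : ℝ)⁻¹) * (p : ℝ) ^ (-2 - 3 * s) +
             (p : ℝ) ^ (-5 - 5 * s)) /
           ((1 - (p : ℝ) ^ (1 - 2 * s)) * (1 - (p : ℝ) ^ (2 - 3 * s))))

theorem W_lim (s : ℝ) (hs : 2 / 3 < s) : Filter.Tendsto (fun k : ℕ => ((p : ℝ) ^ k)⁻¹ * ∑ b : M3 (ZMod (p ^ k)),
   ((p : ℝ) ^ (9 * k) / cent b) ^ (-s / 2) * (cent b / (p : ℝ) ^ (9 * k))) Filter.atTop (nhds (zlim p s)) := by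
  have hp1 : (1 : ℝ) < p := by exact_mod_cast hp.out.one_lt
  have hp0 : (0 : ℝ) < p := by linarith
  set T : ℝ := (p : ℝ) ^ (-2 - s) with hT
  have hT0 : 0 < T := Real.rpow_pos_of_pos hp0 _
  have hg : ∀ n : ℕ, (fun x : ℝ => x ^ (1 + s / 2)) (((p : ℝ) ^ (2 * n))⁻¹) = T ^ n := by
    intro n
    dsimp only
    rw [← Real.rpow_natCast p, ← Real.rpow_neg hp0.le, ← Real.rpow_mul hp0.le, hT, ← Real.rpow_natCast, ← Real.rpow_mul hp0.le]
    congr 1; push_cast; ring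
  have h1 : ∀ (k : ℕ) (b : M3 (ZMod (p ^ k))), ((p : ℝ) ^ (9 * k) / cent b) ^ (-s / 2) * (cent b / (p : ℝ) ^ (9 * k)) = (fun x : ℝ => x ^ (1 + s / 2)) (cent b / (p : ℝ) ^ (9 * k)) := by
    intro k b
    have hc : 0 < cent b := by
      haveI : Nonempty {γ : M3 (ZMod (p ^ k)) // b * γ = γ * b} := ⟨⟨0, by rw [mul_zero, zero_mul]⟩⟩
      exact Nat.card_pos
    have hc' : (0 : ℝ) < cent b := by exact_mod_cast hc
    have hx : 0 < (cent b : ℝ) / (p : ℝ) ^ (9 * k) := by positivity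
    dsimp only
    rw [← inv_div, Real.inv_rpow hx.le, ← Real.rpow_neg hx.le, Real.rpow_add hx, Real.rpow_one, mul_comm]
    congr 2; ring
  simp only [h1]
  have hX : (p : ℝ) ^ 8 * T ^ 3 = (p : ℝ) ^ (2 - 3 * s) := by
    rw [hT, ← Real.rpow_natCast p, ← Real.rpow_natCast _ 3, ← Real.rpow_mul hp0.le, ← Real.rpow_add hp0]
    congr 1; push_cast; ring
  have hY : (p : ℝ) ^ 5 * T ^ 2 = (p : ℝ) ^ (1 - 2 * s) := by
    rw [hT, ← Real.rpow_natCast p, ← Real.rpow_natCast _ 2, ← Real.rpow_mul hp0.le, ← Real.rpow_add hp0]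
    congr 1; push_cast; ring
  have hX1 : (p : ℝ) ^ 8 * T ^ 3 < 1 := by
    rw [hX]; exact Real.rpow_lt_one_of_one_lt_of_neg hp1 (by linarith)
  have hY1 : (p : ℝ) ^ 5 * T ^ 2 < 1 := by
    rw [hY]; exact Real.rpow_lt_one_of_one_lt_of_neg hp1 (by linarith)
  have h2 := lim_aux ((p : ℝ) ^ 8 * T ^ 3) ((p : ℝ) ^ 5 * T ^ 2) _ _ (by positivity) hX1 (by positivity) hY1
    (fun k : ℕ => ((p : ℝ) ^ k)⁻¹ * ∑ b : M3 (ZMod (p ^ k)), (fun x : ℝ => x ^ (1 + s / 2)) (cent b / (p : ℝ) ^ (9 * k)))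
    (by have := Z_zero p (fun x : ℝ => x ^ (1 + s / 2)) (by simp); simp only [this]; simp)
    (fun t => W_step p t (fun x : ℝ => x ^ (1 + s / 2)) T hg)
  have e1 : (p : ℝ) ^ (-3 - 2 * s) = (p : ℝ) * T ^ 2 := by
    rw [hT, ← Real.rpow_natCast _ 2, ← Real.rpow_mul hp0.le]
    nth_rewrite 2 [← Real.rpow_one (p : ℝ)]
    rw [← Real.rpow_add hp0]; congr 1; push_cast; ring
  have e2 : (p : ℝ) ^ (-2 - 3 * s) = (p : ℝ) ^ 4 * T ^ 3 := by
    rw [hT, ← Real.rpow_natCast p, ← Real.rpow_natCast _ 3, ← Real.rpow_mul hp0.le, ← Real.rpow_add hp0]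
    congr 1; push_cast; ring
  have e3 : (p : ℝ) ^ (-5 - 5 * s) = (p : ℝ) ^ 5 * T ^ 5 := by
    rw [hT, ← Real.rpow_natCast p, ← Real.rpow_natCast _ 5, ← Real.rpow_mul hp0.le, ← Real.rpow_add hp0]
    congr 1; push_cast; ring
  have e4 : zlim p s = 1 + ((1 - ((p : ℝ) ^ 8)⁻¹) * ((p : ℝ) ^ 8 * T ^ 3) / (1 - ((p : ℝ) ^ 8 * T ^ 3)) +
    (((p : ℝ) ^ 3 - 1) ^ 2 / ((p : ℝ) - 1) * ((p : ℝ) ^ 5)⁻¹ * (1 - T)) * ((p : ℝ) ^ 5 * T ^ 2) / ((1 - ((p : ℝ) ^ 8 * T ^ 3)) * (1 - ((p : ℝ) ^ 5 * T ^ 2)))) := by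
    rw [zlim, e1, e2, e3, ← hX, ← hY]
    have hx : 1 - ((p : ℝ) ^ 8 * T ^ 3) ≠ 0 := by linarith
    have hy : 1 - ((p : ℝ) ^ 5 * T ^ 2) ≠ 0 := by linarith
    have hc : ((p : ℝ) ^ 3 - 1) ^ 2 / ((p : ℝ) - 1) = ((p : ℝ) ^ 3 - 1) * ((p : ℝ) ^ 2 + p + 1) := by
      rw [div_eq_iff (by linarith)]; ring
    rw [hc]
    dsimp only
    generalize (p : ℝ) = q at *
    clear_value T
    clear hT e1 e2 e3 hX hY hg h1 h2
    field_simp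
    ring
  rw [e4]
  exact h2

end PartG5

section PartH

theorem nss {G : Type*} [Group G] {n : ℕ} (ρ : G →* GL (Fin n) ℂ) (H : Subgroup G) (δ : ℝ) (hδ0 : 0 ≤ δ) (hnδ : (n : ℝ) * δ ≤ 1 / 2)
    (hb : ∀ h ∈ H, ∀ i j, ‖(ρ h : Matrix (Fin n) (Fin n) ℂ) i j - (1 : Matrix (Fin n) (Fin n) ℂ) i j‖ ≤ δ) : ∀ h ∈ H, ρ h = 1 := by
  have key : ∀ r : ℕ, ∀ h ∈ H, ∀ i j, ‖(ρ h : Matrix (Fin n) (Fin n) ℂ) i j - (1 : Matrix (Fin n) (Fin n) ℂ) i j‖ ≤ (3 / 4) ^ r * δ := by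
    intro r
    induction r with
    | zero => simpa using hb
    | succ r ih =>
      intro h hh i j
      set A : Matrix (Fin n) (Fin n) ℂ := (ρ h : Matrix (Fin n) (Fin n) ℂ) - 1 with hA
      have hA1 : ∀ i j, ‖A i j‖ ≤ (3 / 4) ^ r * δ := fun i j => ih h hh i j
      have hA2 : ∀ i j, ‖A i j‖ ≤ δ := fun i j => hb h hh i j
      have hA3 := ih (h * h) (H.mul_mem hh hh) i j
      have e : (2 : ℂ) * A i j = ((ρ (h * h) : Matrix (Fin n) (Fin n) ℂ) i j - (1 : Matrix (Fin n) (Fin n) ℂ) i j) - (A * A) i j := by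
        have : (2 : ℂ) • A = ((ρ (h * h) : Matrix (Fin n) (Fin n) ℂ) - 1) - A * A := by
          rw [map_mul, Units.val_mul, hA, two_smul]; noncomm_ring
        have := congrFun (congrFun this i) j
        simpa using this
      have e2 : ‖(A * A) i j‖ ≤ (n : ℝ) * ((3 / 4) ^ r * δ * δ) := by
        rw [Matrix.mul_apply]
        refine (norm_sum_le _ _).trans ?_
        calc _ ≤ ∑ k : Fin n, ((3 / 4) ^ r * δ * δ) := by
              refine Finset.sum_le_sum fun k _ => ?_
              rw [norm_mul]
              exact mul_le_mul (hA1 _ _) (hA2 _ _) (norm_nonneg _) (by positivity)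
          _ = _ := by simp
      have e3 : 2 * ‖A i j‖ ≤ (3 / 4) ^ r * δ + (n : ℝ) * ((3 / 4) ^ r * δ * δ) := by
        have : ‖(2 : ℂ) * A i j‖ = 2 * ‖A i j‖ := by rw [norm_mul]; simp
        rw [← this, e]
        exact (norm_sub_le _ _).trans (add_le_add hA3 e2)
      have e4 : (n : ℝ) * ((3 / 4) ^ r * δ * δ) ≤ (3 / 4) ^ r * δ * (1 / 2) := by
        calc _ = ((3 / 4) ^ r * δ) * ((n : ℝ) * δ) := by ring
          _ ≤ _ := mul_le_mul_of_nonneg_left hnδ (by positivity)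
      change ‖A i j‖ ≤ _
      rw [pow_succ]; linarith
  intro h hh
  apply Units.ext
  ext i j
  have h1 : Filter.Tendsto (fun r : ℕ => (3 / 4 : ℝ) ^ r * δ) Filter.atTop (nhds (0 * δ)) :=
    (tendsto_pow_atTop_nhds_zero_of_lt_one (by norm_num) (by norm_num)).mul_const δ
  rw [zero_mul] at h1
  have h2 := ge_of_tendsto' h1 (fun r => key r h hh i j)
  have h3 := norm_le_zero_iff.1 h2
  exact sub_eq_zero.1 h3

variable (p : ℕ) [hp : Fact p.Prime]

theorem KK_anti (a b : ℕ) (h : a ≤ b) : KK p b ≤ KK p a := by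
  intro g hg
  rw [mem_KK] at hg ⊢
  obtain ⟨x, hx⟩ := hg
  obtain ⟨c, rfl⟩ := Nat.exists_eq_add_of_le h
  exact ⟨((p : ℤ_[p]) ^ c) • x, by rw [hx, smul_smul, pow_add]⟩

theorem nhds_KK (m : ℕ) (P : KK p m → Prop) (hP : ∀ᶠ g in nhds (1 : KK p m), P g) :
    ∃ N : ℕ, ∀ g : KK p m, (g : Matrix.SpecialLinearGroup (Fin 3) ℤ_[p]) ∈ KK p N → P g := by
  by_contra hn
  push Not at hn
  choose g hg hgP using hn
  have h1 : Filter.Tendsto g Filter.atTop (nhds 1) := by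
    rw [tendsto_subtype_rng]
    have hi : Topology.IsInducing (fun g : Matrix.SpecialLinearGroup (Fin 3) ℤ_[p] => (g : M3 ℤ_[p])) := ⟨rfl⟩
    refine hi.tendsto_nhds_iff.2 ?_
    change Filter.Tendsto (fun N => ((g N).1 : M3 ℤ_[p])) Filter.atTop (nhds (1 : M3 ℤ_[p]))
    refine tendsto_pi_nhds.2 fun i => tendsto_pi_nhds.2 fun j => ?_
    rw [tendsto_iff_norm_sub_tendsto_zero]
    have hq : Filter.Tendsto (fun N : ℕ => ((p : ℝ)⁻¹) ^ N) Filter.atTop (nhds 0) :=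
      tendsto_pow_atTop_nhds_zero_of_lt_one (by positivity) (inv_lt_one_of_one_lt₀ (by exact_mod_cast hp.out.one_lt))
    refine squeeze_zero (fun _ => norm_nonneg _) (fun N => ?_) hq
    obtain ⟨x, hx⟩ := (mem_KK p N _).1 (hg N)
    rw [hx]
    simp only [Matrix.add_apply, Matrix.smul_apply, smul_eq_mul, add_sub_cancel_left]
    rw [norm_mul, norm_pow, PadicInt.norm_p]
    exact mul_le_of_le_one_right (by positivity) (PadicInt.norm_le_one _)
  obtain ⟨N, hN⟩ := (h1.eventually hP).exists
  exact hgP N hN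

theorem rep_trivial (m n : ℕ) (ρ : KK p m →* GL (Fin n) ℂ) (hρ : RepContinuous ρ) :
    ∃ N : ℕ, ∀ g : KK p m, (g : Matrix.SpecialLinearGroup (Fin 3) ℤ_[p]) ∈ KK p N → ρ g = 1 := by
  set δ : ℝ := 1 / (2 * (n + 1)) with hδ
  have hδ0 : 0 < δ := by positivity
  have hnδ : (n : ℝ) * δ ≤ 1 / 2 := by
    rw [hδ, mul_one_div, div_le_iff₀ (by positivity)]; linarith
  have h1 : ∀ᶠ g in nhds (1 : KK p m), ∀ i j, ‖(ρ g : Matrix (Fin n) (Fin n) ℂ) i j - (1 : Matrix (Fin n) (Fin n) ℂ) i j‖ ≤ δ := by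
    rw [Filter.eventually_all]; intro i
    rw [Filter.eventually_all]; intro j
    have hc : Continuous fun g : KK p m => ‖(ρ g : Matrix (Fin n) (Fin n) ℂ) i j - (1 : Matrix (Fin n) (Fin n) ℂ) i j‖ := by
      have h3 : Continuous fun g : KK p m => (ρ g : Matrix (Fin n) (Fin n) ℂ) i j := (continuous_apply j).comp ((continuous_apply i).comp hρ)
      exact (h3.sub continuous_const).norm
    have h2 := hc.tendsto (1 : KK p m)
    rw [map_one, Units.val_one, sub_self, norm_zero] at h2
    exact h2.eventually (Iic_mem_nhds hδ0)
  obtain ⟨N, hN⟩ := nhds_KK p m _ h1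
  exact ⟨N, fun g hg => nss ρ ((KK p N).subgroupOf (KK p m)) δ hδ0.le hnδ (fun h hh => hN h hh) g hg⟩

theorem hasSum_all (h3 : p ≠ 3) (m : ℕ) (hm : 2 ≤ m) (s : ℝ) (hs : 2 / 3 < s) :
    HasSum (fun x : IrrAll (KK p m) => (x.1 : ℝ) ^ (-s)) ((p : ℝ) ^ (8 * m) * zlim p s) := by
  classical
  haveI : NeZero m := ⟨by omega⟩
  have hp0 : (0 : ℝ) < p := by exact_mod_cast hp.out.pos
  choose N φ hφ1 hφ2 hφ3 using fun k => sl_count p h3 m k hm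
  have hsum : ∀ k, ∑ x ∈ Finset.univ.image (φ k), (x.1 : ℝ) ^ (-s) = (p : ℝ) ^ (8 * m) * (((p : ℝ) ^ k)⁻¹ * ∑ b : M3 (ZMod (p ^ k)),
     ((p : ℝ) ^ (9 * k) / cent b) ^ (-s / 2) * (cent b / (p : ℝ) ^ (9 * k))) := by
    intro k
    rw [Finset.sum_image (fun a _ b _ h => hφ1 k h)]
    have h1 := hφ3 k (fun x => x ^ (-s / 2))
    have h2 : ∀ i, (((φ k i).1 : ℝ) ^ 2) ^ (-s / 2) = ((φ k i).1 : ℝ) ^ (-s) := by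
      intro i
      rw [← Real.rpow_natCast, ← Real.rpow_mul (Nat.cast_nonneg _)]
      congr 1; push_cast; ring
    simp only [h2] at h1
    rw [mul_left_comm, ← h1, inv_mul_cancel_left₀ (by positivity)]
  have hlim : Filter.Tendsto (fun k => ∑ x ∈ Finset.univ.image (φ k), (x.1 : ℝ) ^ (-s)) Filter.atTop (nhds ((p : ℝ) ^ (8 * m) * zlim p s)) := by
    simp only [hsum]
    exact (W_lim p s hs).const_mul _
  have hev : ∀ x : IrrAll (KK p m), ∀ᶠ k in Filter.atTop, x ∈ Finset.univ.image (φ k) := by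
    rintro ⟨n, q⟩
    obtain ⟨ρ, rfl⟩ := Quot.exists_rep q
    obtain ⟨N₀, hN₀⟩ := rep_trivial p m n ρ.1 ρ.2.1
    filter_upwards [Filter.eventually_ge_atTop N₀] with k hk
    obtain ⟨i, hi⟩ := hφ2 k n ρ (fun g hg => hN₀ g (KK_anti p N₀ (k + m + m) (by omega) hg))
    rw [← hi]
    exact Finset.mem_image_of_mem _ (Finset.mem_univ _)
  refine hasSum_of_isLUB_of_nonneg _ (fun x => Real.rpow_nonneg (Nat.cast_nonneg _) _) ⟨?_, ?_⟩
  · rintro _ ⟨A, rfl⟩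
    have hA : ∀ᶠ k in Filter.atTop, ∀ x ∈ A, x ∈ Finset.univ.image (φ k) := (Finset.eventually_all A).2 fun x _ => hev x
    refine ge_of_tendsto hlim ?_
    filter_upwards [hA] with k hk
    exact Finset.sum_le_sum_of_subset_of_nonneg hk fun x _ _ => Real.rpow_nonneg (Nat.cast_nonneg _) _
  · intro B hB
    exact le_of_tendsto' hlim fun k => hB ⟨_, rfl⟩

theorem sigma_count (Q : ℕ → Type) (h0 : IsEmpty (Q 0)) (s L : ℝ) (h : HasSum (fun x : (Σ n, Q n) => (x.1 : ℝ) ^ (-s)) L) :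
    HasSum (fun n : ℕ => (Nat.card (Q (n + 1)) : ℝ) * ((n + 1 : ℕ) : ℝ) ^ (-s)) L := by
  have h1 : ∀ n, HasSum (fun c : Q n => (n : ℝ) ^ (-s)) ((Nat.card (Q n) : ℝ) * (n : ℝ) ^ (-s)) := by
    intro n
    have hfin : Finite (Q n) := by
      by_cases hn : n = 0
      · subst hn
        infer_instance
      · by_contra hinf
        rw [not_finite_iff_infinite] at hinf
        have h2 : Summable fun c : Q n => (n : ℝ) ^ (-s) :=
          Summable.sigma_factor (f := fun x : (Σ n, Q n) => (x.1 : ℝ) ^ (-s)) h.summable n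
        rw [summable_const_iff] at h2
        have : (0 : ℝ) < n := by exact_mod_cast Nat.pos_of_ne_zero hn
        exact (Real.rpow_pos_of_pos this _).ne' h2
    haveI := Fintype.ofFinite (Q n)
    have h2 := hasSum_fintype (fun c : Q n => (n : ℝ) ^ (-s))
    rw [Finset.sum_const, nsmul_eq_mul, Finset.card_univ, ← Nat.card_eq_fintype_card] at h2
    exact h2
  have h2 := HasSum.sigma h h1
  refine (hasSum_nat_add_iff (f := fun n : ℕ => (Nat.card (Q n) : ℝ) * (n : ℝ) ^ (-s)) 1 (g := L)).2 ?_
  have h3 : Nat.card (Q 0) = 0 := Nat.card_of_isEmpty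
  rw [Finset.sum_range_one, h3, Nat.cast_zero, zero_mul, add_zero]
  exact h2

theorem final_sum (h3 : p ≠ 3) (m : ℕ) (hm : 2 ≤ m) (s : ℝ) (hs : 2 / 3 < s) :
    HasSum (fun n : ℕ => (contIrrRepCount (KK p m) (n + 1) : ℝ) * ((n + 1 : ℕ) : ℝ) ^ (-s)) ((p : ℝ) ^ (8 * m) * zlim p s) :=
  sigma_count (fun n => Quot fun ρ₁ ρ₂ : {ρ : KK p m →* GL (Fin n) ℂ // RepContinuous ρ ∧ RepIsIrreducible ρ} => RepIso ρ₁.1 ρ₂.1)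
    ⟨fun q => by
      obtain ⟨ρ, rfl⟩ := Quot.exists_rep q
      exact ρ.2.2.1 (Subsingleton.elim _ _)⟩ s _ (hasSum_all p h3 m hm s hs)

end PartH

theorem representation_zeta_congruence_SL3_Zp (p : ℕ) [Fact p.Prime] (hp : p ≠ 3) :
    ∃ M : ℕ, ∀ m : ℕ, M ≤ m → ∀ s : ℝ, 2 / 3 < s →
      HasSum
        (fun n : ℕ =>
          (contIrrRepCount
              ((Matrix.SpecialLinearGroup.map (n := Fin 3) (PadicInt.toZModPow (p := p) m)).ker)
              (n + 1) : ℝ) *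
            ((n + 1 : ℕ) : ℝ) ^ (-s))
        (let u : ℝ → ℝ := fun x => x ^ 3 + x ^ 2 - x - 1 - x⁻¹
         (p : ℝ) ^ (8 * m) *
           (1 + u (p : ℝ) * (p : ℝ) ^ (-3 - 2 * s) + u ((p : ℝ)⁻¹) * (p : ℝ) ^ (-2 - 3 * s) +
             (p : ℝ) ^ (-5 - 5 * s)) /
           ((1 - (p : ℝ) ^ (1 - 2 * s)) * (1 - (p : ℝ) ^ (2 - 3 * s)))) := by
  refine ⟨2, fun m hm s hs => ?_⟩
  have h := final_sum p hp m hm s hs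
  rw [zlim, ← mul_div_assoc] at h
  exact h
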